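/- Let A, B and C be three abelian groups. Then there exists a group S such that: (i) S is strongly torsion generated; (ii) the centre of S is isomorphic to A; (iii) S is perfect, i.e. H_1(S) = 0; (iv) H_2(S) is isomorphic to B; (v) H_3(S) is isomorphic to C. -/

import Mathlib

open CategoryTheory AlgebraicTopology

/-- The chain complex (over `ℤ`) associated to the nerve of the one-object groupoid on a
group `G`, i.e. the simplicial chain complex of the classifying space `BG`; its homology in
positive degrees is the integral group homology of `G`. -/
noncomputable def classifyingComplex (G : Type) [Group G] : ChainComplex (ModuleCat ℤ) ℕ :=
  (alternatingFaceMapComplex (ModuleCat ℤ)).obj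
    (((SimplicialObject.whiskering (Type) (ModuleCat ℤ)).obj (ModuleCat.free ℤ)).obj
      (nerve (SingleObj G)))

/-- The integral group homology `H_n(G; ℤ)` of a group `G`. -/
noncomputable def grpHomology (G : Type) [Group G] (n : ℕ) : ModuleCat ℤ :=
  (classifyingComplex G).homology n

/-- A group `G` is strongly torsion generated if for every `n ≥ 2` there is an element of
order exactly `n` whose normal closure is all of `G`. -/
def StronglyTorsionGenerated (G : Type*) [Group G] : Prop :=
  ∀ n : ℕ, 2 ≤ n → ∃ g : G, orderOf g = n ∧ Subgroup.normalClosure {g} = ⊤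

namespace GH

/-- A bundled `ℤ`-representation of a group. -/
structure Rp (G : Type) [Group G] where
  V : Type
  [acg : AddCommGroup V]
  act : G → V →+ V
  act_one : ∀ v, act 1 v = v
  act_mul : ∀ g h v, act (g * h) v = act g (act h v)

attribute [instance] Rp.acg

section basic
variable {G G' G'' : Type} [Group G] [Group G'] [Group G'']

theorem Rp.act_inv_act (M : Rp G) (g : G) (v : M.V) : M.act g⁻¹ (M.act g v) = v := by
  rw [← M.act_mul, inv_mul_cancel, M.act_one]

theorem Rp.act_act_inv (M : Rp G) (g : G) (v : M.V) : M.act g (M.act g⁻¹ v) = v := by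
  rw [← M.act_mul, mul_inv_cancel, M.act_one]

/-- The map on finitely supported functions induced by maps on index and coefficients. -/
noncomputable def Fmap {X Y A B : Type} [AddCommGroup A] [AddCommGroup B] (f : X → Y) (φ : A →+ B) :
    (X →₀ A) →+ (Y →₀ B) :=
  Finsupp.liftAddHom fun x => (Finsupp.singleAddHom (f x)).comp φ

@[simp] theorem Fmap_single {X Y A B : Type} [AddCommGroup A] [AddCommGroup B] (f : X → Y)
    (φ : A →+ B) (x : X) (a : A) :
    Fmap f φ (Finsupp.single x a) = Finsupp.single (f x) (φ a) := by
  simp [Fmap]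

theorem Fmap_comp {X Y W A B D : Type} [AddCommGroup A] [AddCommGroup B] [AddCommGroup D]
    (f : X → Y) (φ : A →+ B) (f' : Y → W) (φ' : B →+ D) :
    (Fmap f' φ').comp (Fmap f φ) = Fmap (f' ∘ f) (φ'.comp φ) := by
  ext x a : 2
  simp

theorem Fmap_id {X A : Type} [AddCommGroup A] :
    Fmap (id : X → X) (AddMonoidHom.id A) = AddMonoidHom.id _ := by
  ext x a : 2
  simp

theorem Fmap_add {X Y A B : Type} [AddCommGroup A] [AddCommGroup B] (f : X → Y) (φ ψ : A →+ B) :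
    Fmap f (φ + ψ) = Fmap f φ + Fmap f ψ := by
  ext x a : 2
  simp

theorem Fmap_zero {X Y A B : Type} [AddCommGroup A] [AddCommGroup B] (f : X → Y) :
    Fmap f (0 : A →+ B) = 0 := by
  ext x a : 2
  simp

theorem Fmap_eq {X Y A B : Type} [AddCommGroup A] [AddCommGroup B] (f : X → Y) (φ : A →+ B)
    (z : X →₀ A) : Fmap f φ z = Finsupp.mapDomain f (z.mapRange φ φ.map_zero) := by
  have : Fmap f φ = (Finsupp.mapDomain.addMonoidHom f).comp (Finsupp.mapRange.addMonoidHom φ) := by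
    ext x a : 2
    simp
  rw [this]; rfl

theorem Fmap_inj {X Y A B : Type} [AddCommGroup A] [AddCommGroup B] {f : X → Y} {φ : A →+ B}
    (hf : Function.Injective f) (hφ : Function.Injective φ) : Function.Injective (Fmap f φ) := by
  intro a b h
  rw [Fmap_eq, Fmap_eq] at h
  exact Finsupp.mapRange_injective _ _ hφ (Finsupp.mapDomain_injective hf h)

theorem Fmap_surj {X Y A B : Type} [AddCommGroup A] [AddCommGroup B] {f : X → Y} {φ : A →+ B}
    (hf : Function.Surjective f) (hφ : Function.Surjective φ) : Function.Surjective (Fmap f φ) := by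
  intro z
  induction z using Finsupp.induction_linear with
  | zero => exact ⟨0, map_zero _⟩
  | add a b ha hb =>
    obtain ⟨x, rfl⟩ := ha
    obtain ⟨y, rfl⟩ := hb
    exact ⟨x + y, map_add _ _ _⟩
  | single y b =>
    obtain ⟨x, rfl⟩ := hf y
    obtain ⟨a, rfl⟩ := hφ b
    exact ⟨Finsupp.single x a, by simp⟩

theorem Fmap_exact {X A B D : Type} [AddCommGroup A] [AddCommGroup B] [AddCommGroup D]
    {i : A →+ B} {p : B →+ D} (h : ∀ b, p b = 0 → ∃ a, i a = b) (b : X →₀ B)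
    (hb : Fmap id p b = 0) : ∃ a, Fmap id i a = b := by
  have hb' : ∀ x, p (b x) = 0 := by
    intro x
    rw [Fmap_eq, Finsupp.mapDomain_id] at hb
    simpa using DFunLike.congr_fun hb x
  choose a ha using fun x => h (b x) (hb' x)
  classical
  refine ⟨Finsupp.onFinset b.support (fun x => if b x = 0 then 0 else a x) ?_, ?_⟩
  · intro x hx
    simp only [Finsupp.mem_support_iff]
    intro h0
    simp [h0] at hx
  · rw [Fmap_eq, Finsupp.mapDomain_id]
    ext x
    by_cases h0 : b x = 0
    · simp [h0]
    · simp [h0, ha]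

/-- The free cover of a representation. -/
noncomputable def F (M : Rp G) : Rp G where
  V := G →₀ M.V
  act g := Fmap (fun x => x * g⁻¹) (AddMonoidHom.id _)
  act_one v := by
    have : Fmap (fun x : G => x * 1⁻¹) (AddMonoidHom.id M.V) = AddMonoidHom.id _ := by
      ext x a : 2
      simp
    rw [this]; rfl
  act_mul g h v := by
    rw [← AddMonoidHom.comp_apply, Fmap_comp]
    congr 2
    ext x
    simp [mul_assoc]

/-- Typed version of `Finsupp.single`. -/
noncomputable def sg (M : Rp G) (x : G) : M.V →+ (F M).V := Finsupp.singleAddHom x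

theorem F_ext {M : Rp G} {A : Type*} [AddCommGroup A] {φ ψ : (F M).V →+ A}
    (h : ∀ x m, φ (sg M x m) = ψ (sg M x m)) : φ = ψ :=
  Finsupp.addHom_ext (M := M.V) h

theorem F_ext_apply {M : Rp G} {A : Type*} [AddCommGroup A] {φ ψ : (F M).V →+ A}
    (h : ∀ x m, φ (sg M x m) = ψ (sg M x m)) (z : (F M).V) : φ z = ψ z :=
  DFunLike.congr_fun (F_ext h) z

@[simp] theorem F_act_sg (M : Rp G) (g x : G) (m : M.V) :
    (F M).act g (sg M x m) = sg M (x * g⁻¹) m :=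
  Fmap_single _ _ _ _

/-- Lifting maps out of the free cover. -/
noncomputable def flift (M : Rp G) {A : Type*} [AddCommGroup A] (φ : G → M.V →+ A) : (F M).V →+ A :=
  Finsupp.liftAddHom φ

@[simp] theorem flift_sg (M : Rp G) {A : Type*} [AddCommGroup A] (φ : G → M.V →+ A) (x : G)
    (m : M.V) : flift M φ (sg M x m) = φ x m :=
  Finsupp.liftAddHom_apply_single _ _ _

/-- The structure map of the free cover. -/
noncomputable def av (M : Rp G) : (F M).V →+ M.V := flift M fun x => M.act x⁻¹

@[simp] theorem av_sg (M : Rp G) (x : G) (m : M.V) : av M (sg M x m) = M.act x⁻¹ m :=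
  flift_sg _ _ _ _

/-- The sum of coefficients. -/
noncomputable def sm (M : Rp G) : (F M).V →+ M.V := flift M fun _ => AddMonoidHom.id _

@[simp] theorem sm_sg (M : Rp G) (x : G) (m : M.V) : sm M (sg M x m) = m :=
  flift_sg _ _ _ _

/-- Functoriality of the free cover. -/
noncomputable def fm (f : G → G') {M : Rp G} {M' : Rp G'} (φ : M.V →+ M'.V) :
    (F M).V →+ (F M').V := Fmap f φ

@[simp] theorem fm_sg (f : G → G') {M : Rp G} {M' : Rp G'} (φ : M.V →+ M'.V) (x : G) (m : M.V) :
    fm f φ (sg M x m) = sg M' (f x) (φ m) :=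
  Fmap_single _ _ _ _

/-- Equivariance of an additive map along a group homomorphism. -/
def Eqv (f : G →* G') (M : Rp G) (M' : Rp G') (φ : M.V →+ M'.V) : Prop :=
  ∀ g m, φ (M.act g m) = M'.act (f g) (φ m)

theorem av_eqv (M : Rp G) : Eqv (MonoidHom.id G) (F M) M (av M) := by
  intro g m
  refine F_ext_apply (φ := (av M).comp ((F M).act g)) (ψ := (M.act g).comp (av M)) ?_ m
  intro x m
  simp [← M.act_mul]

theorem fm_eqv (f : G →* G') (M : Rp G) (M' : Rp G') (φ : M.V →+ M'.V) :
    Eqv f (F M) (F M') (fm f φ) := by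
  intro g m
  refine F_ext_apply (φ := (fm f φ).comp ((F M).act g)) (ψ := ((F M').act (f g)).comp (fm f φ)) ?_ m
  intro x m
  simp

theorem av_nat {f : G →* G'} {M : Rp G} {M' : Rp G'} {φ : M.V →+ M'.V} (h : Eqv f M M' φ) :
    φ.comp (av M) = (av M').comp (fm f φ) := by
  refine F_ext fun x a => ?_
  have := h x⁻¹ a
  simpa using this

theorem sm_nat {f : G → G'} {M : Rp G} {M' : Rp G'} (φ : M.V →+ M'.V) :
    φ.comp (sm M) = (sm M').comp (fm f φ) := by
  refine F_ext fun x a => ?_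
  simp

/-- Iterated free cover. -/
noncomputable def It : ℕ → Rp G → Rp G
  | 0, M => M
  | n + 1, M => It n (F M)

/-- Chains. -/
abbrev C (n : ℕ) (M : Rp G) : Type := (It n M).V

/-- Identification of chains. -/
noncomputable def up (n : ℕ) (M : Rp G) : C n (F M) ≃+ C (n + 1) M := AddEquiv.refl (C n (F M))

/-- Chain maps. -/
noncomputable def Cm (f : G → G') : ∀ (n : ℕ) {M : Rp G} {M' : Rp G'}, (M.V →+ M'.V) →
    (C n M →+ C n M')
  | 0, _, _, φ => φ
  | n + 1, _, _, φ => Cm f n (fm f φ)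

/-- Differential. -/
noncomputable def d : ∀ (n : ℕ) (M : Rp G), C (n + 1) M →+ C n M
  | 0, M => av M - sm M
  | n + 1, M => ((Cm (id : G → G) (n + 1) (av M)) -
      (up n M).toAddMonoidHom.comp (d n (F M))).comp (up (n + 1) M).symm.toAddMonoidHom

theorem Cm_up (n : ℕ) (f : G → G') {M : Rp G} {M' : Rp G'} (φ : M.V →+ M'.V) (c : C n (F M)) :
    Cm f (n + 1) φ (up n M c) = up n M' (Cm f n (fm f φ) c) := rfl

theorem d_zero_up (M : Rp G) (c : (F M).V) : d 0 M (up 0 M c) = av M c - sm M c := rfl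

theorem d_up (n : ℕ) (M : Rp G) (c : C (n + 1) (F M)) :
    d (n + 1) M (up (n + 1) M c) = Cm (id : G → G) (n + 1) (av M) c - up n M (d n (F M) c) := rfl

theorem fm_comp (f : G → G') (f' : G' → G'') {M : Rp G} {M' : Rp G'} {M'' : Rp G''}
    (φ : M.V →+ M'.V) (φ' : M'.V →+ M''.V) :
    (fm f' φ').comp (fm f φ) = fm (f' ∘ f) (φ'.comp φ) := F_ext fun x a => by simp

theorem fm_id (M : Rp G) : fm (id : G → G) (AddMonoidHom.id M.V) = AddMonoidHom.id _ :=
  F_ext fun x a => by simp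

theorem fm_add (f : G → G') {M : Rp G} {M' : Rp G'} (φ ψ : M.V →+ M'.V) :
    fm f (φ + ψ) = fm f φ + fm f ψ := F_ext fun x a => by simp

theorem fm_zero (f : G → G') {M : Rp G} {M' : Rp G'} :
    fm f (0 : M.V →+ M'.V) = 0 := F_ext fun x a => by simp

theorem Cm_id (n : ℕ) (M : Rp G) (c : C n M) : Cm (id : G → G) n (AddMonoidHom.id M.V) c = c := by
  induction n generalizing M with
  | zero => rfl
  | succ n ih =>
    obtain ⟨c, rfl⟩ := (up n M).surjective c
    rw [Cm_up, fm_id, ih]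

theorem Cm_comp (n : ℕ) (f : G → G') (f' : G' → G'') {M : Rp G} {M' : Rp G'} {M'' : Rp G''}
    (φ : M.V →+ M'.V) (φ' : M'.V →+ M''.V) (c : C n M) :
    Cm f' n φ' (Cm f n φ c) = Cm (f' ∘ f) n (φ'.comp φ) c := by
  induction n generalizing M M' M'' with
  | zero => rfl
  | succ n ih =>
    obtain ⟨c, rfl⟩ := (up n M).surjective c
    rw [Cm_up, Cm_up, Cm_up, ih, fm_comp]

theorem Cm_add (n : ℕ) (f : G → G') {M : Rp G} {M' : Rp G'} (φ ψ : M.V →+ M'.V) (c : C n M) :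
    Cm f n (φ + ψ) c = Cm f n φ c + Cm f n ψ c := by
  induction n generalizing M M' with
  | zero => rfl
  | succ n ih =>
    obtain ⟨c, rfl⟩ := (up n M).surjective c
    rw [Cm_up, Cm_up, Cm_up, fm_add, ih, map_add]

theorem Cm_zero (n : ℕ) (f : G → G') {M : Rp G} {M' : Rp G'} (c : C n M) :
    Cm f n (0 : M.V →+ M'.V) c = 0 := by
  induction n generalizing M M' with
  | zero => rfl
  | succ n ih =>
    obtain ⟨c, rfl⟩ := (up n M).surjective c
    rw [Cm_up, fm_zero, ih, map_zero]

theorem Cm_inj (n : ℕ) {f : G → G'} {M : Rp G} {M' : Rp G'} {φ : M.V →+ M'.V}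
    (hf : Function.Injective f) (hφ : Function.Injective φ) : Function.Injective (Cm f n φ) := by
  induction n generalizing M M' with
  | zero => exact hφ
  | succ n ih => exact ih (φ := fm f φ) (Fmap_inj hf hφ)

theorem Cm_surj (n : ℕ) {f : G → G'} {M : Rp G} {M' : Rp G'} {φ : M.V →+ M'.V}
    (hf : Function.Surjective f) (hφ : Function.Surjective φ) : Function.Surjective (Cm f n φ) := by
  induction n generalizing M M' with
  | zero => exact hφ
  | succ n ih => exact ih (φ := fm f φ) (Fmap_surj hf hφ)

theorem Cm_exact (n : ℕ) {M M' M'' : Rp G} {i : M.V →+ M'.V} {p : M'.V →+ M''.V}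
    (h : ∀ b, p b = 0 → ∃ a, i a = b) (b : C n M') (hb : Cm (id : G → G) n p b = 0) :
    ∃ a, Cm (id : G → G) n i a = b := by
  induction n generalizing M M' M'' with
  | zero => exact h b hb
  | succ n ih =>
    exact ih (i := fm id i) (p := fm id p) (Fmap_exact h) b hb

theorem d_nat (n : ℕ) {f : G →* G'} {M : Rp G} {M' : Rp G'} {φ : M.V →+ M'.V} (h : Eqv f M M' φ)
    (c : C (n + 1) M) : Cm f n φ (d n M c) = d n M' (Cm f (n + 1) φ c) := by
  induction n generalizing M M' with
  | zero =>
    obtain ⟨c, rfl⟩ := (up 0 M).surjective c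
    refine (map_sub φ (av M c) (sm M c)).trans ?_
    exact congrArg₂ _ (DFunLike.congr_fun (av_nat h) c)
      (DFunLike.congr_fun (sm_nat (f := f) φ) c)
  | succ n ih =>
    obtain ⟨c, rfl⟩ := (up (n + 1) M).surjective c
    rw [Cm_up, d_up, d_up, map_sub, Cm_up, ih (fm_eqv f M M' φ), Cm_comp, Cm_comp, av_nat h]
    rfl

theorem d_d (n : ℕ) (M : Rp G) (c : C (n + 2) M) : d n M (d (n + 1) M c) = 0 := by
  induction n generalizing M with
  | zero =>
    obtain ⟨c, rfl⟩ := (up 1 M).surjective c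
    obtain ⟨c, rfl⟩ := (up 0 (F M)).surjective c
    rw [d_up, map_sub]
    let Φ : (F (F M)).V →+ M.V := ((av M).comp (fm id (av M)) - (sm M).comp (fm id (av M)))
      - ((av M).comp (av (F M) - sm (F M)) - (sm M).comp (av (F M) - sm (F M)))
    suffices hh : Φ = 0 from DFunLike.congr_fun hh c
    refine F_ext fun y b => ?_
    refine F_ext_apply (φ := Φ.comp (sg (F M) y)) (ψ := 0) (fun x m => ?_) b
    simp [Φ, M.act_mul]
  | succ n ih =>
    obtain ⟨c, rfl⟩ := (up (n + 2) M).surjective c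
    rw [d_up, map_sub, d_up, ih, ← MonoidHom.coe_id, ← d_nat (n + 1) (av_eqv M) c]
    simp

end basic
end GH

namespace GH
section hom
variable {G G' G'' : Type} [Group G] [Group G'] [Group G'']

/-- Cycles. -/
noncomputable def Z : ∀ (n : ℕ) (M : Rp G), AddSubgroup (C n M)
  | 0, _ => ⊤
  | n + 1, M => (d n M).ker

theorem mem_Z_succ {n : ℕ} {M : Rp G} {c : C (n + 1) M} : c ∈ Z (n + 1) M ↔ d n M c = 0 := Iff.rfl

theorem mem_Z_zero {M : Rp G} (c : C 0 M) : c ∈ Z 0 M := AddSubgroup.mem_top c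

theorem d_mem_Z (n : ℕ) (M : Rp G) (c : C (n + 1) M) : d n M c ∈ Z n M := by
  cases n with
  | zero => exact mem_Z_zero _
  | succ n => exact d_d n M c

theorem Cm_mem_Z (n : ℕ) {f : G →* G'} {M : Rp G} {M' : Rp G'} {φ : M.V →+ M'.V}
    (h : Eqv f M M' φ) {c : C n M} (hc : c ∈ Z n M) : Cm f n φ c ∈ Z n M' := by
  cases n with
  | zero => exact mem_Z_zero _
  | succ n =>
    rw [mem_Z_succ] at *
    rw [← d_nat n h, hc, map_zero]

theorem Cm_mem_Z_iff (n : ℕ) {f : G →* G'} {M : Rp G} {M' : Rp G'} {φ : M.V →+ M'.V}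
    (h : Eqv f M M' φ) (hf : Function.Injective f) (hφ : Function.Injective φ) {c : C n M}
    (hc : Cm f n φ c ∈ Z n M') : c ∈ Z n M := by
  cases n with
  | zero => exact mem_Z_zero _
  | succ n =>
    rw [mem_Z_succ] at *
    rw [← d_nat n h] at hc
    exact Cm_inj n hf hφ (hc.trans (map_zero _).symm)

/-- Homology. -/
def H (n : ℕ) (M : Rp G) : Type := Z n M ⧸ ((d n M).range.addSubgroupOf (Z n M))

noncomputable instance (n : ℕ) (M : Rp G) : AddCommGroup (H n M) :=
  inferInstanceAs (AddCommGroup (Z n M ⧸ ((d n M).range.addSubgroupOf (Z n M))))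

/-- Homology class of a cycle. -/
noncomputable def cl (n : ℕ) (M : Rp G) : Z n M →+ H n M :=
  QuotientAddGroup.mk' ((d n M).range.addSubgroupOf (Z n M))

/-- Homology class of a cycle. -/
noncomputable def hcl {n : ℕ} {M : Rp G} (c : C n M) (h : c ∈ Z n M) : H n M := cl n M ⟨c, h⟩

theorem mk_rep {n : ℕ} {M : Rp G} (a : H n M) : ∃ c h, hcl (M := M) c h = a := by
  obtain ⟨⟨c, h⟩, rfl⟩ := QuotientAddGroup.mk'_surjective _ a
  exact ⟨c, h, rfl⟩

theorem mk_add {n : ℕ} {M : Rp G} (c c' : C n M) (h h') :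
    hcl (M := M) c h + hcl c' h' = hcl (c + c') ((Z n M).add_mem h h') :=
  ((cl n M).map_add ⟨c, h⟩ ⟨c', h'⟩).symm

theorem mk_eq_zero {n : ℕ} {M : Rp G} (c : C n M) (h) :
    hcl (M := M) c h = 0 ↔ ∃ y, d n M y = c := by
  have := QuotientAddGroup.eq_zero_iff (N := (d n M).range.addSubgroupOf (Z n M)) ⟨c, h⟩
  exact this

theorem mk_congr {n : ℕ} {M : Rp G} {c c' : C n M} (e : c = c') (h) :
    hcl (M := M) c h = hcl c' (e ▸ h) := by subst e; rfl

theorem mk_eq_mk {n : ℕ} {M : Rp G} (c c' : C n M) (h h') (y) (hy : d n M y = c - c') :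
    hcl (M := M) c h = hcl c' h' := by
  rw [← sub_eq_zero]
  have : hcl (M := M) c h - hcl c' h' = hcl (c - c') ((Z n M).sub_mem h h') :=
    ((cl n M).map_sub ⟨c, h⟩ ⟨c', h'⟩).symm
  rw [this, mk_eq_zero]
  exact ⟨y, hy⟩

/-- Functoriality of homology. -/
noncomputable def Hm (n : ℕ) {f : G →* G'} {M : Rp G} {M' : Rp G'} {φ : M.V →+ M'.V}
    (h : Eqv f M M' φ) : H n M →+ H n M' :=
  QuotientAddGroup.map _ _ (AddMonoidHom.mk' (fun c : Z n M => (⟨Cm f n φ c, Cm_mem_Z n h c.2⟩ : Z n M'))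
      (fun a b => Subtype.ext (map_add (Cm f n φ) a.1 b.1))) (by
      rintro ⟨c, hc⟩ ⟨y, hy⟩
      refine ⟨Cm f (n + 1) φ y, ?_⟩
      rw [← d_nat n h, hy]
      rfl)

theorem Hm_mk {n : ℕ} {f : G →* G'} {M : Rp G} {M' : Rp G'} {φ : M.V →+ M'.V}
    (h : Eqv f M M' φ) (c : C n M) (hc) :
    Hm n h (hcl (M := M) c hc) = hcl (Cm f n φ c) (Cm_mem_Z n h hc) := rfl

theorem Eqv.comp {f : G →* G'} {M : Rp G} {M' : Rp G'} {φ : M.V →+ M'.V}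
    {f' : G' →* G''} {M'' : Rp G''} {φ' : M'.V →+ M''.V} (h' : Eqv f' M' M'' φ')
    (h : Eqv f M M' φ) : Eqv (f'.comp f) M M'' (φ'.comp φ) := by
  intro g m
  simp [h g m, h' (f g)]

theorem Eqv.id' (M : Rp G) : Eqv (MonoidHom.id G) M M (AddMonoidHom.id _) := fun _ _ => rfl

theorem Hm_comp {n : ℕ} {f : G →* G'} {M : Rp G} {M' : Rp G'} {φ : M.V →+ M'.V}
    {f' : G' →* G''} {M'' : Rp G''} {φ' : M'.V →+ M''.V} (h' : Eqv f' M' M'' φ')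
    (h : Eqv f M M' φ) (a : H n M) : Hm n h' (Hm n h a) = Hm n (h'.comp h) a := by
  obtain ⟨c, hc, rfl⟩ := mk_rep a
  rw [Hm_mk, Hm_mk, Hm_mk]
  exact mk_congr (Cm_comp n f f' φ φ' c) _

theorem Hm_id' {n : ℕ} {f : G →* G} {M : Rp G} {φ : M.V →+ M.V} (h : Eqv f M M φ)
    (hf : ∀ g, f g = g) (hφ : ∀ m, φ m = m) (a : H n M) : Hm n h a = a := by
  obtain rfl : f = MonoidHom.id G := MonoidHom.ext hf
  obtain rfl : φ = AddMonoidHom.id _ := AddMonoidHom.ext hφ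
  obtain ⟨c, hc, rfl⟩ := mk_rep a
  rw [Hm_mk]
  exact mk_congr (Cm_id n M c) _

theorem Hm_congr {n : ℕ} {f f' : G →* G'} {M : Rp G} {M' : Rp G'} {φ φ' : M.V →+ M'.V}
    (h : Eqv f M M' φ) (h' : Eqv f' M M' φ') (hf : ∀ g, f g = f' g) (hφ : ∀ m, φ m = φ' m)
    (a : H n M) : Hm n h a = Hm n h' a := by
  obtain rfl : f = f' := MonoidHom.ext hf
  obtain rfl : φ = φ' := AddMonoidHom.ext hφ
  rfl

theorem Hm_sq {n : ℕ} {G1 : Type} [Group G1] {f : G →* G'} {M : Rp G} {M' : Rp G'}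
    {φ : M.V →+ M'.V}
    {f' : G' →* G''} {M'' : Rp G''} {φ' : M'.V →+ M''.V} (h' : Eqv f' M' M'' φ')
    (h : Eqv f M M' φ) {k : G →* G1} {N : Rp G1} {ψ : M.V →+ N.V} {k' : G1 →* G''}
    {ψ' : N.V →+ M''.V} (q' : Eqv k' N M'' ψ') (q : Eqv k M N ψ)
    (hf : ∀ g, f' (f g) = k' (k g)) (hφ : ∀ m, φ' (φ m) = ψ' (ψ m))
    (a : H n M) : Hm n h' (Hm n h a) = Hm n q' (Hm n q a) := by
  rw [Hm_comp, Hm_comp]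
  exact Hm_congr _ _ hf hφ a

theorem Hm_tri {n : ℕ} {f : G →* G'} {M : Rp G} {M' : Rp G'}
    {φ : M.V →+ M'.V}
    {f' : G' →* G''} {M'' : Rp G''} {φ' : M'.V →+ M''.V} (h' : Eqv f' M' M'' φ')
    (h : Eqv f M M' φ) {k : G →* G''} {ψ : M.V →+ M''.V} (q : Eqv k M M'' ψ)
    (hf : ∀ g, f' (f g) = k g) (hφ : ∀ m, φ' (φ m) = ψ m)
    (a : H n M) : Hm n h' (Hm n h a) = Hm n q a := by
  rw [Hm_comp]
  exact Hm_congr _ _ hf hφ a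

theorem Hm_addφ {n : ℕ} {f : G →* G'} {M : Rp G} {M' : Rp G'} {φ ψ χ : M.V →+ M'.V}
    (h : Eqv f M M' φ) (h' : Eqv f M M' ψ) (h'' : Eqv f M M' χ) (e : ∀ m, χ m = φ m + ψ m)
    (a : H n M) : Hm n h'' a = Hm n h a + Hm n h' a := by
  obtain rfl : χ = φ + ψ := AddMonoidHom.ext e
  obtain ⟨c, hc, rfl⟩ := mk_rep a
  rw [Hm_mk, Hm_mk, Hm_mk, mk_add]
  exact mk_congr (Cm_add n f φ ψ c) _

theorem Hm_zeroφ {n : ℕ} {f : G →* G'} {M : Rp G} {M' : Rp G'} {φ : M.V →+ M'.V}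
    (h : Eqv f M M' φ) (e : ∀ m, φ m = 0) (a : H n M) : Hm n h a = 0 := by
  obtain rfl : φ = 0 := AddMonoidHom.ext e
  obtain ⟨c, hc, rfl⟩ := mk_rep a
  rw [Hm_mk, mk_eq_zero]
  exact ⟨0, by rw [Cm_zero, map_zero]⟩

/-- Short exact sequences of representations. -/
structure Ses (M' M M'' : Rp G) where
  i : M'.V →+ M.V
  p : M.V →+ M''.V
  inj : Function.Injective i
  surj : Function.Surjective p
  pi : ∀ x, p (i x) = 0
  ex : ∀ b, p b = 0 → ∃ a, i a = b
  ie : Eqv (MonoidHom.id G) M' M i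
  pe : Eqv (MonoidHom.id G) M M'' p

variable {M' M M'' : Rp G} (S : Ses M' M M'')

theorem Ses.Cpi (n : ℕ) (x : C n M') : Cm (id : G → G) n S.p (Cm (id : G → G) n S.i x) = 0 := by
  rw [Cm_comp]
  have : S.p.comp S.i = 0 := AddMonoidHom.ext S.pi
  rw [this, Cm_zero]

theorem Ses.Cinj (n : ℕ) : Function.Injective (Cm (id : G → G) n S.i) :=
  Cm_inj n Function.injective_id S.inj

theorem Ses.Csurj (n : ℕ) : Function.Surjective (Cm (id : G → G) n S.p) :=
  Cm_surj n Function.surjective_id S.surj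

/-- The connecting relation. -/
def Ses.Con (n : ℕ) (a : H (n + 1) M'') (b : H n M') : Prop :=
  ∃ (y : C (n + 1) M) (x : C n M') (hx : x ∈ Z n M') (hz : Cm (id : G → G) (n + 1) S.p y ∈ Z (n + 1) M''),
    Cm (id : G → G) n S.i x = d n M y ∧ hcl _ hz = a ∧ hcl x hx = b

theorem Ses.con_exists (n : ℕ) (a : H (n + 1) M'') : ∃ b, S.Con n a b := by
  obtain ⟨z, hz, rfl⟩ := mk_rep a
  obtain ⟨y, rfl⟩ := S.Csurj (n + 1) z
  have h1 : Cm (id : G → G) n S.p (d n M y) = 0 := (d_nat n S.pe y).trans hz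
  obtain ⟨x, hx⟩ := Cm_exact n S.ex _ h1
  have hxZ : x ∈ Z n M' := by
    refine Cm_mem_Z_iff n S.ie Function.injective_id S.inj ?_
    have := d_mem_Z n M y
    rw [← hx] at this
    exact this
  exact ⟨_, y, x, hxZ, hz, hx, rfl, rfl⟩

theorem Ses.con_zero (n : ℕ) (b : H n M') (h : S.Con n 0 b) : b = 0 := by
  obtain ⟨y, x, hx, hz, e, h1, rfl⟩ := h
  rw [mk_eq_zero] at h1
  obtain ⟨w, hw⟩ := h1
  obtain ⟨w', rfl⟩ := S.Csurj _ w
  have h2 : Cm (id : G → G) (n + 1) S.p (y - d (n + 1) M w') = 0 := by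
    rw [map_sub, ← hw, sub_eq_zero]
    exact (d_nat (n + 1) S.pe w').symm
  obtain ⟨v, hv⟩ := Cm_exact (n + 1) S.ex _ h2
  rw [mk_eq_zero]
  refine ⟨v, S.Cinj n ?_⟩
  refine (d_nat n S.ie v).trans ?_
  rw [e]
  change d n M (Cm (id : G → G) (n + 1) S.i v) = _
  rw [hv, map_sub, d_d, sub_zero]

theorem Ses.con_add (n : ℕ) (a a' : H (n + 1) M'') (b b' : H n M') (h : S.Con n a b)
    (h' : S.Con n a' b') : S.Con n (a + a') (b + b') := by
  obtain ⟨y, x, hx, hz, e, rfl, rfl⟩ := h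
  obtain ⟨y', x', hx', hz', e', rfl, rfl⟩ := h'
  refine ⟨y + y', x + x', (Z n M').add_mem hx hx', ?_, ?_, ?_, ?_⟩
  · rw [map_add]; exact (Z (n + 1) M'').add_mem hz hz'
  · rw [map_add, map_add, e, e']
  · rw [mk_add]; exact mk_congr (map_add _ _ _) _
  · rw [mk_add]

theorem Ses.con_neg (n : ℕ) (a : H (n + 1) M'') (b : H n M') (h : S.Con n a b) :
    S.Con n (-a) (-b) := by
  obtain ⟨b', h'⟩ := S.con_exists n (-a)
  have := S.con_zero n _ (by simpa using S.con_add n _ _ _ _ h h')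
  rwa [eq_neg_of_add_eq_zero_right this] at h'

theorem Ses.con_unique (n : ℕ) {a : H (n + 1) M''} {b b' : H n M'} (h : S.Con n a b)
    (h' : S.Con n a b') : b = b' := by
  have := S.con_zero n _ (by simpa using S.con_add n _ _ _ _ h (S.con_neg n _ _ h'))
  exact add_neg_eq_zero.mp this

/-- The connecting homomorphism. -/
noncomputable def Ses.δ (n : ℕ) : H (n + 1) M'' →+ H n M' :=
  AddMonoidHom.mk' (fun a => (S.con_exists n a).choose) fun a b =>
    S.con_unique n (S.con_exists n _).choose_spec
      (S.con_add n _ _ _ _ (S.con_exists n a).choose_spec (S.con_exists n b).choose_spec)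

theorem Ses.con_δ (n : ℕ) (a : H (n + 1) M'') : S.Con n a (S.δ n a) := (S.con_exists n a).choose_spec

theorem Ses.δ_eq (n : ℕ) {a : H (n + 1) M''} {b : H n M'} (h : S.Con n a b) : S.δ n a = b :=
  S.con_unique n (S.con_δ n a) h

theorem Ses.δ_p (n : ℕ) (a : H (n + 1) M) : S.δ n (Hm (n + 1) S.pe a) = 0 := by
  obtain ⟨y, hy, rfl⟩ := mk_rep a
  refine S.δ_eq n ⟨y, 0, (Z n M').zero_mem, Cm_mem_Z _ S.pe hy, ?_, rfl, ?_⟩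
  · rw [map_zero]; exact hy.symm
  · rw [mk_eq_zero]; exact ⟨0, map_zero _⟩

theorem Ses.ker_δ (n : ℕ) (a : H (n + 1) M'') (h : S.δ n a = 0) : ∃ c, Hm (n + 1) S.pe c = a := by
  have := S.con_δ n a
  rw [h] at this
  obtain ⟨y, x, hx, hz, e, rfl, h1⟩ := this
  rw [mk_eq_zero] at h1
  obtain ⟨v, rfl⟩ := h1
  have h2 : y - Cm (id : G → G) (n + 1) S.i v ∈ Z (n + 1) M := by
    rw [mem_Z_succ, map_sub, sub_eq_zero, ← e]
    exact d_nat n S.ie v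
  refine ⟨hcl _ h2, ?_⟩
  rw [Hm_mk]
  refine mk_congr ?_ _
  change Cm (id : G → G) (n + 1) S.p _ = _
  rw [map_sub, S.Cpi, sub_zero]

theorem Ses.i_δ (n : ℕ) (a : H (n + 1) M'') : Hm n S.ie (S.δ n a) = 0 := by
  obtain ⟨y, x, hx, hz, e, rfl, h1⟩ := S.con_δ n a
  rw [← h1, Hm_mk, mk_eq_zero]
  exact ⟨y, e.symm⟩

theorem Ses.ker_i (n : ℕ) (b : H n M') (h : Hm n S.ie b = 0) : ∃ a, S.δ n a = b := by
  obtain ⟨x, hx, rfl⟩ := mk_rep b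
  rw [Hm_mk, mk_eq_zero] at h
  obtain ⟨y, hy⟩ := h
  have hz : Cm (id : G → G) (n + 1) S.p y ∈ Z (n + 1) M'' := by
    rw [mem_Z_succ]
    refine (d_nat n S.pe y).symm.trans ?_
    rw [hy]
    exact S.Cpi n x
  exact ⟨hcl _ hz, S.δ_eq n ⟨y, x, hx, hz, hy.symm, rfl, rfl⟩⟩

theorem Ses.p_i (n : ℕ) (b : H n M') : Hm n S.pe (Hm n S.ie b) = 0 := by
  rw [Hm_comp]
  exact Hm_zeroφ _ S.pi b

theorem Ses.ker_p (n : ℕ) (b : H n M) (h : Hm n S.pe b = 0) : ∃ a, Hm n S.ie a = b := by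
  obtain ⟨y, hy, rfl⟩ := mk_rep b
  rw [Hm_mk, mk_eq_zero] at h
  obtain ⟨w, hw⟩ := h
  obtain ⟨w', rfl⟩ := S.Csurj _ w
  have h2 : Cm (id : G → G) n S.p (y - d n M w') = 0 := by
    rw [map_sub, sub_eq_zero]
    exact hw.symm.trans (d_nat n S.pe w').symm
  obtain ⟨v, hv⟩ := Cm_exact n S.ex _ h2
  have hvZ : v ∈ Z n M' := by
    refine Cm_mem_Z_iff n S.ie Function.injective_id S.inj ?_
    have : y - d n M w' ∈ Z n M := (Z n M).sub_mem hy (d_mem_Z n M w')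
    rw [← hv] at this
    exact this
  refine ⟨hcl v hvZ, ?_⟩
  rw [Hm_mk]
  refine (mk_eq_mk _ _ _ _ w' ?_).symm
  change _ = y - Cm (id : G → G) n S.i v
  rw [hv, sub_sub_cancel]

theorem Ses.p_surj_zero (b : H 0 M'') : ∃ a, Hm 0 S.pe a = b := by
  obtain ⟨y, hy, rfl⟩ := mk_rep b
  obtain ⟨y, rfl⟩ := S.surj y
  exact ⟨hcl (M := M) (n := 0) y (mem_Z_zero _), rfl⟩

theorem Ses.δ_nat (n : ℕ) {N' N N'' : Rp G'} (T : Ses N' N N'') {f : G →* G'} {φ' : M'.V →+ N'.V}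
    {φ : M.V →+ N.V} {φ'' : M''.V →+ N''.V} (h' : Eqv f M' N' φ') (h : Eqv f M N φ)
    (h'' : Eqv f M'' N'' φ'') (e1 : ∀ x, φ (S.i x) = T.i (φ' x)) (e2 : ∀ x, φ'' (S.p x) = T.p (φ x))
    (a : H (n + 1) M'') : T.δ n (Hm (n + 1) h'' a) = Hm n h' (S.δ n a) := by
  obtain ⟨y, x, hx, hz, e, rfl, h1⟩ := S.con_δ n a
  have e1' : φ.comp S.i = T.i.comp φ' := AddMonoidHom.ext e1
  have e2' : φ''.comp S.p = T.p.comp φ := AddMonoidHom.ext e2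
  have e3 : Cm (f : G → G') (n + 1) φ'' (Cm (id : G → G) (n + 1) S.p y) =
      Cm (id : G' → G') (n + 1) T.p (Cm f (n + 1) φ y) := by
    rw [Cm_comp, Cm_comp, e2']; rfl
  refine T.δ_eq n ⟨Cm f (n + 1) φ y, Cm f n φ' x, Cm_mem_Z n h' hx, ?_, ?_, ?_, ?_⟩
  · rw [← e3]; exact Cm_mem_Z _ h'' hz
  · rw [← d_nat n h, ← e, Cm_comp, Cm_comp, e1']; rfl
  · rw [Hm_mk]; exact (mk_congr e3 _).symm
  · rw [← h1, Hm_mk]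

end hom
end GH

namespace GH
section reps
variable {G G' G'' : Type} [Group G] [Group G'] [Group G'']

/-- Restriction along a homomorphism. -/
@[reducible] def res (f : G →* G') (M : Rp G') : Rp G where
  V := M.V
  act g := M.act (f g)
  act_one v := by rw [map_one, M.act_one]
  act_mul g h v := by rw [map_mul, M.act_mul]

/-- Trivial representation. -/
@[reducible] def triv (G : Type) [Group G] (A : Type) [AddCommGroup A] : Rp G where
  V := A
  act _ := AddMonoidHom.id A
  act_one _ := rfl
  act_mul _ _ _ := rfl

theorem triv_act (A : Type) [AddCommGroup A] (g : G) (v : (triv G A).V) :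
    (triv G A).act g v = v := rfl

theorem res_act (f : G →* G') (M : Rp G') (g : G) (v : M.V) :
    (res f M).act g v = M.act (f g) v := rfl

/-- Twisted permutation representation. -/
noncomputable def Tw (Ω : Type) [MulAction G Ω] (M : Rp G) : Rp G where
  V := Ω →₀ M.V
  act g := Fmap (fun x => g • x) (M.act g)
  act_one v := by
    have : Fmap (fun x : Ω => (1 : G) • x) (M.act 1) = AddMonoidHom.id _ := by
      ext x a : 2
      simp [M.act_one]
    rw [this]; rfl
  act_mul g h v := by
    rw [← AddMonoidHom.comp_apply, Fmap_comp]
    refine DFunLike.congr_fun ?_ v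
    ext x a : 2
    simp [M.act_mul, mul_smul]

variable {Ω : Type} [MulAction G Ω]

/-- Typed version of single. -/
noncomputable def sw (M : Rp G) (x : Ω) : M.V →+ (Tw Ω M).V := Finsupp.singleAddHom x

theorem Tw_ext {M : Rp G} {A : Type*} [AddCommGroup A] {φ ψ : (Tw Ω M).V →+ A}
    (h : ∀ x m, φ (sw M x m) = ψ (sw M x m)) (z : (Tw Ω M).V) : φ z = ψ z :=
  DFunLike.congr_fun (Finsupp.addHom_ext (M := M.V) h) z

@[simp] theorem Tw_act_sw (M : Rp G) (g : G) (x : Ω) (m : M.V) :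
    (Tw Ω M).act g (sw M x m) = sw M (g • x) (M.act g m) :=
  Fmap_single _ _ _ _

/-- Lifting maps out of twisted permutation modules. -/
noncomputable def tlift (M : Rp G) {A : Type*} [AddCommGroup A] (φ : Ω → M.V →+ A) :
    (Tw Ω M).V →+ A :=
  Finsupp.liftAddHom φ

@[simp] theorem tlift_sw (M : Rp G) {A : Type*} [AddCommGroup A] (φ : Ω → M.V →+ A) (x : Ω)
    (m : M.V) : tlift M φ (sw M x m) = φ x m :=
  Finsupp.liftAddHom_apply_single _ _ _

/-- Functoriality. -/
noncomputable def tm {Ω' : Type} [MulAction G' Ω'] (u : Ω → Ω') {M : Rp G} {M' : Rp G'}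
    (φ : M.V →+ M'.V) : (Tw Ω M).V →+ (Tw Ω' M').V := Fmap u φ

@[simp] theorem tm_sw {Ω' : Type} [MulAction G' Ω'] (u : Ω → Ω') {M : Rp G} {M' : Rp G'}
    (φ : M.V →+ M'.V) (x : Ω) (m : M.V) : tm u φ (sw M x m) = sw M' (u x) (φ m) :=
  Fmap_single _ _ _ _

theorem tm_eqv {Ω' : Type} [MulAction G' Ω'] {f : G →* G'} {u : Ω → Ω'}
    (hu : ∀ g x, u (g • x) = f g • u x) {M : Rp G} {M' : Rp G'}
    {φ : M.V →+ M'.V} (h : Eqv f M M' φ) : Eqv f (Tw Ω M) (Tw Ω' M') (tm u φ) := by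
  intro g m
  refine Tw_ext (φ := (tm u φ).comp ((Tw Ω M).act g)) (ψ := ((Tw Ω' M').act (f g)).comp (tm u φ)) ?_ m
  intro x m
  simp [hu, h g m]

/-- Kernel representation. -/
def kerRp {M N : Rp G} {p : M.V →+ N.V} (h : Eqv (MonoidHom.id G) M N p) : Rp G where
  V := p.ker
  act g := AddMonoidHom.mk' (fun x => ⟨M.act g x, by
      have := x.2
      rw [AddMonoidHom.mem_ker] at *
      rw [h, this, map_zero]⟩) (fun a b => Subtype.ext (map_add (M.act g) _ _))
  act_one v := Subtype.ext (M.act_one _)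
  act_mul g h v := Subtype.ext (M.act_mul g h _)

/-- The short exact sequence of a surjection. -/
def kerSes {M N : Rp G} {p : M.V →+ N.V} (h : Eqv (MonoidHom.id G) M N p)
    (hs : Function.Surjective p) : Ses (kerRp h) M N where
  i := p.ker.subtype
  p := p
  inj := Subtype.val_injective
  surj := hs
  pi x := x.2
  ex b hb := ⟨⟨b, hb⟩, rfl⟩
  ie _ _ := rfl
  pe := h

theorem av_surj (M : Rp G) : Function.Surjective (av M) := fun m =>
  ⟨sg M 1 m, by simp [M.act_one]⟩

/-- The canonical cover. -/
noncomputable def cov (M : Rp G) : Ses (kerRp (av_eqv M)) (F M) M := kerSes (av_eqv M) (av_surj M)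

theorem res_eqv {f : G →* G'} {M N : Rp G'} {p : M.V →+ N.V} (h : Eqv (MonoidHom.id G') M N p) :
    Eqv (MonoidHom.id G) (res f M) (res f N) p := fun g m => h (f g) m

/-- Restriction of a short exact sequence. -/
def Ses.res {M' M M'' : Rp G'} (S : Ses M' M M'') (f : G →* G') :
    Ses (res f M') (res f M) (res f M'') where
  i := S.i
  p := S.p
  inj := S.inj
  surj := S.surj
  pi := S.pi
  ex := S.ex
  ie := res_eqv S.ie
  pe := res_eqv S.pe

/-- Twisting of a short exact sequence. -/
noncomputable def Ses.tw {M' M M'' : Rp G} (S : Ses M' M M'') (Ω : Type) [MulAction G Ω] :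
    Ses (Tw Ω M') (Tw Ω M) (Tw Ω M'') where
  i := tm id S.i
  p := tm id S.p
  inj := Fmap_inj Function.injective_id S.inj
  surj := Fmap_surj Function.surjective_id S.surj
  pi x := Tw_ext (φ := (tm id S.p).comp (tm id S.i)) (ψ := 0) (fun x m => by simp [S.pi]) x
  ex := Fmap_exact S.ex
  ie := tm_eqv (fun _ _ => rfl) S.ie
  pe := tm_eqv (fun _ _ => rfl) S.pe

/-- Relatively free representations. -/
def IsFr (M : Rp G) : Prop :=
  ∃ P : M.V →+ (F M).V, Eqv (MonoidHom.id G) M (F M) P ∧ ∀ m, av M (P m) = m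

theorem IsFr.vanish {M : Rp G} (hM : IsFr M) (n : ℕ) (a : H (n + 1) M) : a = 0 := by
  obtain ⟨j, hj, hs⟩ := hM
  obtain ⟨z, hz, rfl⟩ := mk_rep a
  rw [mk_eq_zero]
  refine ⟨up (n + 1) M (Cm (id : G → G) (n + 1) j z), ?_⟩
  have h1 : d n (F M) (Cm (id : G → G) (n + 1) j z) = 0 := by
    refine (d_nat n hj z).symm.trans ?_
    rw [mem_Z_succ.1 hz, map_zero]
  rw [d_up, h1, Cm_comp, map_zero, sub_zero]
  have h2 : (av M).comp j = AddMonoidHom.id _ := AddMonoidHom.ext hs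
  rw [h2]
  exact Cm_id _ _ _

theorem fr_F (M : Rp G) : IsFr (F M) := by
  refine ⟨flift M fun x => (sg (F M) x).comp (sg M 1), ?_, ?_⟩
  · intro g m
    refine F_ext_apply (φ := (flift M fun x => (sg (F M) x).comp (sg M 1)).comp ((F M).act g))
      (ψ := ((F (F M)).act g).comp (flift M fun x => (sg (F M) x).comp (sg M 1))) ?_ m
    intro x m
    simp
  · intro m
    refine F_ext_apply (φ := (av (F M)).comp (flift M fun x => (sg (F M) x).comp (sg M 1)))
      (ψ := AddMonoidHom.id _) ?_ m
    intro x m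
    simp

theorem fr_Tw {M : Rp G} (hM : IsFr M) : IsFr (Tw Ω M) := by
  obtain ⟨j, hj, hs⟩ := hM
  let L : Ω → (F M).V →+ (F (Tw Ω M)).V := fun w => flift M fun x =>
    (sg (Tw Ω M) x).comp (sw M (x • w))
  have hL : ∀ g w z, L (g • w) ((F M).act g z) = (F (Tw Ω M)).act g (L w z) := by
    intro g w z
    refine F_ext_apply (φ := (L (g • w)).comp ((F M).act g))
      (ψ := ((F (Tw Ω M)).act g).comp (L w)) ?_ z
    intro x m
    simp [L, mul_smul]
  have hL2 : ∀ w z, av (Tw Ω M) (L w z) = sw M w (av M z) := by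
    intro w z
    refine F_ext_apply (φ := (av (Tw Ω M)).comp (L w)) (ψ := (sw M w).comp (av M)) ?_ z
    intro x m
    simp [L]
  let P : (Tw Ω M).V →+ (F (Tw Ω M)).V := tlift M fun w => (L w).comp j
  refine ⟨P, ?_, ?_⟩
  · intro g m
    refine Tw_ext (φ := P.comp ((Tw Ω M).act g)) (ψ := ((F (Tw Ω M)).act g).comp P) ?_ m
    intro x m
    have := hj g m
    simp only [MonoidHom.id_apply] at this
    simp [P, this, hL]
  · intro m
    refine Tw_ext (φ := (av (Tw Ω M)).comp P) (ψ := AddMonoidHom.id _) ?_ m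
    intro x m
    simp [P, hL2, hs]

theorem fr_TwG (M : Rp G) : IsFr (Tw G M) := by
  let P : (Tw G M).V →+ (F (Tw G M)).V :=
    tlift M fun w => (sg (Tw G M) w⁻¹).comp ((sw M 1).comp (M.act w⁻¹))
  refine ⟨P, ?_, ?_⟩
  · intro g m
    refine Tw_ext (φ := P.comp ((Tw G M).act g)) (ψ := ((F (Tw G M)).act g).comp P) ?_ m
    intro x m
    simp [P, ← M.act_mul]
  · intro m
    refine Tw_ext (φ := (av (Tw G M)).comp P) (ψ := AddMonoidHom.id _) ?_ m
    intro x m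
    simp [P, M.act_act_inv]

theorem fr_res {M : Rp G'} (hM : IsFr M) (j : G →* G') (hj : Function.Injective j) :
    IsFr (res j M) := by
  obtain ⟨P, hP, hs⟩ := hM
  have h1 : ∀ x : G', ∃ h : G, j h = ((x : G' ⧸ j.range).out)⁻¹ * x := fun x => by
    have : ((x : G' ⧸ j.range).out)⁻¹ * x ∈ j.range := by
      rw [← QuotientGroup.eq]
      exact (QuotientGroup.out_eq' _)
    exact this
  choose r hr using h1
  have hr2 : ∀ x h, r (x * (j h)⁻¹) = r x * h⁻¹ := by
    intro x h
    apply hj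
    have : ((x * (j h)⁻¹ : G') : G' ⧸ j.range) = x := by
      rw [eq_comm, QuotientGroup.eq]
      exact ⟨h⁻¹, by simp⟩
    rw [hr, this, map_mul, hr, map_inv, mul_assoc]
  let L : (F M).V →+ (F (res j M)).V := flift M fun x =>
    (sg (res j M) (r x)).comp (M.act (j (r x) * x⁻¹))
  refine ⟨L.comp P, ?_, ?_⟩
  · intro g m
    have e : P ((res j M).act g m) = (F M).act (j g) (P m) := hP (j g) m
    change L (P ((res j M).act g m)) = (F (res j M)).act g (L (P m))
    rw [e]
    refine F_ext_apply (φ := L.comp ((F M).act (j g))) (ψ := ((F (res j M)).act g).comp L) ?_ (P m)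
    intro x m
    simp [L, hr2]
  · intro m
    refine Eq.trans ?_ (hs m)
    refine F_ext_apply (φ := (av (res j M)).comp L) (ψ := av M) ?_ (P m)
    intro x m
    simp [L, ← M.act_mul]

/-! ### degree zero -/

theorem H0_rel {M : Rp G} (g : G) (m : M.V) :
    hcl (n := 0) (M := M) (M.act g m) (mem_Z_zero (M := M) _) =
      hcl (n := 0) (M := M) m (mem_Z_zero (M := M) m) := by
  refine mk_eq_mk (n := 0) (M := M) _ _ _ _ (up 0 M (sg M g⁻¹ m)) ?_
  refine (d_zero_up M (sg M g⁻¹ m)).trans ?_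
  rw [av_sg, sm_sg, inv_inv]
  rfl

/-- The projection to degree zero homology. -/
noncomputable def toH0 (M : Rp G) : M.V →+ H 0 M :=
  AddMonoidHom.mk' (fun m => hcl (n := 0) (M := M) m (mem_Z_zero (M := M) m))
    (fun a b => (mk_add (n := 0) (M := M) a b _ _).symm)

theorem toH0_act {M : Rp G} (g : G) (m : M.V) : toH0 M (M.act g m) = toH0 M m := H0_rel g m

theorem toH0_surj (M : Rp G) : Function.Surjective (toH0 M) := fun a => by
  obtain ⟨c, hc, rfl⟩ := mk_rep a
  exact ⟨c, rfl⟩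

theorem toH0_zero {M : Rp G} {A : Type*} [AddCommGroup A] (φ : M.V →+ A)
    (h : ∀ g m, φ (M.act g m) = φ m) (m : M.V) (hm : toH0 M m = 0) : φ m = 0 := by
  obtain ⟨y, hy⟩ := (mk_eq_zero (n := 0) (M := M) m _).1 hm
  rw [← hy]
  change φ (av M y - sm M y) = 0
  rw [map_sub, sub_eq_zero]
  refine F_ext_apply (φ := φ.comp (av M)) (ψ := φ.comp (sm M)) ?_ y
  intro x m
  simp [h]

theorem Hm_toH0 {f : G →* G'} {M : Rp G} {M' : Rp G'} {φ : M.V →+ M'.V}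
    (h : Eqv f M M' φ) (m : M.V) : Hm 0 h (toH0 M m) = toH0 M' (φ m) := rfl

/-! ### conjugation invariance -/

theorem conj_eqv (M : Rp G) (t : G) : Eqv (MulAut.conj t).toMonoidHom M M (M.act t) := by
  intro g m
  simp [← M.act_mul]

theorem Hm_conj (n : ℕ) (M : Rp G) (t : G) (a : H n M) : Hm n (conj_eqv M t) a = a := by
  induction n generalizing M with
  | zero =>
    obtain ⟨m, rfl⟩ := toH0_surj M a
    rw [Hm_toH0, toH0_act]
  | succ n ih =>
    have h := (cov M).δ_nat n (cov M) (conj_eqv _ t) (conj_eqv _ t) (conj_eqv M t)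
      (fun _ => rfl) (fun x => (av_eqv M t x).symm) a
    rw [ih] at h
    have h2 : (cov M).δ n (Hm (n + 1) (conj_eqv M t) a - a) = 0 := by rw [map_sub, h, sub_self]
    obtain ⟨c, hc⟩ := (cov M).ker_δ n _ h2
    rw [(fr_F M).vanish n c, map_zero] at hc
    exact (sub_eq_zero.1 hc.symm)

end reps

section shapiro
variable {Γ K : Type} [Group Γ] [Group K] {Ω : Type} [MulAction Γ Ω]

theorem sh_eqv {j : K →* Γ} {w0 : Ω} (hs : ∀ g : Γ, g • w0 = w0 ↔ ∃ h, j h = g) (M : Rp Γ) :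
    Eqv j (res j M) (Tw Ω M) (sw M w0) := by
  intro g m
  have := (hs (j g)).2 ⟨g, rfl⟩
  change sw M w0 (M.act (j g) m) = _
  rw [Tw_act_sw, this]

theorem shapiro {j : K →* Γ} {w0 : Ω} (hj : Function.Injective j)
    (hs : ∀ g : Γ, g • w0 = w0 ↔ ∃ h, j h = g) (ht : ∀ w : Ω, ∃ g : Γ, g • w0 = w) (n : ℕ)
    (M : Rp Γ) : Function.Bijective (Hm n (sh_eqv hs M)) := by
  induction n generalizing M with
  | zero =>
    choose r hr using ht
    constructor
    · let φ : (Tw Ω M).V →+ H 0 (res j M) :=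
        tlift M fun w => AddMonoidHom.comp (toH0 (res j M)) (M.act (r w)⁻¹)
      have hφ : ∀ g z, φ ((Tw Ω M).act g z) = φ z := by
        intro g z
        refine Tw_ext (φ := φ.comp ((Tw Ω M).act g)) (ψ := φ) ?_ z
        intro w m
        obtain ⟨h, hh⟩ := (hs ((r (g • w))⁻¹ * g * r w)).1 (by
          rw [mul_smul, mul_smul, hr, inv_smul_eq_iff, hr])
        have h1 := toH0_act (M := res j M) h (M.act (r w)⁻¹ m)
        simp only [φ, AddMonoidHom.comp_apply, Tw_act_sw, tlift_sw]
        refine Eq.trans ?_ h1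
        congr 1
        change _ = M.act (j h) _
        rw [hh, ← M.act_mul, ← M.act_mul]
        congr 2
        group
      rw [injective_iff_map_eq_zero]
      intro a ha
      obtain ⟨m, rfl⟩ := toH0_surj _ a
      rw [Hm_toH0] at ha
      have h1 := toH0_zero φ hφ _ ha
      obtain ⟨h, hh⟩ := (hs (r w0)⁻¹).1 (by rw [inv_smul_eq_iff, hr])
      simp only [φ, tlift_sw, AddMonoidHom.comp_apply] at h1
      rw [← h1, ← hh]
      exact (toH0_act (M := res j M) h m).symm
    · intro b
      obtain ⟨z, rfl⟩ := toH0_surj _ b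
      have : ∀ z, toH0 (Tw Ω M) z ∈ (Hm 0 (sh_eqv hs M)).range := by
        intro z
        have key : (toH0 (Tw Ω M)) z = ((Hm 0 (sh_eqv hs M)).comp (tlift M fun w =>
          AddMonoidHom.comp (toH0 (res j M)) (M.act (r w)⁻¹))) z := by
          refine Tw_ext ?_ z
          intro w m
          simp only [AddMonoidHom.comp_apply, tlift_sw]
          rw [Hm_toH0, ← toH0_act (M := Tw Ω M) (r w)⁻¹ (sw M w m), Tw_act_sw]
          have e : (r w)⁻¹ • w = w0 := by rw [inv_smul_eq_iff, hr]
          rw [e]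
        rw [key]
        exact ⟨_, rfl⟩
      exact this z
  | succ n ih =>
    have hdi : ∀ a, ((cov M).res j).δ n a = 0 → a = 0 := by
      intro a ha
      obtain ⟨c, rfl⟩ := ((cov M).res j).ker_δ n a ha
      rw [(fr_res (fr_F M) j hj).vanish n c, map_zero]
    have hdi' : ∀ a, ((cov M).tw Ω).δ n a = 0 → a = 0 := by
      intro a ha
      obtain ⟨c, rfl⟩ := ((cov M).tw Ω).ker_δ n a ha
      rw [(fr_Tw (fr_F M)).vanish n c, map_zero]
    have nat : ∀ a, ((cov M).tw Ω).δ n (Hm (n + 1) (sh_eqv hs M) a) =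
        Hm n (sh_eqv hs _) (((cov M).res j).δ n a) := fun a =>
      ((cov M).res j).δ_nat n ((cov M).tw Ω) (sh_eqv hs _) (sh_eqv hs (F M)) (sh_eqv hs M)
        (fun x => (tm_sw (id : Ω → Ω) (cov M).i w0 x).symm)
        (fun x => (tm_sw (id : Ω → Ω) (cov M).p w0 x).symm) a
    constructor
    · rw [injective_iff_map_eq_zero]
      intro a ha
      apply hdi
      have := nat a
      rw [ha, map_zero] at this
      exact (injective_iff_map_eq_zero _).1 (ih _).1 _ this.symm
    · intro b
      obtain ⟨a', ha'⟩ := (ih _).2 (((cov M).tw Ω).δ n b)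
      have h1 : Hm n ((cov M).res j).ie a' = 0 := by
        apply (ih (F M)).1
        rw [map_zero, ← ((cov M).tw Ω).i_δ n b, ← ha']
        exact Hm_sq (sh_eqv hs (F M)) ((cov M).res j).ie ((cov M).tw Ω).ie (sh_eqv hs _)
          (fun _ => rfl) (fun x => (tm_sw (id : Ω → Ω) (cov M).i w0 x).symm) a'
      obtain ⟨a, rfl⟩ := ((cov M).res j).ker_i n a' h1
      refine ⟨a, ?_⟩
      rw [← sub_eq_zero]
      apply hdi'
      rw [map_sub, nat, ha', sub_self]
end shapiro
end GH

namespace GH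

/-- Homology with trivial integer coefficients. -/
abbrev HH (n : ℕ) (G : Type) [Group G] : Type := H n (triv G ℤ)

theorem triv_eqv {G G' : Type} [Group G] [Group G'] (f : G →* G') {A B : Type} [AddCommGroup A]
    [AddCommGroup B] (φ : A →+ B) : Eqv f (triv G A) (triv G' B) φ := fun _ _ => rfl

/-- Induced map on homology. -/
noncomputable def hm (n : ℕ) {G G' : Type} [Group G] [Group G'] (f : G →* G') : HH n G →+ HH n G' :=
  Hm n (triv_eqv f (AddMonoidHom.id ℤ))

section
variable {G G' G'' K Q T : Type} [Group G] [Group G'] [Group G''] [Group K] [Group Q] [Group T]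

theorem hm_comp (n : ℕ) (f' : G' →* G'') (f : G →* G') (a : HH n G) :
    hm n f' (hm n f a) = hm n (f'.comp f) a := by
  unfold hm
  rw [Hm_comp]

theorem hm_congr (n : ℕ) {f f' : G →* G'} (h : ∀ g, f g = f' g) (a : HH n G) :
    hm n f a = hm n f' a := Hm_congr _ _ h (fun _ => rfl) a

theorem hm_id (n : ℕ) {f : G →* G} (h : ∀ g, f g = g) (a : HH n G) : hm n f a = a :=
  Hm_id' _ h (fun _ => rfl) a

theorem hm_conj (n : ℕ) (t : G') {f f' : G →* G'} (h : ∀ g, f' g = t * f g * t⁻¹) (a : HH n G) :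
    hm n f' a = hm n f a := by
  rw [← Hm_conj n _ t (hm n f a)]
  unfold hm
  rw [Hm_comp]
  exact Hm_congr _ _ (fun g => by simp [h g]) (fun _ => rfl) a

theorem fr_trivial [Subsingleton G] (M : Rp G) : IsFr M := by
  refine ⟨sg M 1, ?_, ?_⟩
  · intro g m
    obtain rfl := Subsingleton.elim g 1
    simp [M.act_one, (F M).act_one]
  · intro m
    simp [M.act_one]

theorem hm_trivial (n : ℕ) {f : G →* G'} (h : ∀ g, f g = 1) (a : HH (n + 1) G) :
    hm (n + 1) f a = 0 := by
  have e : hm (n + 1) f a = hm (n + 1) (1 : Unit →* G') (hm (n + 1) (1 : G →* Unit) a) := by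
    rw [hm_comp]
    exact hm_congr _ h a
  rw [e, (fr_trivial (triv Unit ℤ)).vanish n (hm (n + 1) (1 : G →* Unit) a), map_zero]

/-! ### Directed unions -/

/-- Directed systems exhausting a group and a coefficient group. -/
structure Exh {I X A : Type} [AddCommGroup A] {Y : I → Type} {B : I → Type} [∀ k, AddCommGroup (B k)]
    (f : ∀ k, Y k → X) (φ : ∀ k, B k →+ A) : Prop where
  dir : ∀ k l, ∃ m, (∀ x, ∃ y, f m y = f k x) ∧ (∀ x, ∃ y, f m y = f l x) ∧
    (∀ x, ∃ y, φ m y = φ k x) ∧ (∀ x, ∃ y, φ m y = φ l x)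
  cov : ∀ x a, ∃ k, (∃ y, f k y = x) ∧ (∃ b, φ k b = a)

theorem Fmap_range {X X' Y A A' B : Type} [AddCommGroup A] [AddCommGroup A'] [AddCommGroup B]
    {f : X → Y} {f' : X' → Y} {φ : A →+ B} {φ' : A' →+ B} (h : ∀ x, ∃ y, f' y = f x)
    (h' : ∀ x, ∃ y, φ' y = φ x) (z : X →₀ A) : ∃ z', Fmap f' φ' z' = Fmap f φ z := by
  induction z using Finsupp.induction_linear with
  | zero => exact ⟨0, by simp⟩
  | add a b ha hb =>
    obtain ⟨x, hx⟩ := ha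
    obtain ⟨y, hy⟩ := hb
    exact ⟨x + y, by rw [map_add, map_add, hx, hy]⟩
  | single x a =>
    obtain ⟨y, hy⟩ := h x
    obtain ⟨b, hb⟩ := h' a
    exact ⟨Finsupp.single y b, by simp [hy, hb]⟩

theorem Exh.fmap {I X A : Type} [Nonempty X] [AddCommGroup A] {Y : I → Type} {B : I → Type}
    [∀ k, AddCommGroup (B k)]
    {f : ∀ k, Y k → X} {φ : ∀ k, B k →+ A} (h : Exh f φ) : Exh f (fun k => Fmap (f k) (φ k)) where
  dir k l := by
    obtain ⟨m, h1, h2, h3, h4⟩ := h.dir k l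
    exact ⟨m, h1, h2, Fmap_range h1 h3, Fmap_range h2 h4⟩
  cov x z := by
    induction z using Finsupp.induction_linear with
    | zero =>
      obtain ⟨k, h1, h2⟩ := h.cov x 0
      exact ⟨k, h1, 0, map_zero _⟩
    | add a b ha hb =>
      obtain ⟨k, h1, z, hz⟩ := ha
      obtain ⟨l, h2, w, hw⟩ := hb
      obtain ⟨m, h3, h4, h5, h6⟩ := h.dir k l
      refine ⟨m, ?_, ?_⟩
      · obtain ⟨y, rfl⟩ := h1
        exact h3 y
      · obtain ⟨z', hz'⟩ := Fmap_range h3 h5 z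
        obtain ⟨w', hw'⟩ := Fmap_range h4 h6 w
        exact ⟨z' + w', by rw [map_add, hz', hw', hz, hw]⟩
    | single y b =>
      obtain ⟨k, h1, _⟩ := h.cov x b
      obtain ⟨l, ⟨y', hy'⟩, ⟨b', hb'⟩⟩ := h.cov y b
      obtain ⟨m, h3, h4, h5, h6⟩ := h.dir k l
      refine ⟨m, ?_, ?_⟩
      · obtain ⟨y, rfl⟩ := h1
        exact h3 y
      · obtain ⟨z', hz'⟩ := Fmap_range h4 h6 (Finsupp.single y' b')
        exact ⟨z', by rw [hz']; simp [hy', hb']⟩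

theorem Exh.chain {I : Type} {Gk : I → Type} [∀ k, Group (Gk k)] {M : Rp G} {Mk : ∀ k, Rp (Gk k)}
    {f : ∀ k, Gk k → G} {φ : ∀ k, (Mk k).V →+ M.V} (h : Exh f φ) (n : ℕ) (c : C n M) :
    ∃ k c', Cm (f k) n (φ k) c' = c := by
  induction n generalizing M Mk with
  | zero =>
    obtain ⟨k, _, h2⟩ := h.cov 1 c
    exact ⟨k, h2⟩
  | succ n ih =>
    exact ih (M := F M) (Mk := fun k => F (Mk k)) (φ := fun k => fm (f k) (φ k)) h.fmap c

theorem Exh.homology {I : Type} {Gk : I → Type} [∀ k, Group (Gk k)]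
    {f : ∀ k, Gk k →* G} (hf : ∀ k, Function.Injective (f k))
    (hd : ∀ k l, ∃ m, (∀ x, ∃ y, f m y = f k x) ∧ (∀ x, ∃ y, f m y = f l x))
    (hc : ∀ x, ∃ k y, f k y = x) (n : ℕ) (a : HH n G) : ∃ k b, hm n (f k) b = a := by
  obtain ⟨c, hcc, rfl⟩ := mk_rep a
  have h : Exh (fun k => (f k : Gk k → G)) (fun _ => AddMonoidHom.id ℤ) :=
    { dir := fun k l => by
        obtain ⟨m, h1, h2⟩ := hd k l
        exact ⟨m, h1, h2, fun x => ⟨x, rfl⟩, fun x => ⟨x, rfl⟩⟩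
      cov := fun x a => by
        obtain ⟨k, y, hy⟩ := hc x
        exact ⟨k, ⟨y, hy⟩, a, rfl⟩ }
  obtain ⟨k, c', rfl⟩ := h.chain (M := triv G ℤ) (Mk := fun k => triv (Gk k) ℤ) n c
  exact ⟨k, hcl c' (Cm_mem_Z_iff n (triv_eqv (f k) (AddMonoidHom.id ℤ)) (hf k)
    Function.injective_id hcc), rfl⟩

/-! ### Slices -/

theorem slices (n : ℕ) (hK : ∀ a : HH n K, a = 0) (J : Type) (a : H n (triv K (J →₀ ℤ))) :
    a = 0 := by
  classical
  let π : Finset J → (J →₀ ℤ) →+ (J →₀ ℤ) := fun s => Finsupp.filterAddHom (fun j => j ∈ s)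
  have hπ : ∀ s z j, π s z j = if j ∈ s then z j else 0 := fun s z j => by
    simp [π, Finsupp.filterAddHom, Finsupp.filter_apply]
  have h0 : ∀ s, Hm n (triv_eqv (MonoidHom.id K) (π s)) a = 0 := by
    intro s
    induction s using Finset.induction_on with
    | empty =>
      refine Hm_zeroφ _ (fun m => ?_) a
      ext j
      rw [hπ]; simp
    | insert j s hj ih =>
      let α : (J →₀ ℤ) →+ ℤ := Finsupp.applyAddHom j
      let β : ℤ →+ (J →₀ ℤ) := Finsupp.singleAddHom j
      rw [Hm_addφ (triv_eqv (MonoidHom.id K) (π s))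
        (triv_eqv (MonoidHom.id K) (β.comp α)) _ (fun m => by
          ext i
          rw [Finsupp.add_apply, hπ, hπ]
          by_cases hi : i = j
          · subst hi; simp [hj, α, β]
          · simp [hi, α, β, Finsupp.single_apply, Ne.symm hi]), ih, zero_add]
      rw [← Hm_tri (triv_eqv (MonoidHom.id K) β) (triv_eqv (MonoidHom.id K) α)
        (triv_eqv (MonoidHom.id K) (β.comp α)) (fun _ => rfl) (fun _ => rfl)]
      rw [hK (Hm n (triv_eqv (MonoidHom.id K) α) a), map_zero]
  obtain ⟨c, hc, rfl⟩ := mk_rep a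
  have hE : Exh (fun _ : Finset J => (id : K → K)) π :=
    { dir := fun s t => ⟨s ∪ t, fun x => ⟨x, rfl⟩, fun x => ⟨x, rfl⟩, fun x => ⟨π s x, by
          ext j
          rw [hπ, hπ]
          by_cases h : j ∈ s <;> simp [h]⟩, fun x => ⟨π t x, by
          ext j
          rw [hπ, hπ]
          by_cases h : j ∈ t <;> simp [h]⟩⟩
      cov := fun x z => ⟨z.support, ⟨x, rfl⟩, z, by
          ext j
          rw [hπ]
          by_cases h : z j = 0 <;> simp [h]⟩ }
  obtain ⟨s, c', hc'⟩ := hE.chain (M := triv K (J →₀ ℤ)) (Mk := fun _ => triv K (J →₀ ℤ)) n c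
  rw [← h0 s, Hm_mk]
  refine mk_congr ?_ _
  rw [← hc']
  change _ = Cm (M := triv K (J →₀ ℤ)) (M' := triv K (J →₀ ℤ)) (id : K → K) n (π s) _
  rw [Cm_comp]
  congr 1
  congr 1
  refine AddMonoidHom.ext fun z => Finsupp.ext fun j => ?_
  rw [hπ]
  refine Eq.trans ?_ (hπ s (π s z) j).symm
  rw [hπ]
  by_cases h : j ∈ s <;> simp [h]

/-! ### Products with acyclic groups -/

/-- Vanishing of homology in degrees `1..m`. -/
def Acyc (m : ℕ) (K : Type) [Group K] : Prop := ∀ i, 1 ≤ i → i ≤ m → ∀ a : HH i K, a = 0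

theorem pr_eqv (K : Type) [Group K] (M : Rp G) :
    Eqv (MonoidHom.fst G K) (res (MonoidHom.fst G K) M) M (AddMonoidHom.id _) := fun _ _ => rfl

theorem tw_inr_bij (n : ℕ) (A : Type) [AddCommGroup A] :
    ∃ h : Eqv (MonoidHom.inr G K) (triv K A) (res (MonoidHom.fst G K) (Tw G (triv G A)))
      (sw (triv G A) (1 : G)), Function.Bijective (Hm n h) := by
  letI : MulAction (G × K) G := MulAction.compHom G (MonoidHom.fst G K)
  have hsm : ∀ (g : G × K) (x : G), g • x = g.1 * x := fun _ _ => rfl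
  exact ⟨_, shapiro (j := MonoidHom.inr G K) (w0 := (1 : G)) (fun a b h => (Prod.ext_iff.1 h).2)
    (fun g => by
      rw [hsm]
      constructor
      · intro h
        exact ⟨g.2, Prod.ext (by simpa using h.symm) rfl⟩
      · rintro ⟨h, rfl⟩
        simp)
    (fun w => ⟨(w, 1), by rw [hsm]; simp⟩) n (triv (G × K) A)⟩

theorem lemP {m : ℕ} (hK : Acyc m K) (n : ℕ) (hn : n ≤ m) (M : Rp G)
    (a : H n (res (MonoidHom.fst G K) M)) (ha : Hm n (pr_eqv K M) a = 0) : a = 0 := by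
  induction n generalizing M with
  | zero =>
    obtain ⟨x, rfl⟩ := toH0_surj _ a
    exact toH0_zero (M := M) (toH0 (res (MonoidHom.fst G K) M))
      (fun g m => toH0_act (M := res (MonoidHom.fst G K) M) (g, 1) m) x ha
  | succ n ih =>
    let A := M.V →₀ ℤ
    let q : G → A →+ M.V := fun x => (M.act x).comp (Finsupp.liftAddHom fun v => zmultiplesHom _ v)
    let p : (Tw G (triv G A)).V →+ M.V := tlift (triv G A) q
    have hp : Eqv (MonoidHom.id G) (Tw G (triv G A)) M p := by
      intro g z
      refine Tw_ext (φ := p.comp ((Tw G (triv G A)).act g)) (ψ := (M.act g).comp p) ?_ z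
      intro x m
      change p ((Tw G (triv G A)).act g (sw (triv G A) x m)) = M.act g (p (sw (triv G A) x m))
      have e1 : p (sw (triv G A) x m) = q x m := tlift_sw (triv G A) q x m
      have e2 : p (sw (triv G A) (g • x) m) = q (g • x) m := tlift_sw (triv G A) q (g • x) m
      have e3 : (Tw G (triv G A)).act g (sw (triv G A) x m) = sw (triv G A) (g • x) m :=
        Tw_act_sw (triv G A) g x m
      rw [e1]
      refine (congrArg p e3).trans (e2.trans ?_)
      exact M.act_mul _ _ _
    have hs : Function.Surjective p := fun v => ⟨sw (triv G A) 1 (Finsupp.single v 1),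
      (tlift_sw (triv G A) q 1 (Finsupp.single v 1)).trans (by
        simp only [q, AddMonoidHom.comp_apply, M.act_one]
        exact (Finsupp.liftAddHom_apply_single _ _ _).trans (one_zsmul v))⟩
    let S := kerSes hp hs
    have h1 := S.δ_nat n S (f := MonoidHom.id G) (Eqv.id' _) (Eqv.id' _) (Eqv.id' _)
      (fun _ => rfl) (fun _ => rfl)
    have h2 := (S.res (MonoidHom.fst G K)).δ_nat n S (pr_eqv K _) (pr_eqv K _) (pr_eqv K _)
      (fun _ => rfl) (fun _ => rfl) a
    rw [ha, map_zero] at h2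
    have h3 := ih (by omega) _ _ h2.symm
    obtain ⟨c, rfl⟩ := (S.res (MonoidHom.fst G K)).ker_δ n a h3
    obtain ⟨he, hb⟩ := tw_inr_bij (G := G) (K := K) (n + 1) A
    obtain ⟨b, rfl⟩ := hb.2 c
    rw [slices (n + 1) (hK (n + 1) (by omega) hn) M.V b, map_zero, map_zero]

theorem lemQ {m : ℕ} (hK : Acyc m K) (x : HH (m + 1) (G × K))
    (hx : hm (m + 1) (MonoidHom.fst G K) x = 0) : ∃ y, hm (m + 1) (MonoidHom.inr G K) y = x := by
  let p : (Tw G (triv G ℤ)).V →+ (triv G ℤ).V := tlift (triv G ℤ) fun _ => AddMonoidHom.id ℤ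
  have hp : Eqv (MonoidHom.id G) (Tw G (triv G ℤ)) (triv G ℤ) p := by
    intro g z
    refine Tw_ext (φ := p.comp ((Tw G (triv G ℤ)).act g)) (ψ := p) ?_ z
    intro x m
    have e3 : (Tw G (triv G ℤ)).act g (sw (triv G ℤ) x m) = sw (triv G ℤ) (g • x) m :=
      Tw_act_sw (triv G ℤ) g x m
    refine (congrArg p e3).trans ?_
    exact (tlift_sw (triv G ℤ) _ (g • x) m).trans (tlift_sw (triv G ℤ) (fun _ => AddMonoidHom.id ℤ) x m).symm
  have hs : Function.Surjective p := fun v => ⟨sw (triv G ℤ) 1 v, tlift_sw (triv G ℤ) _ 1 v⟩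
  let S := kerSes hp hs
  have h2 := (S.res (MonoidHom.fst G K)).δ_nat m S (pr_eqv K _) (pr_eqv K _) (pr_eqv K _)
      (fun _ => rfl) (fun _ => rfl) x
  have hx' : Hm (m + 1) (pr_eqv K (triv G ℤ)) x = 0 := hx
  rw [hx', map_zero] at h2
  have h3 := lemP hK m le_rfl _ _ h2.symm
  obtain ⟨c, rfl⟩ := (S.res (MonoidHom.fst G K)).ker_δ m x h3
  obtain ⟨he, hb⟩ := tw_inr_bij (G := G) (K := K) (m + 1) ℤ
  obtain ⟨b, rfl⟩ := hb.2 c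
  refine ⟨b, ?_⟩
  refine (Hm_tri (S.res (MonoidHom.fst G K)).pe he _ (fun _ => rfl) (fun v => ?_) b).symm
  exact tlift_sw _ _ _ _

theorem hm_fst_inj {m : ℕ} (hK : Acyc m K) (n : ℕ) (hn : n ≤ m) :
    Function.Injective (hm n (MonoidHom.fst G K)) := by
  rw [injective_iff_map_eq_zero]
  exact fun a ha => lemP hK n hn (triv G ℤ) a ha

theorem hm_fst_surj (n : ℕ) : Function.Surjective (hm n (MonoidHom.fst G K)) := fun b =>
  ⟨hm n (MonoidHom.inl G K) b, by rw [hm_comp]; exact hm_id _ (fun _ => rfl) b⟩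

theorem mather {m : ℕ} (hQ : Acyc m Q) (i ψ : Q →* T) (hc : ∀ a b, i a * ψ b = ψ b * i a) (t : T)
    (ht : ∀ q, i q * ψ q = t * ψ q * t⁻¹) (x : HH (m + 1) Q) : hm (m + 1) i x = 0 := by
  let μ : Q × Q →* T := MonoidHom.noncommCoprod i ψ (fun a b => hc a b)
  let Δ : Q →* Q × Q := (MonoidHom.id Q).prod (MonoidHom.id Q)
  let y := hm (m + 1) Δ x - hm (m + 1) (MonoidHom.inl Q Q) x - hm (m + 1) (MonoidHom.inr Q Q) x
  have h1 : hm (m + 1) (MonoidHom.fst Q Q) y = 0 := by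
    simp only [y, map_sub, hm_comp]
    rw [hm_id (f := (MonoidHom.fst Q Q).comp Δ) _ (fun _ => rfl),
      hm_id (f := (MonoidHom.fst Q Q).comp (MonoidHom.inl Q Q)) _ (fun _ => rfl),
      hm_trivial m (f := (MonoidHom.fst Q Q).comp (MonoidHom.inr Q Q)) (fun _ => rfl)]
    simp
  have h2 : hm (m + 1) (MonoidHom.snd Q Q) y = 0 := by
    simp only [y, map_sub, hm_comp]
    rw [hm_id (f := (MonoidHom.snd Q Q).comp Δ) _ (fun _ => rfl),
      hm_id (f := (MonoidHom.snd Q Q).comp (MonoidHom.inr Q Q)) _ (fun _ => rfl),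
      hm_trivial m (f := (MonoidHom.snd Q Q).comp (MonoidHom.inl Q Q)) (fun _ => rfl)]
    simp
  have h3 : y = 0 := by
    obtain ⟨w, hw⟩ := lemQ hQ y h1
    rw [← hw, hm_comp, hm_id (f := (MonoidHom.snd Q Q).comp (MonoidHom.inr Q Q)) _ (fun _ => rfl)]
      at h2
    rw [← hw, h2, map_zero]
  have h4 : hm (m + 1) μ y = 0 := by rw [h3, map_zero]
  simp only [y, map_sub, hm_comp] at h4
  have hμ : ∀ a b, μ (a, b) = i a * ψ b := fun _ _ => rfl
  rw [hm_congr (f := μ.comp (MonoidHom.inl Q Q)) (f' := i) _ (fun g => by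
    change μ (g, 1) = i g
    rw [hμ, map_one, mul_one]) x] at h4
  rw [hm_congr (f := μ.comp (MonoidHom.inr Q Q)) (f' := ψ) _ (fun g => by
    change μ (1, g) = ψ g
    rw [hμ, map_one, one_mul]) x] at h4
  rw [hm_conj (f' := μ.comp Δ) (f := ψ) _ t (fun g => (hμ g g).trans (ht g)) x] at h4
  simpa using h4

end
end GH

namespace GH
open Monoid

/-- The properties of an amalgamated product which we use. -/
structure Amal {L X Y G : Type} [Group L] [Group X] [Group Y] [Group G] (i1 : L →* X) (i2 : L →* Y)
    (jX : X →* G) (jY : Y →* G) : Prop where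
  inj1 : Function.Injective i1
  inj2 : Function.Injective i2
  injX : Function.Injective jX
  injY : Function.Injective jY
  comm : ∀ l, jX (i1 l) = jY (i2 l)
  lift : ∀ (K : Type) [Group K] (f : X →* K) (g : Y →* K), (∀ l, f (i1 l) = g (i2 l)) →
    ∃ h : G →* K, (∀ x, h (jX x) = f x) ∧ ∀ y, h (jY y) = g y
  gen : ∀ P : G → Prop, P 1 → (∀ g x, P g → P (g * jX x)) → (∀ g y, P g → P (g * jY y)) → ∀ g, P g
  cen : (∃ x, ∀ l, i1 l ≠ x) → (∃ y, ∀ l, i2 l ≠ y) → ∀ z : G, (∀ g, g * z = z * g) →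
    ∃ l, jX (i1 l) = z

section words
variable {L : Type} [Group L] {Gf : Bool → Type} [∀ i, Group (Gf i)] {φ : ∀ i, L →* Gf i}

/-- Elements represented by reduced words. -/
inductive Red (φ : ∀ i, L →* Gf i) : Bool → Bool → PushoutI φ → Prop
  | one (i : Bool) (x : Gf i) (hx : x ∉ (φ i).range) : Red φ i i (PushoutI.of i x)
  | cons (i j : Bool) (x : Gf i) (hx : x ∉ (φ i).range) (g : PushoutI φ) (h : Red φ (!i) j g) :
      Red φ i j (PushoutI.of i x * g)

theorem Red.word {i j : Bool} {g : PushoutI φ} (h : Red φ i j g) :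
    ∃ w : CoprodI.Word Gf, PushoutI.Reduced φ w ∧ PushoutI.ofCoprodI w.prod = g ∧
      w.fstIdx = some i := by
  induction h with
  | one i x hx =>
    refine ⟨CoprodI.Word.cons x CoprodI.Word.empty (by simp [CoprodI.Word.fstIdx]) (by
      rintro rfl; exact hx (one_mem _)), ?_, by simp, by simp [CoprodI.Word.fstIdx, CoprodI.Word.cons]⟩
    intro g hg
    simp [CoprodI.Word.cons] at hg
    subst hg
    exact hx
  | cons i j x hx g h ih =>
    obtain ⟨w, h1, h2, h3⟩ := ih
    refine ⟨CoprodI.Word.cons x w (by rw [h3]; simp) (by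
      rintro rfl; exact hx (one_mem _)), ?_, by simp [h2], by
        simp [CoprodI.Word.fstIdx, CoprodI.Word.cons]⟩
    intro g hg
    simp only [CoprodI.Word.cons, List.mem_cons] at hg
    rcases hg with rfl | hg
    · exact hx
    · exact h1 g hg

theorem Red.not_base (hφ : ∀ i, Function.Injective (φ i)) {i j : Bool} {g : PushoutI φ}
    (h : Red φ i j g) : g ∉ (PushoutI.base φ).range := by
  intro hg
  obtain ⟨w, h1, rfl, h3⟩ := h.word
  have := h1.eq_empty_of_mem_range hφ hg
  subst this
  simp [CoprodI.Word.fstIdx] at h3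

theorem Red.mul {i j k l : Bool} {g h : PushoutI φ} (hg : Red φ i j g) (hj : k = !j)
    (hh : Red φ k l h) : Red φ i l (g * h) := by
  induction hg with
  | one i x hx => subst hj; exact Red.cons i l x hx h hh
  | cons i j x hx g hg ih =>
    rw [mul_assoc]
    exact Red.cons i l x hx _ (ih hj)

theorem Red.inv {i j : Bool} {g : PushoutI φ} (hg : Red φ i j g) : Red φ j i g⁻¹ := by
  induction hg with
  | one i x hx =>
    rw [← map_inv]
    exact Red.one i _ (by rwa [inv_mem_iff])
  | cons i j x hx g hg ih =>
    rw [mul_inv_rev, ← map_inv]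
    exact ih.mul (by simp) (Red.one i _ (by rwa [inv_mem_iff]))

theorem Red.base_mul {i j : Bool} {g : PushoutI φ} (hg : Red φ i j g) (l : L) :
    Red φ i j (PushoutI.base φ l * g) := by
  cases hg with
  | one _ x hx =>
    rw [← PushoutI.of_apply_eq_base φ i, ← map_mul]
    exact Red.one i _ (fun h => hx (by simpa using (mul_mem_cancel_left (⟨l, rfl⟩ : φ i l ∈ (φ i).range)).1 h))
  | cons _ _ x hx g hg =>
    rw [← PushoutI.of_apply_eq_base φ i, ← mul_assoc, ← map_mul]
    exact Red.cons i _ _ (fun h => hx (by simpa using (mul_mem_cancel_left (⟨l, rfl⟩ : φ i l ∈ (φ i).range)).1 h)) _ hg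

theorem Red.of_mul (i : Bool) (x : Gf i) (g : PushoutI φ)
    (hg : g ∈ (PushoutI.base φ).range ∨ ∃ i j, Red φ i j g) :
    PushoutI.of i x * g ∈ (PushoutI.base φ).range ∨ ∃ k j, Red φ k j (PushoutI.of i x * g) := by
  by_cases hx : x ∈ (φ i).range
  · obtain ⟨l, rfl⟩ := hx
    rw [PushoutI.of_apply_eq_base φ i]
    rcases hg with hg | ⟨a, b, hg⟩
    · exact Or.inl (mul_mem ⟨l, rfl⟩ hg)
    · exact Or.inr ⟨a, b, hg.base_mul l⟩
  · rcases hg with ⟨l, rfl⟩ | ⟨a, b, hg⟩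
    · rw [← PushoutI.of_apply_eq_base φ i, ← map_mul]
      exact Or.inr ⟨i, i, Red.one i _ (fun h => hx ((mul_mem_cancel_right (⟨l, rfl⟩ : φ i l ∈ (φ i).range)).1 h))⟩
    · by_cases ha : a = !i
      · subst ha
        exact Or.inr ⟨i, b, Red.cons i b x hx g hg⟩
      · have : a = i := by cases a <;> cases i <;> simp_all
        subst this
        cases hg with
        | one _ y hy =>
          rw [← map_mul]
          by_cases h : x * y ∈ (φ a).range
          · obtain ⟨l, hl⟩ := h
            rw [← hl, PushoutI.of_apply_eq_base φ a]
            exact Or.inl ⟨l, rfl⟩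
          · exact Or.inr ⟨a, a, Red.one a _ h⟩
        | cons _ _ y hy g hg =>
          rw [← mul_assoc, ← map_mul]
          by_cases h : x * y ∈ (φ a).range
          · obtain ⟨l, hl⟩ := h
            rw [← hl, PushoutI.of_apply_eq_base φ a]
            exact Or.inr ⟨_, _, hg.base_mul l⟩
          · exact Or.inr ⟨a, b, Red.cons a b _ h g hg⟩

theorem Red.all (g : PushoutI φ) : g ∈ (PushoutI.base φ).range ∨ ∃ i j, Red φ i j g := by
  have : ∀ h : PushoutI φ, (h ∈ (PushoutI.base φ).range ∨ ∃ i j, Red φ i j h) →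
      (g * h ∈ (PushoutI.base φ).range ∨ ∃ i j, Red φ i j (g * h)) := by
    induction g using PushoutI.induction_on with
    | of i x => exact fun h hh => Red.of_mul i x h hh
    | base l =>
      intro h hh
      rw [← PushoutI.of_apply_eq_base φ true]
      exact Red.of_mul true _ h hh
    | mul x y hx hy =>
      intro h hh
      rw [mul_assoc]
      exact hx _ (hy _ hh)
  simpa using this 1 (Or.inl (one_mem _))

theorem Red.center (hφ : ∀ i, Function.Injective (φ i)) (hp : ∀ i, ∃ x, x ∉ (φ i).range)
    (z : PushoutI φ) (hz : ∀ g, g * z = z * g) : z ∈ (PushoutI.base φ).range := by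
  rcases Red.all z with h | ⟨i, j, h⟩
  · exact h
  exfalso
  by_cases hij : i = j
  · subst hij
    obtain ⟨y, hy⟩ := hp (!i)
    have hy' := Red.one (φ := φ) (!i) y hy
    have h1 := ((hy'.inv.mul (by simp) h).mul rfl hy').mul (by simp) h.inv
    refine h1.not_base hφ ?_
    rw [mul_assoc _ z, ← hz]
    simp
  · have hj : j = !i := by cases i <;> cases j <;> simp_all
    subst hj
    have h2 : Red φ (!i) i z := by
      generalize hk : (!i) = k at h
      cases h with
      | one _ x hx => simp at hk
      | cons _ _ x hx g hg =>
        have e : PushoutI.of i x * g = g * PushoutI.of i x := by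
          have := hz (PushoutI.of i x)
          rw [mul_assoc] at this
          exact mul_left_cancel this
        rw [e]
        subst hk
        exact hg.mul (by simp) (Red.one i x hx)
    exact (h2.mul rfl h.inv).not_base hφ (by simp)
end words

/-- A pair of groups as a family. -/
def Pf (X Y : Type) : Bool → Type := fun b => Bool.casesOn b X Y

/-- The group structure on the family. -/
def Pf.grp (X Y : Type) [hX : Group X] [hY : Group Y] (b : Bool) : Group (Pf X Y b) :=
  Bool.casesOn (motive := fun b => Group (Pf X Y b)) b hX hY

theorem exists_amal {L X Y : Type} [Group L] [Group X] [Group Y] (i1 : L →* X) (i2 : L →* Y)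
    (h1 : Function.Injective i1) (h2 : Function.Injective i2) :
    ∃ (G : Type) (_ : Group G) (jX : X →* G) (jY : Y →* G), Amal i1 i2 jX jY := by
  let Gf : Bool → Type := Pf X Y
  letI : ∀ i, Group (Gf i) := Pf.grp X Y
  let φ : ∀ i, L →* Gf i := fun i => match i with
    | true => i2
    | false => i1
  have hφ : ∀ i, Function.Injective (φ i) := fun i => match i with
    | true => h2
    | false => h1
  refine ⟨PushoutI φ, inferInstance, (PushoutI.of false : Gf false →* PushoutI φ),
    (PushoutI.of true : Gf true →* PushoutI φ), ⟨h1, h2, PushoutI.of_injective hφ false,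
    PushoutI.of_injective hφ true, ?_, ?_, ?_, ?_⟩⟩
  · intro l
    exact (PushoutI.of_apply_eq_base φ false l).trans (PushoutI.of_apply_eq_base φ true l).symm
  · intro K _ f g hfg
    let ff : ∀ i, Gf i →* K := fun i => match i with
      | true => g
      | false => f
    have hff : ∀ i, (ff i).comp (φ i) = f.comp i1 := fun i => match i with
      | true => MonoidHom.ext fun l => (hfg l).symm
      | false => rfl
    exact ⟨PushoutI.lift ff _ hff, fun x => PushoutI.lift_of ff _ hff (i := false) x,
      fun x => PushoutI.lift_of ff _ hff (i := true) x⟩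
  · intro P h1 hX hY g
    have key : ∀ h, P h → P (h * g) := by
      induction g using PushoutI.induction_on with
      | of i x => exact match i, x with
        | true, x => fun h hh => hY h x hh
        | false, x => fun h hh => hX h x hh
      | base l =>
        intro h hh
        rw [← PushoutI.of_apply_eq_base φ true]
        exact hY h _ hh
      | mul x y hx hy =>
        intro h hh
        rw [← mul_assoc]
        exact hy _ (hx _ hh)
    simpa using key 1 h1
  · rintro ⟨x, hx⟩ ⟨y, hy⟩ z hz
    obtain ⟨l, hl⟩ := Red.center hφ (fun i => match i with
      | true => ⟨y, fun ⟨l, hl⟩ => hy l hl⟩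
      | false => ⟨x, fun ⟨l, hl⟩ => hx l hl⟩) z hz
    exact ⟨l, (PushoutI.of_apply_eq_base φ false l).trans hl⟩
end GH

namespace GH

section perm
variable {G : Type} [Group G] {Ω : Type} [MulAction G Ω]

/-- Permutation module. -/
noncomputable def Pm (G : Type) [Group G] (Ω : Type) [MulAction G Ω] : Rp G := Tw Ω (triv G ℤ)

/-- Inclusion of a coordinate. -/
noncomputable def ps (G : Type) [Group G] {Ω : Type} [MulAction G Ω] (x : Ω) : ℤ →+ (Pm G Ω).V :=
  sw (triv G ℤ) x

/-- Basis element. -/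
noncomputable def pt (G : Type) [Group G] {Ω : Type} [MulAction G Ω] (x : Ω) : (Pm G Ω).V := ps G x 1

theorem Pm_act (g : G) (x : Ω) : (Pm G Ω).act g (pt G x) = pt G (g • x) :=
  Tw_act_sw (triv G ℤ) g x (1 : ℤ)

theorem Pm_ext {A : Type*} [AddCommGroup A] {φ ψ : (Pm G Ω).V →+ A}
    (h : ∀ x, φ (pt G x) = ψ (pt G x)) (z : (Pm G Ω).V) : φ z = ψ z := by
  refine Tw_ext (M := triv G ℤ) (φ := φ) (ψ := ψ) (fun x => ?_) z
  have : φ.comp (ps G x) = ψ.comp (ps G x) := AddMonoidHom.ext_int (h x)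
  exact fun m => DFunLike.congr_fun this m

/-- Maps out of permutation modules. -/
noncomputable def plift (G : Type) [Group G] {Ω : Type} [MulAction G Ω] {A : Type*} [AddCommGroup A]
    (u : Ω → A) : (Pm G Ω).V →+ A :=
  tlift (triv G ℤ) fun x => zmultiplesHom A (u x)

theorem plift_pt {A : Type*} [AddCommGroup A] (u : Ω → A) (x : Ω) : plift G u (pt G x) = u x :=
  (tlift_sw (triv G ℤ) (fun x => zmultiplesHom A (u x)) x (1 : ℤ)).trans (one_zsmul _)

theorem plift_ps {A : Type*} [AddCommGroup A] (u : Ω → A) (x : Ω) (m : ℤ) :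
    plift G u (ps G x m) = zmultiplesHom A (u x) m :=
  (tlift_sw (triv G ℤ) (fun x => zmultiplesHom A (u x)) x m)

theorem plift_eqv {M : Rp G} {u : Ω → M.V} (h : ∀ g x, u (g • x) = M.act g (u x)) :
    Eqv (MonoidHom.id G) (Pm G Ω) M (plift G u) := by
  intro g z
  refine Pm_ext (φ := (plift G u).comp ((Pm G Ω).act g)) (ψ := (M.act g).comp (plift G u)) ?_ z
  intro x
  rw [AddMonoidHom.comp_apply, AddMonoidHom.comp_apply, Pm_act, plift_pt, plift_pt, h]

theorem ps_eqv {K : Type} [Group K] {j : K →* G} {w0 : Ω} (hs : ∀ g : G, g • w0 = w0 ↔ ∃ h, j h = g) :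
    Eqv j (triv K ℤ) (Pm G Ω) (ps G w0) := sh_eqv hs (triv G ℤ)

theorem ps_bij {K : Type} [Group K] {j : K →* G} {w0 : Ω} (hj : Function.Injective j)
    (hs : ∀ g : G, g • w0 = w0 ↔ ∃ h, j h = g) (ht : ∀ w : Ω, ∃ g : G, g • w0 = w) (n : ℕ) :
    Function.Bijective (Hm n (ps_eqv hs)) := shapiro hj hs ht n (triv G ℤ)

/-- Product of representations. -/
@[reducible] def Rp.prod (M N : Rp G) : Rp G where
  V := M.V × N.V
  act g := (M.act g).prodMap (N.act g)
  act_one v := Prod.ext (M.act_one _) (N.act_one _)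
  act_mul g h v := Prod.ext (M.act_mul _ _ _) (N.act_mul _ _ _)

variable (M N : Rp G)
theorem inl_eqv : Eqv (MonoidHom.id G) M (M.prod N) (AddMonoidHom.inl M.V N.V) :=
  fun g _ => Prod.ext rfl (map_zero (N.act g)).symm
theorem inr_eqv : Eqv (MonoidHom.id G) N (M.prod N) (AddMonoidHom.inr M.V N.V) :=
  fun g _ => Prod.ext (map_zero (M.act g)).symm rfl
theorem fst_eqv : Eqv (MonoidHom.id G) (M.prod N) M (AddMonoidHom.fst M.V N.V) := fun _ _ => rfl
theorem snd_eqv : Eqv (MonoidHom.id G) (M.prod N) N (AddMonoidHom.snd M.V N.V) := fun _ _ => rfl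

theorem prod_decomp (n : ℕ) (a : H n (M.prod N)) :
    a = Hm n (inl_eqv M N) (Hm n (fst_eqv M N) a) + Hm n (inr_eqv M N) (Hm n (snd_eqv M N) a) := by
  rw [Hm_comp, Hm_comp]
  refine Eq.trans ?_ (Hm_addφ (f := MonoidHom.id G)
    ((inl_eqv M N).comp (fst_eqv M N)) ((inr_eqv M N).comp (snd_eqv M N)) (Eqv.id' _) (fun m => ?_) a)
  · exact (Hm_id' _ (fun _ => rfl) (fun _ => rfl) a).symm
  · exact Prod.ext (add_zero _).symm (zero_add _).symm

theorem fst_inl (n : ℕ) (a : H n M) : Hm n (fst_eqv M N) (Hm n (inl_eqv M N) a) = a :=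
  (Hm_tri (fst_eqv M N) (inl_eqv M N) (Eqv.id' M) (fun _ => rfl) (fun _ => rfl) a).trans
    (Hm_id' _ (fun _ => rfl) (fun _ => rfl) a)
theorem snd_inr (n : ℕ) (a : H n N) : Hm n (snd_eqv M N) (Hm n (inr_eqv M N) a) = a :=
  (Hm_tri (snd_eqv M N) (inr_eqv M N) (Eqv.id' N) (fun _ => rfl) (fun _ => rfl) a).trans
    (Hm_id' _ (fun _ => rfl) (fun _ => rfl) a)
theorem snd_inl (n : ℕ) (a : H n M) : Hm n (snd_eqv M N) (Hm n (inl_eqv M N) a) = 0 := by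
  rw [Hm_comp]
  exact Hm_zeroφ _ (fun _ => rfl) a
theorem fst_inr (n : ℕ) (a : H n N) : Hm n (fst_eqv M N) (Hm n (inr_eqv M N) a) = 0 := by
  rw [Hm_comp]
  exact Hm_zeroφ _ (fun _ => rfl) a

/-- A representation as an action by permutations. -/
def Rp.perm (M : Rp G) : G →* Equiv.Perm M.V where
  toFun g := ⟨M.act g, M.act g⁻¹, fun v => M.act_inv_act g v, fun v => M.act_act_inv g v⟩
  map_one' := Equiv.ext fun v => M.act_one v
  map_mul' g h := Equiv.ext fun v => M.act_mul g h v

end perm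

section mv
variable {L X Y G : Type} [Group L] [Group X] [Group Y] [Group G] {i1 : L →* X} {i2 : L →* Y}
  {jX : X →* G} {jY : Y →* G}

theorem coset_stab {K : Type} [Group K] (j : K →* G) (g : G) :
    g • (((1 : G) : G ⧸ j.range)) = ((1 : G) : G ⧸ j.range) ↔ ∃ h, j h = g := by
  rw [MulAction.Quotient.smul_coe, eq_comm, QuotientGroup.eq]
  simp [MonoidHom.mem_range]

theorem coset_trans {K : Type} [Group K] (j : K →* G) (w : G ⧸ j.range) :
    ∃ g : G, g • (((1 : G) : G ⧸ j.range)) = w := by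
  obtain ⟨g, rfl⟩ := QuotientGroup.mk_surjective w
  exact ⟨g, by rw [MulAction.Quotient.smul_coe]; simp⟩

theorem coset_mul {K : Type} [Group K] (j : K →* G) (g : G) (k : K) :
    ((g * j k : G) : G ⧸ j.range) = g := by
  rw [eq_comm, QuotientGroup.eq]
  simp

/-- Projection between coset spaces. -/
def cproj {K K' : Type} [Group K] [Group K'] (j : K →* G) (j' : K' →* G) (i : K →* K')
    (h : ∀ k, j' (i k) = j k) : G ⧸ j.range → G ⧸ j'.range :=
  Quotient.lift (fun g => (g : G ⧸ j'.range)) (by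
    intro a b hab
    have : a⁻¹ * b ∈ j.range := by
      rw [← QuotientGroup.leftRel_apply]; exact hab
    obtain ⟨k, hk⟩ := this
    obtain rfl : b = a * j' (i k) := by rw [h, hk]; group
    exact (coset_mul _ _ _).symm)

theorem Amal.ses (h : Amal i1 i2 jX jY) :
    ∃ S : Ses (Pm G (G ⧸ (jX.comp i1).range)) ((Pm G (G ⧸ jX.range)).prod (Pm G (G ⧸ jY.range)))
      (triv G ℤ), (∀ m, S.i (ps G (((1 : G) : G ⧸ (jX.comp i1).range)) m) =
        (ps G (((1 : G) : G ⧸ jX.range)) m, ps G (((1 : G) : G ⧸ jY.range)) m)) ∧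
      (∀ m, S.p (ps G (((1 : G) : G ⧸ jX.range)) m, 0) = m) ∧
      (∀ m, S.p (0, ps G (((1 : G) : G ⧸ jY.range)) m) = -m) := by
  let L' := jX.comp i1
  let PL := Pm G (G ⧸ L'.range)
  let PX := Pm G (G ⧸ jX.range)
  let PY := Pm G (G ⧸ jY.range)
  let uX : G ⧸ L'.range → PX.V := fun w => pt G (cproj L' jX i1 (fun _ => rfl) w)
  let uY : G ⧸ L'.range → PY.V := fun w => pt G (cproj L' jY i2 (fun k => (h.comm k).symm) w)
  have huX : ∀ g w, uX (g • w) = PX.act g (uX w) := by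
    intro g w
    obtain ⟨k, rfl⟩ := QuotientGroup.mk_surjective w
    exact (Pm_act (Ω := G ⧸ jX.range) g (k : G ⧸ jX.range)).symm
  have huY : ∀ g w, uY (g • w) = PY.act g (uY w) := by
    intro g w
    obtain ⟨k, rfl⟩ := QuotientGroup.mk_surjective w
    exact (Pm_act (Ω := G ⧸ jY.range) g (k : G ⧸ jY.range)).symm
  let i : PL.V →+ (PX.prod PY).V := (plift G uX).prod (plift G uY)
  have ie : Eqv (MonoidHom.id G) PL (PX.prod PY) i := fun g m =>
    Prod.ext (plift_eqv huX g m) (plift_eqv huY g m)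
  let eX : PX.V →+ ℤ := plift G fun _ => 1
  let eY : PY.V →+ ℤ := plift G fun _ => 1
  have eXe : Eqv (MonoidHom.id G) PX (triv G ℤ) eX := plift_eqv (fun _ _ => rfl)
  have eYe : Eqv (MonoidHom.id G) PY (triv G ℤ) eY := plift_eqv (fun _ _ => rfl)
  have heX : ∀ w, eX (pt G w) = 1 := fun w => plift_pt _ w
  have heY : ∀ w, eY (pt G w) = 1 := fun w => plift_pt _ w
  let p : (PX.prod PY).V →+ ℤ := (eX.comp (AddMonoidHom.fst PX.V PY.V)) -
    (eY.comp (AddMonoidHom.snd PX.V PY.V))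
  have pp : ∀ a b, p (a, b) = eX a - eY b := fun _ _ => rfl
  have pe : Eqv (MonoidHom.id G) (PX.prod PY) (triv G ℤ) p := by
    rintro g ⟨a, b⟩
    exact congrArg₂ (· - ·) (eXe g a) (eYe g b)
  have ipt : ∀ g : G, i (pt G (g : G ⧸ L'.range)) =
      (pt G (g : G ⧸ jX.range), pt G (g : G ⧸ jY.range)) := fun g =>
    Prod.ext (plift_pt _ _) (plift_pt _ _)
  have pi : ∀ x, p (i x) = 0 := by
    refine Pm_ext (φ := p.comp i) (ψ := 0) fun w => ?_
    obtain ⟨g, rfl⟩ := QuotientGroup.mk_surjective w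
    rw [AddMonoidHom.comp_apply, ipt, pp, heX, heY]
    simp
  let b0 : PL.V := pt G (((1 : G) : G ⧸ L'.range))
  have hb0 : ∀ l, PL.act (jX (i1 l)) b0 = b0 := by
    intro l
    refine (Pm_act _ _).trans ?_
    have := (coset_stab L' (jX (i1 l))).2 ⟨l, rfl⟩
    rw [this]
  let τ : Equiv.Perm PL.V := Equiv.addRight b0
  obtain ⟨Φ, hΦX, hΦY⟩ := h.lift (Equiv.Perm PL.V) (PL.perm.comp jX)
    ((MulAut.conj τ).toMonoidHom.comp (PL.perm.comp jY)) (by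
      intro l
      ext v
      change PL.act (jX (i1 l)) v = PL.act (jY (i2 l)) (v + -b0) + b0
      rw [← h.comm, map_add, map_neg, hb0]
      abel)
  let D : G → PL.V := fun g => Φ g 0
  have hX : ∀ x v, Φ (jX x) v = PL.act (jX x) v := fun x v => by
    rw [hΦX]; rfl
  have hY : ∀ y v, Φ (jY y) v = PL.act (jY y) v + (b0 - PL.act (jY y) b0) := fun x v => by
    rw [hΦY]
    change PL.act (jY x) (v + -b0) + b0 = _
    rw [map_add, map_neg]
    abel
  have hD : ∀ g v, Φ g v = PL.act g v + D g := by
    refine h.gen _ ?_ ?_ ?_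
    · intro v
      simp [D, PL.act_one]
    · intro g x hg v
      simp only [D, map_mul, Equiv.Perm.mul_apply] at hg ⊢
      rw [hX, hX, map_zero (PL.act (jX x)), hg, PL.act_mul]
    · intro g x hg v
      simp only [D, map_mul, Equiv.Perm.mul_apply] at hg ⊢
      rw [hY, hY, map_zero (PL.act (jY x)), zero_add, hg, hg (b0 - _), PL.act_mul,
        map_add (PL.act g)]
      abel
  have hDX : ∀ g x, D (g * jX x) = D g := fun g x => by
    simp only [D, map_mul, Equiv.Perm.mul_apply]
    rw [hX, map_zero (PL.act (jX x))]
  have hDY : ∀ g y, D (g * jY y) + PL.act (g * jY y) b0 = D g + PL.act g b0 := fun g y => by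
    have : D (g * jY y) = Φ g (Φ (jY y) 0) := by simp only [D, map_mul, Equiv.Perm.mul_apply]
    rw [this, hD, hY, PL.act_mul, map_zero, zero_add, map_sub]
    abel
  let vX : G ⧸ jX.range → PL.V := Quotient.lift (fun g => - D g) (by
    intro a b hab
    have : a⁻¹ * b ∈ jX.range := by
      rw [← QuotientGroup.leftRel_apply]; exact hab
    obtain ⟨k, hk⟩ := this
    obtain rfl : b = a * jX k := by rw [hk]; group
    change - D _ = - D _
    rw [hDX])
  let vY : G ⧸ jY.range → PL.V := Quotient.lift (fun g => D g + PL.act g b0) (by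
    intro a b hab
    have : a⁻¹ * b ∈ jY.range := by
      rw [← QuotientGroup.leftRel_apply]; exact hab
    obtain ⟨k, hk⟩ := this
    obtain rfl : b = a * jY k := by rw [hk]; group
    exact (hDY a k).symm)
  have inj : Function.Injective i := by
    refine Function.LeftInverse.injective (g := fun w => plift G vX w.1 + plift G vY w.2) ?_
    intro z
    let r : (PX.prod PY).V →+ PL.V := ((plift G vX).comp (AddMonoidHom.fst PX.V PY.V)) +
      ((plift G vY).comp (AddMonoidHom.snd PX.V PY.V))
    have hr : ∀ a b, r (a, b) = plift G vX a + plift G vY b := fun _ _ => rfl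
    refine Pm_ext (φ := r.comp i) (ψ := AddMonoidHom.id _) ?_ z
    intro w
    obtain ⟨g, rfl⟩ := QuotientGroup.mk_surjective w
    rw [AddMonoidHom.comp_apply, ipt, hr, plift_pt, plift_pt]
    change - D g + (D g + PL.act g b0) = _
    rw [neg_add_cancel_left]
    refine (Pm_act _ _).trans ?_
    rw [MulAction.Quotient.smul_coe]
    simp
  have ex : ∀ w, p w = 0 → ∃ a, i a = w := by
    let π := QuotientAddGroup.mk' i.range
    have hπ : ∀ a, π (i a) = 0 := fun a => (QuotientAddGroup.eq_zero_iff _).2 ⟨a, rfl⟩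
    let πX : PX.V →+ _ := π.comp (AddMonoidHom.inl PX.V PY.V)
    let πY : PY.V →+ _ := π.comp (AddMonoidHom.inr PX.V PY.V)
    have hsp : ∀ a b, π (a, b) = πX a + πY b := fun a b => by
      change _ = π (a, 0) + π (0, b)
      rw [← map_add]
      refine congrArg π (Prod.ext (add_zero _).symm (zero_add _).symm)
    have h1 : ∀ g : G, πX (pt G (g : G ⧸ jX.range)) = - πY (pt G (g : G ⧸ jY.range)) := fun g => by
      rw [eq_neg_iff_add_eq_zero, ← hsp, ← ipt, hπ]
    let c := πX (pt G (((1 : G) : G ⧸ jX.range)))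
    have hc : ∀ g : G, πX (pt G (g : G ⧸ jX.range)) = c := by
      refine h.gen _ rfl ?_ ?_
      · intro g x hg
        rw [coset_mul, hg]
      · intro g x hg
        rw [h1, coset_mul, ← h1, hg]
    have hX' : ∀ a, πX a = zmultiplesHom _ c (eX a) := by
      refine Pm_ext (φ := πX) (ψ := (zmultiplesHom _ c).comp eX) ?_
      intro w
      obtain ⟨g, rfl⟩ := QuotientGroup.mk_surjective w
      rw [hc, AddMonoidHom.comp_apply]
      rw [heX]
      simp
    have hY' : ∀ a, πY a = - zmultiplesHom _ c (eY a) := by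
      refine Pm_ext (φ := πY) (ψ := - (zmultiplesHom _ c).comp eY) ?_
      intro w
      obtain ⟨g, rfl⟩ := QuotientGroup.mk_surjective w
      have h2 : πY (pt G (g : G ⧸ jY.range)) = -c := by rw [← hc g, h1 g, neg_neg]
      rw [h2]
      change -c = - zmultiplesHom _ c (eY (pt G (g : G ⧸ jY.range)))
      rw [heY]
      simp
    rintro ⟨a, b⟩ hw
    have : π (a, b) = 0 := by
      rw [hsp, hX', hY', ← sub_eq_add_neg, ← map_sub]
      rw [pp] at hw
      rw [hw, map_zero]
    exact (QuotientAddGroup.eq_zero_iff _).1 this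
  refine ⟨⟨i, p, inj, fun m => ⟨(ps G (((1 : G) : G ⧸ jX.range)) m, 0), ?_⟩, pi, ex, ie, pe⟩,
    fun m => ?_, fun m => ?_, fun m => ?_⟩
  · refine (pp _ _).trans ?_
    rw [map_zero, sub_zero]
    exact (plift_ps _ _ _).trans (by simp)
  · have : i.comp (ps G (((1 : G) : G ⧸ L'.range))) =
      (ps G (((1 : G) : G ⧸ jX.range))).prod (ps G (((1 : G) : G ⧸ jY.range))) :=
      AddMonoidHom.ext_int (ipt 1)
    exact DFunLike.congr_fun this m
  · refine (pp _ _).trans ?_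
    rw [map_zero, sub_zero]
    exact (plift_ps _ _ _).trans (by simp)
  · refine (pp _ _).trans ?_
    rw [map_zero, zero_sub]
    exact congrArg Neg.neg ((plift_ps _ _ _).trans (by simp))
/-- The connecting data of Mayer and Vietoris. -/
theorem Amal.mv (h : Amal i1 i2 jX jY) (n : ℕ) :
    (∃ δ : HH (n + 1) G →+ HH n L,
      (∀ a, δ a = 0 → ∃ x y, a = hm (n + 1) jX x + hm (n + 1) jY y) ∧
      (∀ x, δ (hm (n + 1) jX x) = 0) ∧ (∀ y, δ (hm (n + 1) jY y) = 0) ∧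
      (∀ a, hm n i1 (δ a) = 0) ∧ (∀ a, hm n i2 (δ a) = 0) ∧
      (∀ l, hm n i1 l = 0 → hm n i2 l = 0 → ∃ a, δ a = l)) ∧
    (∀ x y, hm n jX x = hm n jY y → ∃ l, hm n i1 l = x ∧ hm n i2 l = y) := by
  obtain ⟨S, hi, hpX, hpY⟩ := h.ses
  have bL := ps_bij (K := L) (j := jX.comp i1) (h.injX.comp h.inj1) (coset_stab _) (coset_trans _)
  have bX := ps_bij (K := X) (j := jX) h.injX (coset_stab _) (coset_trans _)
  have bY := ps_bij (K := Y) (j := jY) h.injY (coset_stab _) (coset_trans _)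
  let eL := ps_eqv (j := jX.comp i1) (coset_stab (jX.comp i1))
  let eX := ps_eqv (j := jX) (coset_stab jX)
  let eY := ps_eqv (j := jY) (coset_stab jY)
  let PX := Pm G (G ⧸ jX.range)
  let PY := Pm G (G ⧸ jY.range)
  have sX : ∀ k l, Hm k (fst_eqv PX PY) (Hm k S.ie (Hm k eL l)) = Hm k eX (hm k i1 l) := by
    intro k l
    rw [Hm_comp]
    exact Hm_sq ((fst_eqv PX PY).comp S.ie) eL eX (triv_eqv i1 (AddMonoidHom.id ℤ)) (fun _ => rfl)
      (fun m => congrArg Prod.fst (hi m)) l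
  have sY : ∀ k l, Hm k (snd_eqv PX PY) (Hm k S.ie (Hm k eL l)) = Hm k eY (hm k i2 l) := by
    intro k l
    rw [Hm_comp]
    exact Hm_sq ((snd_eqv PX PY).comp S.ie) eL eY (triv_eqv i2 (AddMonoidHom.id ℤ))
      (fun g => h.comm g) (fun m => congrArg Prod.snd (hi m)) l
  have pX : ∀ k x, Hm k S.pe (Hm k (inl_eqv PX PY) (Hm k eX x)) = hm k jX x := by
    intro k x
    rw [Hm_comp]
    exact Hm_tri (S.pe.comp (inl_eqv PX PY)) eX (triv_eqv jX (AddMonoidHom.id ℤ)) (fun _ => rfl)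
      (fun m => hpX m) x
  have pY : ∀ k x, Hm k S.pe (Hm k (inr_eqv PX PY) (Hm k eY x)) = - hm k jY x := by
    intro k x
    rw [← add_eq_zero_iff_eq_neg]
    have e1 : Eqv jY (triv Y ℤ) (triv G ℤ) (S.p.comp ((AddMonoidHom.inr PX.V PY.V).comp (ps G _))) :=
      (S.pe.comp ((inr_eqv PX PY).comp eY) :)
    have e0 : Eqv jY (triv Y ℤ) (triv G ℤ) (0 : ℤ →+ ℤ) := fun _ _ => rfl
    have := Hm_addφ (n := k) e1 (triv_eqv jY (AddMonoidHom.id ℤ)) e0 (fun m => by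
      change (0 : ℤ) = S.p (0, ps G _ m) + m
      rw [hpY]; simp) x
    rw [Hm_zeroφ e0 (fun _ => rfl)] at this
    rw [this]
    congr 1
    rw [Hm_comp, Hm_comp]
  let εL := AddEquiv.ofBijective (Hm n eL) (bL n)
  have hε : ∀ b, Hm n eL (εL.symm b) = b := fun b => εL.apply_symm_apply b
  have hε' : ∀ b, εL.symm (Hm n eL b) = b := fun b => εL.symm_apply_apply b
  refine ⟨⟨εL.symm.toAddMonoidHom.comp (S.δ n), ?_, ?_, ?_, ?_, ?_, ?_⟩, ?_⟩
  · intro a ha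
    have h1 : S.δ n a = 0 := by
      have := congrArg (Hm n eL) ha
      rw [map_zero] at this
      exact (hε _).symm.trans this
    obtain ⟨c, rfl⟩ := S.ker_δ n a h1
    obtain ⟨x, hx⟩ := (bX (n + 1)).2 (Hm (n + 1) (fst_eqv PX PY) c)
    obtain ⟨y, hy⟩ := (bY (n + 1)).2 (Hm (n + 1) (snd_eqv PX PY) c)
    refine ⟨x, -y, ?_⟩
    rw [prod_decomp PX PY (n + 1) c, ← hx, ← hy, map_add, pX, pY, map_neg]
  · intro x
    rw [← pX]
    change εL.symm (S.δ n _) = 0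
    rw [S.δ_p, map_zero]
  · intro x
    rw [← neg_neg (hm (n + 1) jY x), ← pY]
    change εL.symm (S.δ n _) = 0
    rw [map_neg, S.δ_p, neg_zero, map_zero]
  · intro a
    apply (bX n).1
    rw [map_zero, ← sX]
    change Hm n _ (Hm n _ (Hm n eL (εL.symm (S.δ n a)))) = 0
    rw [hε, S.i_δ, map_zero]
  · intro a
    apply (bY n).1
    rw [map_zero, ← sY]
    change Hm n _ (Hm n _ (Hm n eL (εL.symm (S.δ n a)))) = 0
    rw [hε, S.i_δ, map_zero]
  · intro l h1 h2
    obtain ⟨a, ha⟩ := S.ker_i n (Hm n eL l) (by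
      rw [prod_decomp PX PY n (Hm n S.ie (Hm n eL l)), sX, sY, h1, h2]
      simp)
    refine ⟨a, ?_⟩
    change εL.symm (S.δ n a) = l
    rw [ha, hε']
  · intro x y hxy
    obtain ⟨b, hb⟩ := S.ker_p n (Hm n (inl_eqv PX PY) (Hm n eX x) + Hm n (inr_eqv PX PY) (Hm n eY y)) (by
      rw [map_add, pX, pY, hxy, add_neg_cancel])
    obtain ⟨l, rfl⟩ := (bL n).2 b
    refine ⟨l, ?_, ?_⟩
    · apply (bX n).1
      rw [← sX, hb, map_add, fst_inl, fst_inr, add_zero]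
    · apply (bY n).1
      rw [← sY, hb, map_add, snd_inl, snd_inr, zero_add]
end mv
end GH

namespace GH

section step

/-- Acts by `ρ` on the layers in `p`. -/
noncomputable def lay {X : Type} (p : ℤ → Prop) [DecidablePred p] : Equiv.Perm X →* Equiv.Perm (ℤ × X) where
  toFun ρ :=
    { toFun := fun x => (x.1, if p x.1 then ρ x.2 else x.2)
      invFun := fun x => (x.1, if p x.1 then ρ⁻¹ x.2 else x.2)
      left_inv := fun x => by ext <;> by_cases h : p x.1 <;> simp [h]
      right_inv := fun x => by ext <;> by_cases h : p x.1 <;> simp [h] }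
  map_one' := by ext x <;> simp
  map_mul' ρ σ := by ext x <;> by_cases h : p x.1 <;> simp [h]

theorem lay_apply {X : Type} (p : ℤ → Prop) [DecidablePred p] (ρ : Equiv.Perm X) (x : ℤ × X) :
    lay p ρ x = (x.1, if p x.1 then ρ x.2 else x.2) := rfl

/-- The shift. -/
def shf (X : Type) : Equiv.Perm (ℤ × X) where
  toFun x := (x.1 - 1, x.2)
  invFun x := (x.1 + 1, x.2)
  left_inv x := by simp
  right_inv x := by simp

theorem lay_comm {X : Type} (ρ σ : Equiv.Perm X) :
    lay (fun k => k = 0) ρ * lay (fun k => 1 ≤ k) σ = lay (fun k => 1 ≤ k) σ * lay (fun k => k = 0) ρ := by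
  ext ⟨k, x⟩
  · rfl
  · simp only [Equiv.Perm.mul_apply, lay_apply]
    by_cases h : k = 0
    · have : ¬ (1 ≤ k) := by omega
      simp [h]
    · simp [h]

theorem lay_shift {X : Type} (ρ : Equiv.Perm X) :
    lay (fun k => k = 0) ρ * lay (fun k => 1 ≤ k) ρ = shf X * lay (fun k => 1 ≤ k) ρ * (shf X)⁻¹ := by
  rw [eq_mul_inv_iff_mul_eq]
  ext ⟨k, x⟩
  · rfl
  · simp only [Equiv.Perm.mul_apply, lay_apply, shf, Equiv.coe_fn_mk]
    by_cases h : 1 ≤ k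
    · by_cases h' : k = 1
      · subst h'; simp
      · have h1 : ¬ (k - 1 = 0) := by omega
        have h2 : 1 ≤ k - 1 := by omega
        simp [h, h1, h2]
    · have h1 : ¬ (k - 1 = 0) := by omega
      have h2 : ¬ (1 ≤ k - 1) := by omega
      simp [h, h1, h2]

theorem lay_commutator {X : Type} (ρ : Equiv.Perm X) :
    lay (fun k => k = 0) ρ = shf X * lay (fun k => 1 ≤ k) ρ * (shf X)⁻¹ * (lay (fun k => 1 ≤ k) ρ)⁻¹ := by
  rw [← lay_shift]
  simp

theorem displace {W Z : Type} (q : W ↪ Z) (σ : Equiv.Perm Z) (h : ∀ w, σ (q w) ∉ Set.range q)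
    (a b : Equiv.Perm W) : Equiv.Perm.viaEmbeddingHom q (a * b * a⁻¹ * b⁻¹) ∈ Subgroup.normalClosure {σ} := by
  rw [map_mul, map_mul, map_mul, map_inv, map_inv]
  set A := Equiv.Perm.viaEmbeddingHom q a with hA
  set B := Equiv.Perm.viaEmbeddingHom q b with hB
  set c := σ * A⁻¹ * σ⁻¹ with hc
  have hσ : σ ∈ Subgroup.normalClosure {σ} := Subgroup.subset_normalClosure rfl
  have hN : (Subgroup.normalClosure {σ}).Normal := inferInstance
  have h1 : A * c ∈ Subgroup.normalClosure {σ} := by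
    have : A * c = (A * σ * A⁻¹) * σ⁻¹ := by rw [hc]; group
    rw [this]
    exact mul_mem (hN.conj_mem _ hσ _) (inv_mem hσ)
  have h2 : c * B = B * c := by
    refine Equiv.Perm.Disjoint.commute (fun z => ?_)
    by_cases hz : z ∈ Set.range q
    · left
      have : σ⁻¹ z ∉ Set.range q := by
        rintro ⟨w, hw⟩
        refine h w ?_
        rw [hw]
        simpa using hz
      have h3 : A⁻¹ (σ⁻¹ z) = σ⁻¹ z := by
        rw [hA, ← map_inv]
        exact Equiv.Perm.viaEmbedding_apply_of_notMem _ _ _ this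
      rw [hc, Equiv.Perm.mul_apply, Equiv.Perm.mul_apply, h3]
      simp
    · right
      exact Equiv.Perm.viaEmbedding_apply_of_notMem _ _ _ hz
  have h3 : A * B * A⁻¹ * B⁻¹ = (A * c) * (B * (A * c)⁻¹ * B⁻¹) := by
    calc A * B * A⁻¹ * B⁻¹ = A * (B * c) * c⁻¹ * A⁻¹ * B⁻¹ := by group
      _ = A * (c * B) * c⁻¹ * A⁻¹ * B⁻¹ := by rw [h2]
      _ = _ := by group
  rw [h3]
  exact mul_mem h1 (hN.conj_mem _ (inv_mem h1) _)

/-- Two injections with equivalent complements differ by a permutation. -/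
theorem exists_perm {Y Z : Type} (f g : Y → Z) (hf : Function.Injective f) (hg : Function.Injective g)
    (e : ((Set.range f)ᶜ : Set Z) ≃ ((Set.range g)ᶜ : Set Z)) : ∃ θ : Equiv.Perm Z, ∀ y, θ (f y) = g y := by
  classical
  refine ⟨(Equiv.Set.sumCompl (Set.range f)).symm.trans ((Equiv.sumCongr
    ((Equiv.ofInjective f hf).symm.trans (Equiv.ofInjective g hg)) e).trans
      (Equiv.Set.sumCompl (Set.range g))), fun y => ?_⟩
  have : (Equiv.Set.sumCompl (Set.range f)).symm (f y) = Sum.inl ⟨f y, y, rfl⟩ :=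
    Equiv.Set.sumCompl_symm_apply_of_mem (Set.mem_range_self y)
  have h2 : (Equiv.ofInjective f hf).symm ⟨f y, y, rfl⟩ = y := Equiv.ofInjective_symm_apply hf y
  simp [this, h2]

/-- Left multiplication. -/
def lmu (H W : Type) [Group H] : H →* Equiv.Perm (H × W) where
  toFun h := (Equiv.mulLeft h).prodCongr (Equiv.refl W)
  map_one' := by ext x <;> simp
  map_mul' a b := by ext x <;> simp [mul_assoc]

theorem lmu_apply {H W : Type} [Group H] (h a : H) (w : W) : lmu H W h (a, w) = (h * a, w) := rfl

/-- One step of the construction of acyclic simple overgroups. -/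
theorem exists_step (H : Type) [Group H] : ∃ (T : Type) (_ : Group T) (i ψ : H →* T) (t : T),
    Function.Injective i ∧ (∀ a b, i a * ψ b = ψ b * i a) ∧ (∀ q, i q * ψ q = t * ψ q * t⁻¹) ∧
    ∀ h', h' ≠ 1 → ∀ h, i h ∈ Subgroup.normalClosure {i h'} := by
  let V := H × ℕ
  let W := ℤ × V
  let Y := H × W
  let Z := ℤ × Y
  refine ⟨Equiv.Perm Z, inferInstance, (lay (fun k => k = 0)).comp (lmu H W),
    (lay (fun k => 1 ≤ k)).comp (lmu H W), shf Y, ?_, fun a b => lay_comm _ _, fun q => lay_shift _, ?_⟩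
  · intro a b hab
    have := DFunLike.congr_fun hab ((0, (1, (0, (1, 0)))) : Z)
    have h2 := congrArg (fun z : Z => z.2.1) this
    change a * 1 = b * 1 at h2
    simpa using h2
  have hVV : Nonempty (V × V ≃ V) := by
    rw [← Cardinal.eq, Cardinal.mk_prod, Cardinal.lift_id]
    exact Cardinal.mul_eq_self (Cardinal.aleph0_le_mk V)
  obtain ⟨vv⟩ := hVV
  have emb : ∀ X : Type, (X ↪ V) → Nonempty (X × V ↪ V) := fun X e =>
    ⟨(e.prodMap (Function.Embedding.refl V)).trans vv.toEmbedding⟩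
  have eℤ : ℤ ↪ V := ⟨fun k => (1, Encodable.encode k), fun a b h =>
    Encodable.encode_injective (congrArg Prod.snd h)⟩
  have eH : H ↪ V := ⟨fun k => (k, 0), fun a b h => congrArg Prod.fst h⟩
  obtain ⟨eW⟩ : Nonempty (W ↪ V) := emb ℤ eℤ
  obtain ⟨eY'⟩ := emb H eH
  let eY : Y ↪ V := ((Function.Embedding.refl H).prodMap eW).trans eY'
  let eZ : Z ↪ V := ((Function.Embedding.refl ℤ).prodMap eY).trans eW
  let jY : V ↪ Y := ⟨fun v => (1, (0, v)), fun a b h => congrArg (fun z : Y => z.2.2) h⟩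
  obtain ⟨β⟩ : Nonempty (Y ≃ V) := Function.Embedding.antisymm eY jY
  let q : W ↪ Z := ⟨fun w => (0, (1, w)), fun a b h => congrArg (fun z : Z => z.2.2) h⟩
  let f : Y → Z := fun y => (0, y)
  let g : Y → Z := fun y => q (0, β y)
  have hf : Function.Injective f := fun a b h => congrArg (fun z : Z => z.2) h
  have hg : Function.Injective g := fun a b h => β.injective (congrArg (fun z : Z => z.2.2.2) h)
  have cf : Nonempty (((Set.range f)ᶜ : Set Z) ≃ V) := by
    refine Function.Embedding.antisymm ((Function.Embedding.subtype _).trans eZ)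
      ⟨fun v => ⟨(1, (1, (0, v))), ?_⟩, fun a b h => congrArg (fun z : Z => z.2.2.2) (congrArg Subtype.val h)⟩
    rintro ⟨y, hy⟩
    exact zero_ne_one (α := ℤ) (congrArg Prod.fst hy)
  have cg : Nonempty (((Set.range g)ᶜ : Set Z) ≃ V) := by
    refine Function.Embedding.antisymm ((Function.Embedding.subtype _).trans eZ)
      ⟨fun v => ⟨(1, (1, (0, v))), ?_⟩, fun a b h => congrArg (fun z : Z => z.2.2.2) (congrArg Subtype.val h)⟩
    rintro ⟨y, hy⟩
    exact zero_ne_one (α := ℤ) (congrArg Prod.fst hy)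
  obtain ⟨cf⟩ := cf
  obtain ⟨cg⟩ := cg
  obtain ⟨θ, hθ⟩ := exists_perm f g hf hg (cf.trans cg.symm)
  intro h' hh' h
  set N := Subgroup.normalClosure {((lay (fun k => k = 0)).comp (lmu H W)) h'} with hNdef
  have hN : N.Normal := Subgroup.normalClosure_normal
  have hq : ∀ w, ((lay (fun k => k = 0)).comp (lmu H W)) h' (q w) ∉ Set.range q := by
    rintro w ⟨w', hw⟩
    have : ((lay (fun k => k = 0)).comp (lmu H W)) h' (q w) = ((0, (h', w)) : Z) := by
      change lay (fun k => k = 0) (lmu H W h') ((0, (1, w)) : Z) = _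
      rw [lay_apply, if_pos rfl, lmu_apply, mul_one]
    rw [this] at hw
    exact hh' (congrArg (fun z : Z => z.2.1) hw).symm
  let ρ : Equiv.Perm V := (β.symm.trans (lmu H W h)).trans β
  have key : Equiv.Perm.viaEmbeddingHom q (lay (fun k => k = 0) ρ) ∈ N := by
    rw [lay_commutator]
    exact displace q _ hq _ _
  have conj : ((lay (fun k => k = 0)).comp (lmu H W)) h =
      θ⁻¹ * Equiv.Perm.viaEmbeddingHom q (lay (fun k => k = 0) ρ) * (θ⁻¹)⁻¹ := by
    rw [inv_inv, mul_assoc, eq_inv_mul_iff_mul_eq]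
    refine Equiv.ext fun z => ?_
    obtain ⟨k, y⟩ := z
    rw [Equiv.Perm.mul_apply, Equiv.Perm.mul_apply]
    change θ (lay (fun k => k = 0) (lmu H W h) (k, y)) = (lay (fun k => k = 0) ρ).viaEmbedding q (θ (k, y))
    rw [lay_apply]
    by_cases hk : k = 0
    · subst hk
      rw [if_pos rfl]
      have e1 : θ (0, y) = q (0, β y) := hθ y
      have e2 : θ (0, lmu H W h y) = q (0, β (lmu H W h y)) := hθ _
      rw [e1, Equiv.Perm.viaEmbedding_apply, lay_apply, if_pos rfl]
      refine e2.trans ?_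
      simp [ρ]
    · rw [if_neg hk]
      by_cases hr : θ (k, y) ∈ Set.range q
      · obtain ⟨⟨k', v⟩, hw⟩ := hr
        have : k' ≠ 0 := by
          rintro rfl
          have e1 : θ (0, β.symm v) = q (0, β (β.symm v)) := hθ _
          rw [Equiv.apply_symm_apply, hw] at e1
          exact hk (congrArg Prod.fst (θ.injective e1)).symm
        change θ (k, y) = _
        rw [← hw, Equiv.Perm.viaEmbedding_apply, lay_apply, if_neg this]
      · exact (Equiv.Perm.viaEmbedding_apply_of_notMem _ _ _ hr).symm
  rw [conj]
  exact hN.conj_mem _ key _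

end step
end GH

namespace GH

section colim
variable {Gs : ℕ → Type} [∀ n, Group (Gs n)] (j : ∀ n, Gs n →* Gs (n + 1))

/-- Transition maps of a sequence. -/
def trn (m n : ℕ) (h : m ≤ n) : Gs m →* Gs n :=
  Nat.leRecOn (C := fun k => Gs m →* Gs k) h (fun {k} f => (j k).comp f) (MonoidHom.id _)

theorem trn_self (m : ℕ) : trn j m m le_rfl = MonoidHom.id _ :=
  Nat.leRecOn_self _

theorem trn_succ (m n : ℕ) (h : m ≤ n) : trn j m (n + 1) (h.trans (Nat.le_succ n)) = (j n).comp (trn j m n h) :=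
  Nat.leRecOn_succ (C := fun k => Gs m →* Gs k) h (MonoidHom.id _)

theorem trn_trn (m n k : ℕ) (h : m ≤ n) (h' : n ≤ k) (x : Gs m) :
    trn j n k h' (trn j m n h x) = trn j m k (h.trans h') x := by
  induction k, h' using Nat.le_induction with
  | base => rw [trn_self]; rfl
  | succ k hk ih =>
    rw [trn_succ j n k hk, trn_succ j m k (h.trans hk)]
    exact congrArg (j k) ih

theorem trn_inj (hj : ∀ n, Function.Injective (j n)) (m n : ℕ) (h : m ≤ n) :
    Function.Injective (trn j m n h) := by
  induction n, h using Nat.le_induction with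
  | base => rw [trn_self]; exact Function.injective_id
  | succ k hk ih =>
    rw [trn_succ j m k hk]
    exact (hj k).comp ih

instance trn_sys : DirectedSystem Gs (fun m n h => (trn j m n h : Gs m → Gs n)) where
  map_self m x := by rw [trn_self]; rfl
  map_map := fun k _ _ hij hjk x => trn_trn j _ _ _ hij hjk x

theorem exists_colim (hj : ∀ n, Function.Injective (j n)) :
    ∃ (L : Type) (_ : Group L) (f : ∀ n, Gs n →* L), (∀ n, Function.Injective (f n)) ∧
      (∀ n x, f (n + 1) (j n x) = f n x) ∧ (∀ m n, m ≤ n → ∀ x, ∃ y, f n y = f m x) ∧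
      ∀ x, ∃ n y, f n y = x := by
  let f : ∀ n, Gs n →* DirectLimit Gs (trn j) := fun n =>
    { toFun := fun x => ⟦⟨n, x⟩⟧
      map_one' := (DirectLimit.one_def n).symm
      map_mul' := fun x y => (DirectLimit.mul_def n x y).symm }
  have ht : ∀ m n (h : m ≤ n) x, f n (trn j m n h x) = f m x := fun m n h x =>
    DirectLimit.mk_apply (f := trn j) m n x h
  refine ⟨DirectLimit Gs (trn j), inferInstance, f, fun n => ?_, fun n x => ?_, fun m n h x => ⟨_, ht m n h x⟩,
    fun x => ?_⟩
  · exact DirectLimit.mk_injective (trn j) (trn_inj j hj) n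
  · rw [← ht n (n + 1) (Nat.le_succ n) x, trn_succ j n n le_rfl, trn_self]
    rfl
  · obtain ⟨i, y, rfl⟩ := DirectLimit.exists_eq_mk (trn j) x
    exact ⟨i, y, rfl⟩

end colim

/-- Bundled groups. -/
structure Gp where
  /-- carrier -/
  X : Type
  /-- group structure -/
  g : Group X

instance (G : Gp) : Group G.X := G.g

/-- `m`-acyclic simple overgroup. -/
theorem exists_acyclic_aux (m : ℕ) : ∀ (H : Type) [Group H], ∃ (K : Type) (_ : Group K) (ι : H →* K),
    Function.Injective ι ∧ Acyc m K ∧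
      (1 ≤ m → ∀ x : K, x ≠ 1 → Subgroup.normalClosure {x} = ⊤) := by
  induction m with
  | zero =>
    intro H _
    exact ⟨H, inferInstance, MonoidHom.id H, Function.injective_id, fun i h1 h2 => absurd h2 (by omega),
      fun h => absurd h (by omega)⟩
  | succ m ih =>
    have step : ∀ (H : Gp), ∃ (K : Gp) (ι : H.X →* K.X), Function.Injective ι ∧ Acyc m K.X ∧
        (Acyc m H.X → ∀ x : HH (m + 1) H.X, hm (m + 1) ι x = 0) ∧
        ∀ h', h' ≠ 1 → ∀ h, ι h ∈ Subgroup.normalClosure {ι h'} := by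
      intro H
      obtain ⟨T, gT, i, ψ, t, hi, hc, ht, hn⟩ := exists_step H.X
      obtain ⟨K, gK, ι, hι, hK, -⟩ := ih T
      refine ⟨⟨K, gK⟩, ι.comp i, hι.comp hi, hK, fun hH x => ?_, fun h' hh h => ?_⟩
      · have := hm_comp (m + 1) ι i x
        rw [mather hH i ψ hc t ht x, map_zero] at this
        exact this.symm
      · have h1 := Subgroup.mem_map_of_mem ι (hn h' hh h)
        have h2 : (Subgroup.normalClosure {i h'}).map ι ≤ Subgroup.normalClosure {ι (i h')} := by
          rw [Subgroup.map_le_iff_le_comap]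
          refine Subgroup.normalClosure_le_normal ?_
          rintro _ rfl
          exact Subgroup.subset_normalClosure rfl
        exact h2 h1
    choose nx em inj acy kil nrm using step
    intro H gH
    let Gs : ℕ → Gp := fun n => Nat.rec (motive := fun _ => Gp) ⟨H, gH⟩ (fun _ G => nx G) n
    let j : ∀ n, (Gs n).X →* (Gs (n + 1)).X := fun n => em (Gs n)
    have hj : ∀ n, Function.Injective (j n) := fun n => inj (Gs n)
    obtain ⟨L, gL, f, hf, hfj, hmono, hcov⟩ := exists_colim (Gs := fun n => (Gs n).X) j hj
    refine ⟨L, gL, f 0, hf 0, ?_, ?_⟩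
    · intro k hk1 hk2 a
      have hd : ∀ k l, ∃ m, (∀ x, ∃ y, f m y = f k x) ∧ (∀ x, ∃ y, f m y = f l x) := fun k l =>
        ⟨max k l, hmono _ _ (le_max_left _ _), hmono _ _ (le_max_right _ _)⟩
      obtain ⟨n, b, rfl⟩ := Exh.homology hf hd hcov k a
      have e : ∀ n (b : HH k (Gs n).X), hm k (f n) b = hm k (f (n + 1)) (hm k (j n) b) := by
        intro n b
        rw [hm_comp]
        exact hm_congr k (fun x => (hfj n x).symm) b
      rw [e n b]
      have hA : Acyc m (Gs (n + 1)).X := acy (Gs n)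
      rcases Nat.lt_or_ge k (m + 1) with h | h
      · rw [hA k hk1 (by omega) (hm k (j n) b)]
        exact map_zero _
      · obtain rfl : k = m + 1 := by omega
        rw [e (n + 1)]
        have : hm (m + 1) (j (n + 1)) (hm (m + 1) (j n) b) = 0 := kil (Gs (n + 1)) hA _
        rw [this]
        exact map_zero _
    · intro _ x hx
      rw [eq_top_iff]
      rintro y -
      obtain ⟨n, x', hx'⟩ := hcov x
      obtain ⟨l, y', hy'⟩ := hcov y
      obtain ⟨x'', hx2⟩ := hmono n (max n l) (le_max_left _ _) x'
      obtain ⟨y'', hy2⟩ := hmono l (max n l) (le_max_right _ _) y'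
      have e1 : f (max n l) x'' = x := hx2.trans hx'
      have e2 : f (max n l) y'' = y := hy2.trans hy'
      have hne : x'' ≠ 1 := by
        rintro rfl
        exact hx (by rw [← e1, map_one])
      have h1 := nrm (Gs (max n l)) x'' hne y''
      have h2 : (Subgroup.normalClosure {j (max n l) x''}).map (f (max n l + 1)) ≤ Subgroup.normalClosure {x} := by
        rw [Subgroup.map_le_iff_le_comap]
        refine Subgroup.normalClosure_le_normal ?_
        rintro _ rfl
        change f (max n l + 1) (j (max n l) x'') ∈ (Subgroup.normalClosure {x} : Subgroup L)
        rw [hfj, e1]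
        exact Subgroup.subset_normalClosure rfl
      have h3 := h2 (Subgroup.mem_map_of_mem (f (max n l + 1)) h1)
      have h4 : f (max n l + 1) (em (Gs (max n l)) y'') = y := (hfj _ _).trans e2
      rwa [h4] at h3

/-- `3`-acyclic simple overgroups. -/
theorem exists_acyclic (H : Type) [Group H] : ∃ (K : Type) (_ : Group K) (ι : H →* K),
    Function.Injective ι ∧ Acyc 3 K ∧ (∀ x : K, x ≠ 1 → Subgroup.normalClosure {x} = ⊤) ∧
      (∀ n, 2 ≤ n → ∃ x : K, orderOf x = n) ∧ ∃ x, ∀ h, ι h ≠ x := by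
  obtain ⟨K, gK, ι, hι, hK, hs⟩ := exists_acyclic_aux 3 (H × (∀ n : ℕ, Multiplicative (ZMod n)))
  let s : ∀ n : ℕ, Multiplicative (ZMod n) →* H × (∀ n : ℕ, Multiplicative (ZMod n)) := fun n =>
    (MonoidHom.inr _ _).comp (MonoidHom.mulSingle (fun n : ℕ => Multiplicative (ZMod n)) n)
  have hsi : ∀ n, Function.Injective (s n) := fun n a b h =>
    Pi.mulSingle_injective (M := fun n : ℕ => Multiplicative (ZMod n)) n (congrArg Prod.snd h)
  refine ⟨K, gK, ι.comp (MonoidHom.inl _ _), hι.comp (fun a b h => congrArg Prod.fst h), hK, hs (by norm_num),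
    fun n hn => ⟨ι (s n (Multiplicative.ofAdd 1)), ?_⟩, ι (s 2 (Multiplicative.ofAdd 1)), fun h e => ?_⟩
  · rw [orderOf_injective ι hι, orderOf_injective _ (hsi n), orderOf_ofAdd_eq_addOrderOf, ZMod.addOrderOf_one]
  · have h1 := congrArg Prod.snd (hι e)
    have h2 : (1 : ∀ n : ℕ, Multiplicative (ZMod n)) = Pi.mulSingle (M := fun n : ℕ => Multiplicative (ZMod n)) 2 (Multiplicative.ofAdd 1) := h1
    have h3 := congrFun h2 2
    rw [Pi.mulSingle_eq_same] at h3
    have h4 : (0 : ZMod 2) = 1 := congrArg Multiplicative.toAdd h3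
    exact absurd h4 (by decide)

end GH

namespace GH

section h1
variable {G G' : Type} [Group G] [Group G']

/-- Basic 1-chains. -/
noncomputable def el1 (g : G) (k : ℤ) : C 1 (triv G ℤ) := sg (triv G ℤ) g k

/-- Basic 2-chains. -/
noncomputable def el2 (x y : G) (k : ℤ) : C 2 (triv G ℤ) := sg (F (triv G ℤ)) x (sg (triv G ℤ) y k)

theorem d0_triv (c : C 1 (triv G ℤ)) : d 0 (triv G ℤ) c = 0 := by
  have := d_zero_up (M := triv G ℤ) c
  refine this.trans ?_
  have h : av (triv G ℤ) = sm (triv G ℤ) := F_ext fun x m => by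
    rw [av_sg, sm_sg]; rfl
  rw [h]
  exact sub_self _

theorem z1_mem (c : C 1 (triv G ℤ)) : c ∈ Z 1 (triv G ℤ) := d0_triv c

theorem ab_cases (a : Additive (Abelianization G)) : ∃ g : G, a = Additive.ofMul (Abelianization.of g) := by
  obtain ⟨g, hg⟩ := QuotientGroup.mk_surjective (Additive.toMul a)
  exact ⟨g, (congrArg Additive.ofMul hg).symm⟩

theorem d1_el2 (x y : G) (k : ℤ) : d 1 (triv G ℤ) (el2 x y k) = el1 x k - (el1 (y * x) k - el1 y k) := by
  have h1 := d_up (n := 0) (M := triv G ℤ) (el2 x y k : C 1 (F (triv G ℤ)))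
  refine h1.trans ?_
  have h2 := d_zero_up (M := F (triv G ℤ)) (el2 x y k : C 0 (F (F (triv G ℤ))))
  have h3 : av (F (triv G ℤ)) (sg (F (triv G ℤ)) x (sg (triv G ℤ) y k)) = el1 (y * x) k := by
    rw [av_sg, F_act_sg, inv_inv]; rfl
  have h4 : sm (F (triv G ℤ)) (sg (F (triv G ℤ)) x (sg (triv G ℤ) y k)) = el1 y k := by
    rw [sm_sg]; rfl
  have h5 : fm (id : G → G) (av (triv G ℤ)) (sg (F (triv G ℤ)) x (sg (triv G ℤ) y k)) = el1 x k := by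
    rw [fm_sg, av_sg]; rfl
  have h6 : d 0 (F (triv G ℤ)) (el2 x y k) = el1 (y * x) k - el1 y k :=
    h2.trans (by rw [← h3, ← h4]; rfl)
  exact congrArg₂ (fun a b => a - b) h5 h6

/-- The map to the abelianization on chains. -/
noncomputable def tab (G : Type) [Group G] : C 1 (triv G ℤ) →+ Additive (Abelianization G) :=
  flift (triv G ℤ) fun g => zmultiplesHom _ (Additive.ofMul (Abelianization.of g))

theorem tab_el1 (g : G) (k : ℤ) : tab G (el1 g k) = k • Additive.ofMul (Abelianization.of g) :=
  flift_sg _ _ _ _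

theorem tab_d (c : C 2 (triv G ℤ)) : tab G (d 1 (triv G ℤ) c) = 0 := by
  have : (tab G).comp (d 1 (triv G ℤ)) = 0 := by
    refine F_ext (M := F (triv G ℤ)) (φ := (tab G).comp (d 1 (triv G ℤ))) (ψ := 0) fun x m => ?_
    have h2 : ((tab G).comp (d 1 (triv G ℤ))).comp (sg (F (triv G ℤ)) x) = 0 := by
      refine F_ext (M := triv G ℤ) fun y k => ?_
      change tab G (d 1 (triv G ℤ) (el2 x y k)) = 0
      rw [d1_el2, map_sub, map_sub, tab_el1, tab_el1, tab_el1, map_mul, ofMul_mul, smul_add]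
      abel
    exact DFunLike.congr_fun h2 m
  exact DFunLike.congr_fun this c

/-- `H_1` to the abelianization. -/
noncomputable def hab (G : Type) [Group G] : HH 1 G →+ Additive (Abelianization G) :=
  QuotientAddGroup.lift _ ((tab G).comp (Z 1 (triv G ℤ)).subtype) (by
    rintro ⟨c, hc⟩ ⟨y, hy⟩
    have : d 1 (triv G ℤ) y = c := hy
    change tab G c = 0
    rw [← this, tab_d])

theorem hab_mk (c : C 1 (triv G ℤ)) (hc) : hab G (hcl c hc) = tab G c := rfl

/-- The class of a group element. -/
noncomputable def gc (g : G) : HH 1 G := hcl (el1 g 1) (z1_mem _)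

theorem hab_gc (g : G) : hab G (gc g) = Additive.ofMul (Abelianization.of g) := by
  rw [gc, hab_mk, tab_el1, one_smul]

theorem gc_mul (a b : G) : gc (a * b) = gc a + gc b := by
  rw [gc, gc, gc, mk_add]
  refine mk_eq_mk _ _ _ _ (- el2 b a 1) ?_
  rw [map_neg, d1_el2]
  abel

/-- The class map as a homomorphism on the abelianization. -/
noncomputable def gch (G : Type) [Group G] : Additive (Abelianization G) →+ HH 1 G :=
  MonoidHom.toAdditiveLeft (Abelianization.lift (MonoidHom.mk' (fun g => Multiplicative.ofAdd (gc g))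
    (fun a b => congrArg Multiplicative.ofAdd (gc_mul a b))))

theorem gch_of (g : G) : gch G (Additive.ofMul (Abelianization.of g)) = gc g := rfl

theorem gch_hab (a : HH 1 G) : gch G (hab G a) = a := by
  obtain ⟨c, hc, rfl⟩ := mk_rep a
  have key : ((gch G).comp (tab G)) =
      ((QuotientAddGroup.mk' _ : Z 1 (triv G ℤ) →+ _).comp
        ((AddMonoidHom.id (C 1 (triv G ℤ))).codRestrict (Z 1 (triv G ℤ)) z1_mem) :
        C 1 (triv G ℤ) →+ HH 1 G) := by
    refine F_ext (M := triv G ℤ) fun x k => ?_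
    have : ∀ φ ψ : C 1 (triv G ℤ) →+ HH 1 G, φ (el1 x 1) = ψ (el1 x 1) → φ (el1 x k) = ψ (el1 x k) := by
      intro φ ψ h
      have : φ.comp (sg (triv G ℤ) x) = ψ.comp (sg (triv G ℤ) x) := AddMonoidHom.ext_int h
      exact DFunLike.congr_fun this k
    refine this _ _ ?_
    change gch G (tab G (el1 x 1)) = gc x
    rw [tab_el1, one_smul, gch_of]
  exact DFunLike.congr_fun key c

theorem hab_inj : Function.Injective (hab G) := fun a b h => by
  rw [← gch_hab a, h, gch_hab]

theorem hab_gch (a : Additive (Abelianization G)) : hab G (gch G a) = a := by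
  obtain ⟨g, this⟩ := ab_cases a
  rw [this, gch_of, hab_gc]

theorem hm_gc (f : G →* G') (g : G) : hm 1 f (gc g) = gc (f g) := by
  have h : Cm f 1 (AddMonoidHom.id ℤ) (M := triv G ℤ) (M' := triv G' ℤ) (el1 g 1) = el1 (f g) 1 :=
    fm_sg f (M := triv G ℤ) (M' := triv G' ℤ) (AddMonoidHom.id ℤ) g 1
  exact mk_congr h _

theorem hab_nat (f : G →* G') (a : HH 1 G) :
    hab G' (hm 1 f a) = MonoidHom.toAdditive (Abelianization.map f) (hab G a) := by
  obtain ⟨b, rfl⟩ : ∃ b, gch G b = a := ⟨_, gch_hab a⟩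
  obtain ⟨g, this⟩ := ab_cases b
  rw [this, gch_of, hm_gc, hab_gc, hab_gc]
  rfl

end h1
end GH

namespace GH

section fox

/-- The free `G`-set on `α`. -/
structure GA (G α : Type) where
  /-- group coordinate -/
  g : G
  /-- index -/
  x : α

instance (G α : Type) [Group G] : MulAction G (GA G α) where
  smul h z := ⟨h * z.g, z.x⟩
  one_smul z := by
    change GA.mk (1 * z.g) z.x = z
    rw [one_mul]
  mul_smul a b z := by
    change GA.mk (a * b * z.g) z.x = GA.mk (a * (b * z.g)) z.x
    rw [mul_assoc]

theorem GA_smul {G α : Type} [Group G] (h g : G) (x : α) : h • (GA.mk g x) = GA.mk (h * g) x := rfl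

theorem fr_GA (G α : Type) [Group G] : IsFr (Pm G (GA G α)) := by
  let P : (Pm G (GA G α)).V →+ (F (Pm G (GA G α))).V :=
    plift G fun z => sg (Pm G (GA G α)) z.g⁻¹ (pt G ⟨1, z.x⟩)
  refine ⟨P, ?_, ?_⟩
  · refine plift_eqv (M := F (Pm G (GA G α))) fun g z => ?_
    obtain ⟨h, x⟩ := z
    rw [GA_smul, F_act_sg, mul_inv_rev]
  · intro m
    refine Pm_ext (φ := (av (Pm G (GA G α))).comp P) (ψ := AddMonoidHom.id _) (fun z => ?_) m
    obtain ⟨h, x⟩ := z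
    change av _ (P (pt G ⟨h, x⟩)) = pt G ⟨h, x⟩
    rw [plift_pt, av_sg, inv_inv, Pm_act, GA_smul, mul_one]

theorem retract_vanish {G : Type} [Group G] {I M : Rp G} (hM : IsFr M) {r : I.V →+ M.V} {s : M.V →+ I.V}
    (hr : Eqv (MonoidHom.id G) I M r) (hs : Eqv (MonoidHom.id G) M I s) (h : ∀ z, s (r z) = z)
    (n : ℕ) (a : H (n + 1) I) : a = 0 := by
  have h1 : Hm (n + 1) hr a = 0 := hM.vanish n _
  have h2 : Hm (n + 1) hs (Hm (n + 1) hr a) = Hm (n + 1) (Eqv.id' I) a :=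
    Hm_tri hs hr (Eqv.id' I) (fun _ => rfl) h a
  rw [h1, map_zero, Hm_id' _ (fun _ => rfl) (fun _ => rfl)] at h2
  exact h2.symm

variable (α : Type)

/-- Fox derivatives. -/
theorem exists_fox : ∃ D : FreeGroup α → (Pm (FreeGroup α) (GA (FreeGroup α) α)).V,
    (∀ a b, D (a * b) = D a + (Pm (FreeGroup α) (GA (FreeGroup α) α)).act a (D b)) ∧
    ∀ x, D (FreeGroup.of x) = pt _ ⟨1, x⟩ := by
  let G := FreeGroup α
  let M := Pm G (GA G α)
  let e : α → M.V := fun x => pt G ⟨1, x⟩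
  let Γ : G →* Equiv.Perm (G × M.V) := FreeGroup.lift fun x =>
    { toFun := fun z => (FreeGroup.of x * z.1, M.act (FreeGroup.of x) z.2 + e x)
      invFun := fun z => ((FreeGroup.of x)⁻¹ * z.1, M.act (FreeGroup.of x)⁻¹ (z.2 - e x))
      left_inv := fun z => by simp [M.act_inv_act]
      right_inv := fun z => by simp [M.act_act_inv] }
  have hof : ∀ x g m, Γ (FreeGroup.of x) (g, m) = (FreeGroup.of x * g, M.act (FreeGroup.of x) m + e x) := by
    intro x g m
    simp only [Γ, FreeGroup.lift_apply_of]
    rfl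
  have mulc : ∀ a b : G, ∀ u v, (∀ g m, Γ a (g, m) = (a * g, M.act a m + u)) →
      (∀ g m, Γ b (g, m) = (b * g, M.act b m + v)) →
      (∀ g m, Γ (a * b) (g, m) = (a * b * g, M.act (a * b) m + (u + M.act a v))) := by
    intro a b u v ha hb g m
    rw [map_mul, Equiv.Perm.mul_apply, hb, ha, map_add, M.act_mul, mul_assoc]
    congr 1
    abel
  have Q : ∀ w : G, ∃ u, ∀ g m, Γ w (g, m) = (w * g, M.act w m + u) := by
    intro w
    induction w using FreeGroup.induction_on with
    | C1 => exact ⟨0, fun g m => by rw [map_one, one_mul, M.act_one, add_zero]; rfl⟩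
    | of x => exact ⟨e x, hof x⟩
    | inv_of x _ =>
      refine ⟨M.act (FreeGroup.of x)⁻¹ (- e x), fun g m => ?_⟩
      rw [map_inv, Equiv.Perm.inv_eq_iff_eq, hof, ← map_add, M.act_act_inv, mul_inv_cancel_left]
      simp
    | mul a b ha hb =>
      obtain ⟨u, hu⟩ := ha
      obtain ⟨v, hv⟩ := hb
      exact ⟨_, mulc a b u v hu hv⟩
  choose D hD using Q
  refine ⟨D, fun a b => ?_, fun x => ?_⟩
  · have h1 := (hD (a * b) 1 0).symm.trans (mulc a b _ _ (hD a) (hD b) 1 0)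
    exact add_left_cancel (congrArg Prod.snd h1)
  · have h1 := (hD (FreeGroup.of x) 1 0).symm.trans (hof x 1 0)
    exact add_left_cancel (congrArg Prod.snd h1)

theorem free_vanish (n : ℕ) (a : HH (n + 2) (FreeGroup α)) : a = 0 := by
  obtain ⟨D, hD, hDof⟩ := exists_fox α
  let G := FreeGroup α
  let M := Pm G (GA G α)
  let P := Pm G G
  let ε : P.V →+ (triv G ℤ).V := plift G (fun _ => (1 : ℤ))
  have hε : Eqv (MonoidHom.id G) P (triv G ℤ) ε := plift_eqv (M := triv G ℤ) (fun _ _ => rfl)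
  have hεs : Function.Surjective ε := fun k => ⟨ps G 1 k, by
    refine (plift_ps _ _ _).trans ?_
    simp⟩
  let S := kerSes hε hεs
  let r : P.V →+ M.V := plift G D
  let s : M.V →+ P.V := plift G fun z => pt G (z.g * FreeGroup.of z.x) - pt G z.g
  have hs : Eqv (MonoidHom.id G) M P s := plift_eqv (M := P) fun g z => by
    obtain ⟨h, x⟩ := z
    rw [GA_smul, map_sub, Pm_act, Pm_act, smul_eq_mul, smul_eq_mul, mul_assoc]
  have hεs0 : ∀ z, ε (s z) = 0 := fun z =>
    Pm_ext (φ := ε.comp s) (ψ := 0) (fun z => by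
      change ε (s (pt G z)) = 0
      rw [plift_pt, map_sub, plift_pt, plift_pt, sub_self]) z
  have hr : ∀ g z, r (P.act g z) = zmultiplesHom M.V (D g) (ε z) + M.act g (r z) := fun g z =>
    Pm_ext (φ := r.comp (P.act g)) (ψ := (zmultiplesHom M.V (D g)).comp ε + (M.act g).comp r) (fun x => by
      change r (P.act g (pt G x)) = zmultiplesHom M.V (D g) (ε (pt G x)) + M.act g (r (pt G x))
      rw [Pm_act, plift_pt, plift_pt, plift_pt, smul_eq_mul, hD]
      congr 1
      exact (one_zsmul _).symm) z
  have D1 : D 1 = 0 := by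
    have := hD 1 1
    rw [mul_one, Rp.act_one] at this
    simpa using this
  have hsD : ∀ w, s (D w) = pt G w - pt G 1 := by
    intro w
    induction w using FreeGroup.induction_on with
    | C1 => rw [D1, map_zero]; exact (sub_self _).symm
    | of x => rw [hDof, plift_pt, one_mul]
    | inv_of x ih =>
      have h1 := hD (FreeGroup.of x)⁻¹ (FreeGroup.of x)
      rw [inv_mul_cancel, D1] at h1
      have h2 : s (D (FreeGroup.of x)⁻¹) + P.act (FreeGroup.of x)⁻¹ (s (D (FreeGroup.of x))) = 0 := by
        refine (congrArg (fun t => s (D (FreeGroup.of x)⁻¹) + t) (hs (FreeGroup.of x)⁻¹ _).symm).trans ?_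
        rw [← map_add]
        exact (congrArg s h1.symm).trans (map_zero s)
      rw [ih, map_sub, Pm_act, Pm_act, smul_eq_mul, smul_eq_mul, mul_one, inv_mul_cancel] at h2
      rw [eq_neg_of_add_eq_zero_left h2]
      abel
    | mul a b ha hb =>
      have h2 : s (D (a * b)) = s (D a) + P.act a (s (D b)) := by
        refine (congrArg s (hD a b)).trans ?_
        rw [map_add]
        exact congrArg (fun t => s (D a) + t) (hs a _)
      rw [h2, ha, hb, map_sub, Pm_act, Pm_act, smul_eq_mul, smul_eq_mul, mul_one]
      abel
  have hsr : ∀ z, s (r z) = z - zmultiplesHom P.V (pt G 1) (ε z) := fun z =>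
    Pm_ext (φ := s.comp r) (ψ := AddMonoidHom.id _ - (zmultiplesHom P.V (pt G 1)).comp ε) (fun x => by
      change s (r (pt G x)) = pt G x - zmultiplesHom P.V (pt G 1) (ε (pt G x))
      rw [plift_pt, plift_pt, hsD]
      congr 1
      exact (one_zsmul _).symm) z
  let r' : (kerRp hε).V →+ M.V := r.comp ε.ker.subtype
  let s' : M.V →+ (kerRp hε).V := s.codRestrict ε.ker hεs0
  have hr' : Eqv (MonoidHom.id G) (kerRp hε) M r' := fun g z => by
    refine (hr g z.1).trans ?_
    have : ε z.1 = 0 := z.2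
    rw [this, map_zero]
    exact zero_add _
  have hs' : Eqv (MonoidHom.id G) M (kerRp hε) s' := fun g z => Subtype.ext (hs g z)
  have h0 : ∀ b : H (n + 1) (kerRp hε), b = 0 := fun b =>
    retract_vanish (fr_GA G α) hr' hs' (fun z => Subtype.ext (by
      refine (hsr z.1).trans ?_
      have : ε z.1 = 0 := z.2
      rw [this, map_zero]
      exact sub_zero _)) n b
  obtain ⟨c, hc⟩ := S.ker_δ (n + 1) a (h0 _)
  have : c = 0 := (fr_TwG (triv G ℤ)).vanish (n + 1) c
  rw [← hc, this]
  exact map_zero _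

end fox
end GH

namespace GH

/-- Subgroups of free abelian groups are free. -/
theorem exists_basis_sub (ι : Type) (N : Submodule ℤ (ι →₀ ℤ)) : ∃ β : Type, Nonempty (Module.Basis β ℤ N) := by
  classical
  letI : LinearOrder ι := linearOrderOfSTO (WellOrderingRel (α := ι))
  have wf : WellFounded (fun a b : ι => a < b) := WellOrderingRel.isWellOrder.wf
  let Ni : ι → Submodule ℤ (ι →₀ ℤ) := fun i => N ⊓ Finsupp.supported ℤ ℤ (Set.Iic i)
  let J : ι → Submodule ℤ ℤ := fun i => (Ni i).map (Finsupp.lapply i)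
  have hJ : ∀ i, ∃ x ∈ Ni i, ∀ y ∈ Ni i, x i ∣ y i := by
    intro i
    obtain ⟨g, hg⟩ := (IsPrincipalIdealRing.principal (J i : Ideal ℤ)).principal
    have hgm : g ∈ J i := by
      rw [hg]; exact Submodule.mem_span_singleton_self g
    obtain ⟨x, hx, hxg⟩ := hgm
    refine ⟨x, hx, fun y hy => ?_⟩
    have h1 : y i ∈ J i := ⟨y, hy, rfl⟩
    rw [hg] at h1
    have hx' : x i = g := hxg
    rw [hx']
    exact Ideal.mem_span_singleton.1 h1
  choose x hx hdv using hJ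
  let β := {i : ι // x i i ≠ 0}
  let b : β → N := fun i => ⟨x i.1, (hx i.1).1⟩
  have hlow : ∀ i j, i < j → x i j = 0 := by
    intro i j hij
    by_contra h
    have := (hx i).2 (Finsupp.mem_support_iff.2 h)
    exact absurd this (not_le.2 hij)
  have hli : LinearIndependent ℤ b := by
    rw [linearIndependent_iff]
    intro c hc
    by_contra hne
    obtain ⟨m, hm, hmax⟩ := Finset.exists_max_image c.support (fun i : β => i.1)
      (Finsupp.support_nonempty_iff.2 hne)
    have h1 : ((Finsupp.linearCombination ℤ b c : N) : ι →₀ ℤ) m.1 = 0 := by rw [hc]; rfl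
    rw [Finsupp.linearCombination_apply, Finsupp.sum, AddSubmonoidClass.coe_finset_sum, Finsupp.finsetSum_apply,
      Finset.sum_eq_single m] at h1
    · have h2 : c m * x m.1 m.1 = 0 := h1
      rcases mul_eq_zero.1 h2 with h | h
      · exact (Finsupp.mem_support_iff.1 hm) h
      · exact m.2 h
    · intro j hj hjm
      have : j.1 < m.1 := lt_of_le_of_ne (hmax j hj) (fun h => hjm (Subtype.ext h))
      change c j * x j.1 m.1 = 0
      rw [hlow _ _ this, mul_zero]
    · intro h; exact absurd hm h
  have hstep : ∀ i, ∀ y (hy : y ∈ Ni i), (⟨y, hy.1⟩ : N) ∈ Submodule.span ℤ (Set.range b) := by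
    intro i
    induction i using wf.induction with
    | _ i ih =>
      intro y hy
      have key : ∀ z (hz : z ∈ Ni i), z i = 0 → (⟨z, hz.1⟩ : N) ∈ Submodule.span ℤ (Set.range b) := by
        intro z hz hzi
        by_cases h0 : z = 0
        · have : (⟨z, hz.1⟩ : N) = 0 := Subtype.ext h0
          rw [this]; exact Submodule.zero_mem _
        · obtain ⟨m, hm, hmax⟩ := Finset.exists_max_image z.support id (Finsupp.support_nonempty_iff.2 h0)
          have hmi : m < i := lt_of_le_of_ne (hz.2 hm) (fun h => (Finsupp.mem_support_iff.1 hm) (h ▸ hzi))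
          exact ih m hmi z ⟨hz.1, fun j hj => hmax j hj⟩
      obtain ⟨k, hk⟩ := hdv i y hy
      by_cases hg : x i i = 0
      · exact key y hy (by rw [hk, hg, zero_mul])
      · have hz : y - k • x i ∈ Ni i := Submodule.sub_mem _ hy (Submodule.smul_mem _ _ (hx i))
        have h1 := key _ hz (by
          rw [Finsupp.sub_apply, Finsupp.smul_apply, hk, smul_eq_mul, mul_comm, sub_self])
        have h2 : b ⟨i, hg⟩ ∈ Submodule.span ℤ (Set.range b) := Submodule.subset_span ⟨_, rfl⟩
        have h3 := Submodule.add_mem _ h1 (Submodule.smul_mem _ k h2)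
        convert h3 using 1
        refine Subtype.ext ?_
        change y = y - k • x i + k • x i
        rw [sub_add_cancel]
  have hsp : ⊤ ≤ Submodule.span ℤ (Set.range b) := by
    rintro ⟨y, hy⟩ -
    by_cases h0 : y = 0
    · have : (⟨y, hy⟩ : N) = 0 := Subtype.ext h0
      rw [this]; exact Submodule.zero_mem _
    · obtain ⟨m, hm, hmax⟩ := Finset.exists_max_image y.support id (Finsupp.support_nonempty_iff.2 h0)
      exact hstep m y ⟨hy, fun j hj => hmax j hj⟩
  exact ⟨β, ⟨Module.Basis.mk hli hsp⟩⟩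

end GH

namespace GH

section pres

theorem gc_rep {G : Type} [Group G] (a : HH 1 G) : ∃ g, gc g = a := by
  obtain ⟨g, hg⟩ := ab_cases (hab G a)
  exact ⟨g, by rw [← gch_of, ← hg, gch_hab]⟩

theorem gc_one {G : Type} [Group G] : gc (1 : G) = 0 := by
  have := gc_mul (1 : G) 1
  rw [mul_one] at this
  simpa using this

theorem gc_inv {G : Type} [Group G] (g : G) : gc g⁻¹ = - gc g := by
  refine eq_neg_of_add_eq_zero_left ?_
  rw [← gc_mul, inv_mul_cancel, gc_one]

theorem H1_ext {α A : Type} [AddCommGroup A] {φ ψ : HH 1 (FreeGroup α) →+ A}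
    (h : ∀ x, φ (gc (FreeGroup.of x)) = ψ (gc (FreeGroup.of x))) (a) : φ a = ψ a := by
  obtain ⟨g, rfl⟩ := gc_rep a
  induction g using FreeGroup.induction_on with
  | C1 => rw [gc_one, map_zero, map_zero]
  | of x => exact h x
  | inv_of x ih => rw [gc_inv, map_neg, map_neg, h]
  | mul a b ha hb => rw [gc_mul, map_add, map_add, ha, hb]

/-- Maps out of `H_1` of a free group. -/
noncomputable def Lf {α A : Type} [AddCommGroup A] (u : α → A) : HH 1 (FreeGroup α) →+ A :=
  (MonoidHom.toAdditiveLeft (Abelianization.lift (FreeGroup.lift (fun x => Multiplicative.ofAdd (u x))))).comp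
    (hab (FreeGroup α))

theorem Lf_of {α A : Type} [AddCommGroup A] (u : α → A) (x : α) : Lf u (gc (FreeGroup.of x)) = u x := by
  change MonoidHom.toAdditiveLeft _ (hab _ (gc (FreeGroup.of x))) = _
  rw [hab_gc]
  simp

/-- `H_1` of a free group. -/
noncomputable def Lh (α : Type) : HH 1 (FreeGroup α) →+ (α →₀ ℤ) := Lf fun x => Finsupp.single x 1

theorem Lh_inv (α : Type) : ∃ ψ : (α →₀ ℤ) →+ HH 1 (FreeGroup α), (∀ a, ψ (Lh α a) = a) ∧ ∀ c, Lh α (ψ c) = c := by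
  let ψ : (α →₀ ℤ) →+ HH 1 (FreeGroup α) := Finsupp.liftAddHom fun x => zmultiplesHom _ (gc (FreeGroup.of x))
  refine ⟨ψ, fun a => ?_, fun c => ?_⟩
  · refine H1_ext (φ := ψ.comp (Lh α)) (ψ := AddMonoidHom.id _) (fun x => ?_) a
    change ψ (Lh α _) = gc (FreeGroup.of x)
    rw [Lh, Lf_of]
    simp [ψ]
  · have : (Lh α).comp ψ = AddMonoidHom.id _ := by
      ext x
      simp [ψ, Lh, Lf_of]
    exact DFunLike.congr_fun this c

theorem exists_pres (B : Type) [AddCommGroup B] : ∃ (β : Type) (f : FreeGroup β →* FreeGroup B)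
    (q : HH 1 (FreeGroup B) →+ B), Function.Surjective q ∧ Function.Injective (hm 1 f) ∧
    ∀ z, q z = 0 ↔ ∃ y, hm 1 f y = z := by
  let ℓ : (B →₀ ℤ) →ₗ[ℤ] B := Finsupp.linearCombination ℤ id
  obtain ⟨β, ⟨b⟩⟩ := exists_basis_sub B (LinearMap.ker ℓ)
  obtain ⟨ψB, hB1, hB2⟩ := Lh_inv B
  obtain ⟨ψβ, hβ1, hβ2⟩ := Lh_inv β
  have hw : ∀ i : β, ∃ w : FreeGroup B, gc w = ψB (b i : B →₀ ℤ) := fun i => gc_rep _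
  choose w hw using hw
  let f : FreeGroup β →* FreeGroup B := FreeGroup.lift w
  have hq : ∀ z, Lf id z = ℓ (Lh B z) := fun z =>
    H1_ext (φ := Lf id) (ψ := ℓ.toAddMonoidHom.comp (Lh B)) (fun x => by
      change _ = ℓ (Lh B _)
      rw [Lf_of, Lh, Lf_of]
      simp [ℓ]) z
  have hf : ∀ y, Lh B (hm 1 f y) = (b.repr.symm (Lh β y) : LinearMap.ker ℓ) := fun y =>
    H1_ext (φ := (Lh B).comp (hm 1 f)) (ψ := (LinearMap.ker ℓ).subtype.toAddMonoidHom.comp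
      (b.repr.symm.toLinearMap.toAddMonoidHom.comp (Lh β))) (fun x => by
      change Lh B (hm 1 f _) = (b.repr.symm (Lh β _) : LinearMap.ker ℓ)
      rw [hm_gc]
      have : f (FreeGroup.of x) = w x := FreeGroup.lift_apply_of
      rw [this, hw, hB2, Lh, Lf_of]
      simp) y
  have injB : Function.Injective (Lh B) := Function.LeftInverse.injective hB1
  refine ⟨β, f, Lf id, fun x => ⟨_, Lf_of id x⟩, ?_, fun z => ⟨fun h => ?_, ?_⟩⟩
  · intro y y' h
    have h1 := congrArg (Lh B) h
    rw [hf, hf] at h1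
    exact Function.LeftInverse.injective hβ1 (b.repr.symm.injective (Subtype.ext h1))
  · rw [hq] at h
    refine ⟨ψβ (b.repr ⟨Lh B z, h⟩), injB ?_⟩
    rw [hf, hβ2]
    simp
  · rintro ⟨y, rfl⟩
    rw [hq, hf]
    exact (b.repr.symm (Lh β y)).2

end pres
end GH

namespace GH

section assembly
variable {G G' L X Y K : Type} [Group G] [Group G'] [Group L] [Group X] [Group Y] [Group K]

theorem hm0_inj (f : G →* G') (a : HH 0 G) (h : hm 0 f a = 0) : a = 0 := by
  obtain ⟨c, hc, rfl⟩ := mk_rep a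
  obtain ⟨y, hy⟩ := (mk_eq_zero _ _).1 ((Hm_mk (triv_eqv f (AddMonoidHom.id ℤ)) c hc).symm.trans h)
  have h2 : (c : ℤ) = 0 := hy.symm.trans (d0_triv y)
  rw [mk_eq_zero]
  exact ⟨0, (map_zero _).trans h2.symm⟩

variable {i1 : L →* X} {i2 : L →* Y} {jX : X →* G} {jY : Y →* G}

theorem susp_one (h : Amal i1 i2 jX jY) (hX : Acyc 3 X) (hY : Acyc 3 Y) (a : HH 1 G) : a = 0 := by
  obtain ⟨⟨δ, h1, -, -, h4, -, -⟩, -⟩ := h.mv 0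
  obtain ⟨x, y, e⟩ := h1 a (hm0_inj i1 _ (h4 a))
  rw [e, hX 1 le_rfl (by norm_num) x, hY 1 le_rfl (by norm_num) y, map_zero, map_zero, add_zero]

theorem susp_iso (h : Amal i1 i2 jX jY) (hX : Acyc 3 X) (hY : Acyc 3 Y) (n : ℕ) (h1 : 1 ≤ n) (h2 : n ≤ 2) :
    Nonempty (HH (n + 1) G ≃+ HH n L) := by
  obtain ⟨⟨δ, g1, -, -, -, -, g6⟩, -⟩ := h.mv n
  refine ⟨AddEquiv.ofBijective δ ⟨(injective_iff_map_eq_zero _).2 fun a ha => ?_, fun l =>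
    g6 l (hX n h1 (by omega) _) (hY n h1 (by omega) _)⟩⟩
  obtain ⟨x, y, e⟩ := g1 a ha
  rw [e, hX (n + 1) (by omega) (by omega) x, hY (n + 1) (by omega) (by omega) y, map_zero, map_zero, add_zero]

theorem kerEquiv {M N P : Type} [AddCommGroup M] [AddCommGroup N] [AddCommGroup P] (p : M →+ N) (q : M →+ P)
    (hp : Function.Surjective p) (hq : Function.Surjective q) (h : ∀ z, p z = 0 ↔ q z = 0) : Nonempty (N ≃+ P) := by
  have e : p.ker = q.ker := by
    ext z; exact h z
  exact ⟨((QuotientAddGroup.quotientKerEquivOfSurjective p hp).symm.trans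
    (QuotientAddGroup.quotientAddEquivOfEq e)).trans (QuotientAddGroup.quotientKerEquivOfSurjective q hq)⟩

section g1
variable {F1 F2 G K : Type} [Group F1] [Group F2] [Group G] [Group K] {f : F1 →* F2} {ι : F1 →* K}
  {jX : F2 × K →* G} {jY : K →* G}

theorem g1_fst (n : ℕ) (l : HH n F1) : hm n (MonoidHom.fst F2 K) (hm n (f.prod ι) l) = hm n f l :=
  (hm_comp n _ _ l).trans (hm_congr n (fun _ => rfl) l)

theorem g1_inl_fst (hK : Acyc 3 K) (n : ℕ) (hn : n ≤ 3) (x : HH n (F2 × K)) :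
    hm n (MonoidHom.inl F2 K) (hm n (MonoidHom.fst F2 K) x) = x :=
  hm_fst_inj hK n hn ((hm_comp n _ _ _).trans (hm_id n (fun _ => rfl) _))

theorem g1_surj (h : Amal (f.prod ι) ι jX jY) (hK : Acyc 3 K) :
    Function.Surjective (hm 1 (jX.comp (MonoidHom.inl F2 K))) := by
  intro a
  obtain ⟨⟨δ, g1, -, -, g4, -, -⟩, -⟩ := h.mv 0
  obtain ⟨x, y, e⟩ := g1 a (hm0_inj _ _ (g4 a))
  refine ⟨hm 1 (MonoidHom.fst F2 K) x, ?_⟩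
  rw [← hm_comp, g1_inl_fst hK 1 (by norm_num), e, hK 1 le_rfl (by norm_num) y, map_zero, add_zero]

theorem g1_ker (h : Amal (f.prod ι) ι jX jY) (hK : Acyc 3 K) (z : HH 1 F2) :
    hm 1 (jX.comp (MonoidHom.inl F2 K)) z = 0 ↔ ∃ y, hm 1 f y = z := by
  obtain ⟨-, g⟩ := h.mv 1
  constructor
  · intro hz
    obtain ⟨l, e1, -⟩ := g (hm 1 (MonoidHom.inl _ _) z) 0 (by rw [hm_comp, map_zero]; exact hz)
    refine ⟨l, ?_⟩
    rw [← g1_fst (ι := ι), e1, hm_comp]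
    exact hm_id 1 (fun _ => rfl) _
  · rintro ⟨y, rfl⟩
    have e1 : hm 1 (MonoidHom.inl F2 K) (hm 1 f y) = hm 1 (f.prod ι) y := by
      rw [← g1_fst (ι := ι)]
      exact g1_inl_fst hK 1 (by norm_num) _
    rw [← hm_comp, e1, hm_comp]
    refine (hm_congr 1 (f' := jY.comp ι) h.comm y).trans ?_
    rw [← hm_comp, hK 1 le_rfl (by norm_num) (hm 1 ι y), map_zero]

theorem g1_two (h : Amal (f.prod ι) ι jX jY) (hK : Acyc 3 K) (hf : Function.Injective (hm 1 f))
    (hF : ∀ a : HH 2 F2, a = 0) (a : HH 2 G) : a = 0 := by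
  obtain ⟨⟨δ, g1, -, -, g4, -, -⟩, -⟩ := h.mv 1
  have hδ : δ a = 0 := hf (by rw [← g1_fst (ι := ι), g4, map_zero, map_zero])
  obtain ⟨x, y, e⟩ := g1 a hδ
  have hx : x = 0 := hm_fst_inj hK 2 (by norm_num) ((hF _).trans (map_zero _).symm)
  rw [e, hx, hK 2 (by norm_num) (by norm_num) y, map_zero, map_zero, add_zero]

end g1

/-- A group with prescribed `H_1` and `H_2 = 0`. -/
theorem exists_G1 (B : Type) [AddCommGroup B] : ∃ (G : Type) (_ : Group G),
    Nonempty (HH 1 G ≃+ B) ∧ ∀ a : HH 2 G, a = 0 := by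
  obtain ⟨β, f, q, hq, hf, hfq⟩ := exists_pres B
  obtain ⟨K, _, ι, hι, hK, -, -, -⟩ := exists_acyclic (FreeGroup β)
  obtain ⟨G, _, jX, jY, h⟩ := exists_amal (f.prod ι) ι (fun a b e => hι (congrArg Prod.snd e)) hι
  exact ⟨G, inferInstance, kerEquiv _ q (g1_surj h hK) hq fun z => (g1_ker h hK z).trans (hfq z).symm,
    g1_two h hK hf fun a => free_vanish B 0 a⟩

/-- A group with prescribed `H_2` and `H_1 = 0`. -/
theorem exists_G2 (B : Type) [AddCommGroup B] : ∃ (G : Type) (_ : Group G),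
    (∀ a : HH 1 G, a = 0) ∧ Nonempty (HH 2 G ≃+ B) ∧ ∃ x : G, x ≠ 1 := by
  obtain ⟨K, _, ι, hι, hK, -, -, ⟨x0, hx0⟩⟩ := exists_acyclic (Multiplicative B)
  obtain ⟨G, _, jX, jY, h⟩ := exists_amal ι ι hι hι
  obtain ⟨e⟩ := susp_iso h hK hK 1 le_rfl (by norm_num)
  refine ⟨G, inferInstance, susp_one h hK hK, ⟨e.trans ((AddEquiv.ofBijective (hab (Multiplicative B))
    ⟨hab_inj, fun b => ⟨gch _ b, hab_gch b⟩⟩).trans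
    (MulEquiv.toAdditive (Abelianization.equivOfComm (H := Multiplicative B)).symm))⟩, jX x0, fun h1 => ?_⟩
  have : x0 = 1 := h.injX (h1.trans (map_one _).symm)
  exact hx0 1 ((map_one ι).trans this.symm)

theorem exists_G12 (B C : Type) [AddCommGroup B] [AddCommGroup C] : ∃ (G : Type) (_ : Group G),
    Nonempty (HH 1 G ≃+ B) ∧ Nonempty (HH 2 G ≃+ C) ∧ ∃ x : G, x ≠ 1 := by
  obtain ⟨G1, _, ⟨e1⟩, h1⟩ := exists_G1 B
  obtain ⟨G2, _, h2, ⟨e2⟩, x, hx⟩ := exists_G2 C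
  have hA : Acyc 1 G2 := fun i hi hi' a => by
    obtain rfl : i = 1 := by omega
    exact h2 a
  refine ⟨G1 × G2, inferInstance, ⟨(AddEquiv.ofBijective (hm 1 (MonoidHom.fst G1 G2))
    ⟨hm_fst_inj hA 1 le_rfl, hm_fst_surj 1⟩).trans e1⟩, ⟨(AddEquiv.ofBijective (hm 2 (MonoidHom.inr G1 G2))
    ⟨fun a b hab => ?_, fun x => lemQ hA x (h1 _)⟩).symm.trans e2⟩, (1, x), fun h => hx (congrArg Prod.snd h)⟩
  have h := congrArg (hm 2 (MonoidHom.snd G1 G2)) hab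
  rw [hm_comp, hm_comp] at h
  exact ((hm_id 2 (fun _ => rfl) a).symm.trans h).trans (hm_id 2 (fun _ => rfl) b)

end assembly
end GH

namespace GH

/-- Strong torsion generation. -/
def stg (G : Type) [Group G] : Prop :=
  ∀ n : ℕ, 2 ≤ n → ∃ g : G, orderOf g = n ∧ Subgroup.normalClosure {g} = ⊤

/-- Simple (in the sense of normal closures) with torsion of all orders. -/
def Sto (K : Type) [Group K] : Prop :=
  (∀ x : K, x ≠ 1 → Subgroup.normalClosure {x} = ⊤) ∧ ∀ n, 2 ≤ n → ∃ x : K, orderOf x = n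

section grp
variable {G K L S A X Y : Type} [Group G] [Group K] [Group L] [Group S] [CommGroup A] [Group X] [Group Y]

theorem ne_one_of_order {x : K} {n : ℕ} (hn : 2 ≤ n) (h : orderOf x = n) : x ≠ 1 := by
  rintro rfl
  rw [orderOf_one] at h
  omega

theorem Sto.center (hK : Sto K) (z : K) (hz : ∀ g, g * z = z * g) : z = 1 := by
  by_contra hne
  have key : ∀ w : K, (∀ g, g * w = w * g) → w ≠ 1 → ∀ y : K, ∃ k : ℤ, w ^ k = y := by
    intro w hw hw1 y
    have hN : (Subgroup.zpowers w).Normal := ⟨by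
      rintro _ ⟨k, rfl⟩ g
      refine ⟨k, ?_⟩
      have : Commute g (w ^ k) := Commute.zpow_right (hw g) k
      change w ^ k = g * w ^ k * g⁻¹
      rw [this.eq, mul_inv_cancel_right]⟩
    have h1 : Subgroup.normalClosure {w} ≤ Subgroup.zpowers w :=
      Subgroup.normalClosure_le_normal (by rintro _ rfl; exact Subgroup.mem_zpowers _)
    rw [hK.1 w hw1] at h1
    exact h1 (Subgroup.mem_top y)
  have hcomm : ∀ a b : K, a * b = b * a := by
    intro a b
    obtain ⟨k, rfl⟩ := key z hz hne a
    exact (Commute.zpow_right (hz b) k).eq.symm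
  obtain ⟨x, hx⟩ := hK.2 2 le_rfl
  obtain ⟨y, hy⟩ := hK.2 3 (by norm_num)
  obtain ⟨k, hk⟩ := key x (fun g => hcomm _ _) (ne_one_of_order le_rfl hx) y
  have h2 : y ^ 2 = 1 := by
    rw [← hk, ← zpow_natCast, ← zpow_mul, mul_comm, zpow_mul, zpow_natCast, ← hx, pow_orderOf_eq_one, one_zpow]
  have h3 := orderOf_dvd_of_pow_eq_one h2
  rw [hy] at h3
  omega

theorem Sto.all (hK : Sto K) (N : Subgroup G) [hN : N.Normal] (j : K →* G) (x : K) (hx : x ≠ 1) (h : j x ∈ N) (y : K) :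
    j y ∈ N := by
  have h1 : Subgroup.normalClosure {x} ≤ N.comap j :=
    Subgroup.normalClosure_le_normal (by rintro _ rfl; exact h)
  rw [hK.1 x hx] at h1
  exact h1 (Subgroup.mem_top y)

theorem Amal.eq_top {i1 : L →* X} {i2 : L →* Y} {jX : X →* G} {jY : Y →* G} (h : Amal i1 i2 jX jY)
    (N : Subgroup G) (hX : ∀ x, jX x ∈ N) (hY : ∀ y, jY y ∈ N) : N = ⊤ := by
  rw [eq_top_iff]
  rintro g -
  exact h.gen (fun g => g ∈ N) N.one_mem (fun g x hg => N.mul_mem hg (hX x)) (fun g x hg => N.mul_mem hg (hY x)) g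

theorem susp_grp {ι : L →* K} {jX jY : K →* G} (h : Amal ι ι jX jY) (hK : Sto K) (hp : ∃ x, ∀ l, ι l ≠ x)
    (hL : ∃ l : L, l ≠ 1) : stg G ∧ ∀ z : G, (∀ g, g * z = z * g) → z = 1 := by
  constructor
  · intro n hn
    obtain ⟨e, he⟩ := hK.2 n hn
    refine ⟨jX e, (orderOf_injective jX h.injX e).trans he, ?_⟩
    have hX := hK.all (Subgroup.normalClosure {jX e}) jX e (ne_one_of_order hn he) (Subgroup.subset_normalClosure rfl)
    refine h.eq_top _ hX ?_
    obtain ⟨l, hl⟩ := hL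
    refine hK.all _ jY (ι l) (fun h1 => hl (h.inj1 (h1.trans (map_one ι).symm))) ?_
    rw [← h.comm]
    exact hX _
  · intro z hz
    obtain ⟨l, rfl⟩ := h.cen hp hp z hz
    have : ι l = 1 := hK.center _ fun g => h.injX (by rw [map_mul, map_mul]; exact hz _)
    rw [this, map_one]

theorem exists_Sp (B C : Type) [AddCommGroup B] [AddCommGroup C] : ∃ (S : Type) (_ : Group S),
    stg S ∧ (∀ z : S, (∀ g, g * z = z * g) → z = 1) ∧ (∀ a : HH 1 S, a = 0) ∧ Nonempty (HH 2 S ≃+ B) ∧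
      Nonempty (HH 3 S ≃+ C) := by
  obtain ⟨G, _, ⟨e1⟩, ⟨e2⟩, hG⟩ := exists_G12 B C
  obtain ⟨K, _, ι, hι, hK, h1, h2, h3⟩ := exists_acyclic G
  obtain ⟨S, _, jX, jY, h⟩ := exists_amal ι ι hι hι
  obtain ⟨g1, g2⟩ := susp_grp h ⟨h1, h2⟩ h3 hG
  obtain ⟨u1⟩ := susp_iso h hK hK 1 le_rfl (by norm_num)
  obtain ⟨u2⟩ := susp_iso h hK hK 2 (by norm_num) le_rfl
  exact ⟨S, inferInstance, g1, g2, susp_one h hK hK, ⟨u1.trans e1⟩, ⟨u2.trans e2⟩⟩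

/-- The first inclusion of the central construction. -/
def jc (c : A →* S) (hc : ∀ a s, s * c a = c a * s) (ι : S →* K) : A × S →* S × K where
  toFun p := (c p.1 * p.2, ι p.2)
  map_one' := by simp
  map_mul' p q := by
    refine Prod.ext ?_ (map_mul ι _ _)
    change c (p.1 * q.1) * (p.2 * q.2) = c p.1 * p.2 * (c q.1 * q.2)
    rw [map_mul, mul_assoc, mul_assoc, ← mul_assoc p.2, hc, mul_assoc]

theorem central_grp {c : A →* S} {hc : ∀ a s, s * c a = c a * s} {ι : S →* K} {jX : S × K →* G} {jY : A × K →* G}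
    (h : Amal (jc c hc ι) ((MonoidHom.id A).prodMap ι) jX jY) (hι : Function.Injective ι) (hK : Sto K)
    (hp : ∃ x, ∀ l, ι l ≠ x) (hS : ∃ s : S, s ≠ 1) :
    stg G ∧ ∀ z : G, (∀ g, g * z = z * g) ↔ ∃ a, jY (a, 1) = z := by
  have hA : ∀ a, jY (a, 1) = jX (c a, 1) := fun a => by
    have := h.comm (a, 1)
    change jX (c a * 1, ι 1) = jY (a, ι 1) at this
    rw [mul_one, map_one] at this
    exact this.symm
  have hB : ∀ s, jY (1, ι s) = jX (s, ι s) := fun s => by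
    have := h.comm (1, s)
    change jX (c 1 * s, ι s) = jY (1, ι s) at this
    rw [map_one, one_mul] at this
    exact this.symm
  constructor
  · intro n hn
    obtain ⟨e, he⟩ := hK.2 n hn
    have ho : orderOf (jY (1, e)) = n := by
      rw [orderOf_injective jY h.injY, ← he]
      exact orderOf_injective (MonoidHom.inr A K) (fun a b h => congrArg Prod.snd h) e
    refine ⟨jY (1, e), ho, ?_⟩
    set N := Subgroup.normalClosure {jY (1, e)} with hN
    have n1 : ∀ k, jY (1, k) ∈ N := fun k => hK.all N (jY.comp (MonoidHom.inr A K)) e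
      (ne_one_of_order hn he) (Subgroup.subset_normalClosure rfl) k
    have n2 : ∀ s, jX (s, ι s) ∈ N := fun s => by rw [← hB]; exact n1 _
    have n3 : ∀ k, jX (1, k) ∈ N := by
      obtain ⟨s, hs⟩ := hS
      have hs' : ι s ≠ 1 := fun h1 => hs (hι (h1.trans (map_one ι).symm))
      have : ∃ k, k * ι s ≠ ι s * k := by
        by_contra hcon
        push Not at hcon
        exact hs' (hK.center _ hcon)
      obtain ⟨k, hk⟩ := this
      refine hK.all N (jX.comp (MonoidHom.inr S K)) (k * ι s * k⁻¹ * (ι s)⁻¹) ?_ ?_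
      · intro h1
        apply hk
        rw [mul_inv_eq_one, mul_inv_eq_iff_eq_mul] at h1
        exact h1
      · have hn : N.Normal := inferInstance
        have h1 := N.mul_mem (hn.conj_mem _ (n2 s) (jX (1, k))) (N.inv_mem (n2 s))
        rw [← map_inv, ← map_inv, ← map_mul, ← map_mul, ← map_mul] at h1
        convert h1 using 1
        change jX _ = jX _
        congr 1
        refine Prod.ext ?_ rfl
        change 1 = 1 * s * 1⁻¹ * s⁻¹
        simp
    have n4 : ∀ s, jX (s, 1) ∈ N := fun s => by
      have h1 := N.mul_mem (n2 s) (n3 (ι s)⁻¹)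
      rw [← map_mul, Prod.mk_mul_mk, mul_one, mul_inv_cancel] at h1
      exact h1
    refine h.eq_top N (fun x => ?_) (fun y => ?_)
    · have h1 := N.mul_mem (n4 x.1) (n3 x.2)
      rw [← map_mul, Prod.mk_mul_mk, mul_one, one_mul] at h1
      exact h1
    · have h1 := N.mul_mem (n4 (c y.1)) (n1 y.2)
      rw [← hA, ← map_mul, Prod.mk_mul_mk, mul_one, one_mul] at h1
      exact h1
  · intro z
    constructor
    · intro hz
      obtain ⟨x, hx⟩ := hp
      obtain ⟨l, rfl⟩ := h.cen ⟨(1, x), fun l hl => hx _ (congrArg Prod.snd hl)⟩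
        ⟨(1, x), fun l hl => hx _ (congrArg Prod.snd hl)⟩ z hz
      have e : jX (jc c hc ι l) = jY (l.1, ι l.2) := h.comm l
      rw [e] at hz ⊢
      have : ι l.2 = 1 := hK.center _ fun g => by
        have h1 := hz (jY (1, g))
        rw [← map_mul, ← map_mul] at h1
        exact congrArg Prod.snd (h.injY h1)
      exact ⟨l.1, by rw [this]⟩
    · rintro ⟨a, rfl⟩
      intro g
      refine h.gen (fun g => g * jY (a, 1) = jY (a, 1) * g) (by rw [one_mul, mul_one]) ?_ ?_ g
      · intro g x hg
        have : jX x * jY (a, 1) = jY (a, 1) * jX x := by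
          rw [hA, ← map_mul, ← map_mul]
          congr 1
          exact Prod.ext (hc a x.1) (by simp)
        rw [mul_assoc, this, ← mul_assoc, hg, mul_assoc]
      · intro g x hg
        have : jY x * jY (a, 1) = jY (a, 1) * jY x := by
          rw [← map_mul, ← map_mul]
          congr 1
          exact Prod.ext (mul_comm _ _) (by simp)
        rw [mul_assoc, this, ← mul_assoc, hg, mul_assoc]

theorem central_hom {c : A →* S} {hc : ∀ a s, s * c a = c a * s} {ι : S →* K} {jX : S × K →* G} {jY : A × K →* G}
    (h : Amal (jc c hc ι) ((MonoidHom.id A).prodMap ι) jX jY) (hK : Acyc 3 K) {m : ℕ} (hm2 : m ≤ 2) (hS : Acyc m S) :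
    Acyc (m + 1) G := by
  intro i hi him a
  obtain ⟨n, rfl⟩ : ∃ n, i = n + 1 := ⟨i - 1, by omega⟩
  have hA : ∀ a, jY (a, 1) = jX (c a, 1) := fun a => by
    have := h.comm (a, 1)
    change jX (c a * 1, ι 1) = jY (a, ι 1) at this
    rw [mul_one, map_one] at this
    exact this.symm
  have hB : ∀ s, jX (s, ι s) = jY (1, ι s) := fun s => by
    have := h.comm (1, s)
    change jX (c 1 * s, ι s) = jY (1, ι s) at this
    rw [map_one, one_mul] at this
    exact this
  obtain ⟨⟨δ, g1, -, -, -, g5, -⟩, -⟩ := h.mv n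
  have hδ : δ a = 0 := by
    refine hm_fst_inj hS n (by omega) ?_
    have h1 := congrArg (hm n (MonoidHom.fst A K)) (g5 a)
    rw [hm_comp, map_zero] at h1
    rw [map_zero]
    exact h1
  have hX : ∀ x, hm (n + 1) jX x = 0 := by
    intro x
    have e : hm (n + 1) ((MonoidHom.id S).prod ι) (hm (n + 1) (MonoidHom.fst S K) x) = x :=
      hm_fst_inj hK (n + 1) (by omega) ((hm_comp (n + 1) _ _ _).trans (hm_id (n + 1) (fun _ => rfl) _))
    rw [← e, hm_comp]
    refine (hm_congr (n + 1) (f' := (jY.comp (MonoidHom.inr A K)).comp ι) hB _).trans ?_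
    rw [← hm_comp, hK (n + 1) (by omega) (by omega) (hm (n + 1) ι _), map_zero]
  have hY : ∀ y, hm (n + 1) jY y = 0 := by
    intro y
    have e : hm (n + 1) (MonoidHom.inl A K) (hm (n + 1) (MonoidHom.fst A K) y) = y :=
      hm_fst_inj hK (n + 1) (by omega) ((hm_comp (n + 1) _ _ _).trans (hm_id (n + 1) (fun _ => rfl) _))
    rw [← e, hm_comp]
    refine (hm_congr (n + 1) (f' := jX.comp ((MonoidHom.inl S K).comp c)) hA _).trans ?_
    rw [← hm_comp]
    exact hX _
  obtain ⟨x, y, e⟩ := g1 a hδ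
  rw [e, hX, hY, add_zero]

theorem central_step (c : A →* S) (hc : ∀ a s, s * c a = c a * s) (hci : Function.Injective c) (hS : ∃ s : S, s ≠ 1)
    {m : ℕ} (hm2 : m ≤ 2) (hA : Acyc m S) : ∃ (J : Type) (_ : Group J) (c' : A →* J),
      Function.Injective c' ∧ (∀ z : J, (∀ g, g * z = z * g) ↔ ∃ a, c' a = z) ∧ stg J ∧ (∃ s : J, s ≠ 1) ∧
        Acyc (m + 1) J := by
  obtain ⟨K, _, ι, hι, hK, h1, h2, h3⟩ := exists_acyclic S
  obtain ⟨J, _, jX, jY, h⟩ := exists_amal (jc c hc ι) ((MonoidHom.id A).prodMap ι) (by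
      intro p q hpq
      have e2 : p.2 = q.2 := hι (congrArg Prod.snd hpq)
      have e1 : c p.1 * p.2 = c q.1 * q.2 := congrArg Prod.fst hpq
      rw [e2] at e1
      exact Prod.ext (hci (mul_right_cancel e1)) e2) (by
      intro p q hpq
      have e1 : p.1 = q.1 := congrArg (fun z : A × K => z.1) hpq
      exact Prod.ext e1 (hι (congrArg Prod.snd hpq)))
  obtain ⟨g1, g2⟩ := central_grp h hι ⟨h1, h2⟩ h3 hS
  obtain ⟨e, he, -⟩ := g1 2 le_rfl
  exact ⟨J, inferInstance, jY.comp (MonoidHom.inl A K), h.injY.comp (fun a b h => congrArg Prod.fst h), g2, g1,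
    ⟨e, ne_one_of_order le_rfl he⟩, central_hom h hK hm2 hA⟩

theorem exists_E (A : Type) [CommGroup A] : ∃ (J : Type) (_ : Group J) (c' : A →* J),
      Function.Injective c' ∧ (∀ z : J, (∀ g, g * z = z * g) ↔ ∃ a, c' a = z) ∧ stg J ∧ Acyc 3 J := by
  obtain ⟨J1, _, c1, i1, z1, -, s1, a1⟩ := central_step (m := 0) (MonoidHom.inl A (Multiplicative ℤ))
    (fun a s => mul_comm _ _) (fun a b h => congrArg Prod.fst h) ⟨(1, Multiplicative.ofAdd 1), fun h => by
      have h1 : (1 : ℤ) = 0 := congrArg Multiplicative.toAdd (congrArg Prod.snd h)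
      exact absurd h1 (by decide)⟩ (by norm_num) (fun i hi hi' => by omega)
  obtain ⟨J2, _, c2, i2, z2, -, s2, a2⟩ := central_step c1 (fun a => (z1 _).2 ⟨a, rfl⟩) i1 s1 (by norm_num) a1
  obtain ⟨J3, _, c3, i3, z3, t3, s3, a3⟩ := central_step c2 (fun a => (z2 _).2 ⟨a, rfl⟩) i2 s2 (by norm_num) a2
  exact ⟨J3, inferInstance, c3, i3, z3, t3, a3⟩

theorem half (φ : S →* G) (s : S) (hs : Subgroup.normalClosure {s} = ⊤) (hc : ∀ g, φ s * φ g = φ g * φ s)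
    (hp : ∀ a : HH 1 S, a = 0) (x : S) : φ x = 1 := by
  have h1 : Subgroup.normalClosure {s} ≤ (Subgroup.center φ.range).comap φ.rangeRestrict := by
    refine Subgroup.normalClosure_le_normal ?_
    rintro _ rfl
    change φ.rangeRestrict _ ∈ Subgroup.center φ.range
    rw [Subgroup.mem_center_iff]
    rintro ⟨_, g, rfl⟩
    exact Subtype.ext (hc g).symm
  rw [hs] at h1
  have h2 : ∀ a b, φ a * φ b = φ b * φ a := by
    intro a b
    have := Subgroup.mem_center_iff.1 (h1 (Subgroup.mem_top a)) (φ.rangeRestrict b)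
    exact (congrArg Subtype.val this).symm
  have h3 : commutator S ≤ φ.ker := by
    rw [commutator_def, Subgroup.commutator_le]
    intro a _ b _
    rw [MonoidHom.mem_ker, map_commutatorElement, commutatorElement_def, h2 a b]
    group
  have h4 : Additive.ofMul (Abelianization.of x) = 0 := by
    rw [← hab_gc, hp (gc x), map_zero]
  have h5 : (Abelianization.of x) = 1 := h4
  have h6 : x ∈ commutator S := by
    rw [← Abelianization.ker_of]
    exact h5
  exact h3 h6

theorem stg_prod (h1 : stg S) (h2 : stg G) (p1 : ∀ a : HH 1 S, a = 0) (p2 : ∀ a : HH 1 G, a = 0) : stg (S × G) := by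
  intro n hn
  obtain ⟨s, os, hs⟩ := h1 n hn
  obtain ⟨e, oe, he⟩ := h2 n hn
  refine ⟨(s, e), by rw [Prod.orderOf, os, oe, Nat.lcm_self], ?_⟩
  set N := Subgroup.normalClosure {(s, e)} with hN
  have key : QuotientGroup.mk' N (s, e) = 1 :=
    (QuotientGroup.eq_one_iff _).2 (Subgroup.subset_normalClosure rfl)
  have k0 : QuotientGroup.mk' N (s, 1) * QuotientGroup.mk' N (1, e) = 1 := by
    rw [← map_mul, Prod.mk_mul_mk, mul_one, one_mul, key]
  have kk : ∀ x y, QuotientGroup.mk' N (x, 1) * QuotientGroup.mk' N (1, y) =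
      QuotientGroup.mk' N (1, y) * QuotientGroup.mk' N (x, 1) := fun x y => by
    rw [← map_mul, ← map_mul, Prod.mk_mul_mk, Prod.mk_mul_mk, mul_one, one_mul, mul_one, one_mul]
  have q1 : ∀ x, QuotientGroup.mk' N (x, 1) = 1 := half ((QuotientGroup.mk' N).comp (MonoidHom.inl S G)) s hs
    (fun g => by
      change QuotientGroup.mk' N (s, 1) * QuotientGroup.mk' N (g, 1) = QuotientGroup.mk' N (g, 1) * QuotientGroup.mk' N (s, 1)
      rw [eq_inv_of_mul_eq_one_left k0]
      exact (Commute.inv_right (a := QuotientGroup.mk' N (g, 1)) (kk g e)).eq.symm) p1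
  have q2 : ∀ x, QuotientGroup.mk' N (1, x) = 1 := half ((QuotientGroup.mk' N).comp (MonoidHom.inr S G)) e he
    (fun g => by
      change QuotientGroup.mk' N (1, e) * QuotientGroup.mk' N (1, g) = QuotientGroup.mk' N (1, g) * QuotientGroup.mk' N (1, e)
      rw [eq_inv_of_mul_eq_one_right k0]
      exact (Commute.inv_left (a := QuotientGroup.mk' N (s, 1)) (kk s g)).eq) p2
  rw [eq_top_iff]
  rintro ⟨x, y⟩ -
  refine (QuotientGroup.eq_one_iff _).1 ?_
  change QuotientGroup.mk' N (x, y) = 1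
  have : (x, y) = (x, 1) * (1, y) := by rw [Prod.mk_mul_mk, mul_one, one_mul]
  rw [this, map_mul, q1, q2, one_mul]

theorem exists_final (A B C : Type) [AddCommGroup A] [AddCommGroup B] [AddCommGroup C] : ∃ (S : Type) (_ : Group S),
    stg S ∧ Nonempty (Subgroup.center S ≃* Multiplicative A) ∧ (∀ a : HH 1 S, a = 0) ∧ Nonempty (HH 2 S ≃+ B) ∧
      Nonempty (HH 3 S ≃+ C) := by
  obtain ⟨S, _, s1, s2, s3, ⟨e2⟩, ⟨e3⟩⟩ := exists_Sp B C
  obtain ⟨E, _, c, hc, hz, t, hE⟩ := exists_E (Multiplicative A)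
  refine ⟨S × E, inferInstance, stg_prod s1 t s3 (hE 1 le_rfl (by norm_num)), ?_, fun a => ?_,
    ⟨(AddEquiv.ofBijective (hm 2 (MonoidHom.fst S E)) ⟨hm_fst_inj hE 2 (by norm_num), hm_fst_surj 2⟩).trans e2⟩,
    ⟨(AddEquiv.ofBijective (hm 3 (MonoidHom.fst S E)) ⟨hm_fst_inj hE 3 le_rfl, hm_fst_surj 3⟩).trans e3⟩⟩
  · let ψ : Multiplicative A →* Subgroup.center (S × E) := ((MonoidHom.inr S E).comp c).codRestrict _ (by
      intro a
      rw [Subgroup.mem_center_iff]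
      rintro ⟨x, y⟩
      refine Prod.ext ?_ ((hz _).2 ⟨a, rfl⟩ y)
      change x * 1 = 1 * x
      rw [one_mul, mul_one])
    refine ⟨(MulEquiv.ofBijective ψ ⟨fun a b hab => hc (congrArg (fun z : Subgroup.center (S × E) => z.1.2) hab), ?_⟩).symm⟩
    rintro ⟨⟨x, y⟩, hxy⟩
    rw [Subgroup.mem_center_iff] at hxy
    obtain ⟨a, ha⟩ := (hz y).1 fun g => congrArg Prod.snd (hxy (1, g))
    have hx : x = 1 := s2 x fun g => congrArg Prod.fst (hxy (g, 1))
    exact ⟨a, Subtype.ext (Prod.ext hx.symm ha)⟩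
  · exact hm_fst_inj hE 1 (by norm_num) ((s3 _).trans (map_zero _).symm)

end grp
end GH

namespace GH

section bar
variable {G : Type} [Group G]

/-- Homogeneous basic chains. -/
noncomputable def Eh : ∀ (n : ℕ) (M : Rp G), (Fin (n + 1) → G) → M.V →+ C n M
  | 0, M, v => M.act (v 0)
  | n + 1, M, v => (up n M).toAddMonoidHom.comp ((Eh n (F M) (Fin.tail v)).comp ((sg M (v 0)).comp (M.act (v 0))))

theorem Eh_zero (M : Rp G) (v : Fin 1 → G) (m : M.V) : Eh 0 M v m = M.act (v 0) m := rfl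

theorem Eh_succ (n : ℕ) (M : Rp G) (v : Fin (n + 2) → G) (m : M.V) :
    Eh (n + 1) M v m = up n M (Eh n (F M) (Fin.tail v) (sg M (v 0) (M.act (v 0) m))) := rfl

theorem Eh_nat (n : ℕ) : ∀ {M M' : Rp G} {φ : M.V →+ M'.V} (_ : Eqv (MonoidHom.id G) M M' φ) (v : Fin (n + 1) → G) (m : M.V),
    Cm (id : G → G) n φ (Eh n M v m) = Eh n M' v (φ m) := by
  induction n with
  | zero => exact fun h v m => h (v 0) m
  | succ n ih =>
    intro M M' φ h v m
    rw [Eh_succ, Eh_succ, Cm_up]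
    refine congrArg (up n M') ((ih (fm_eqv (MonoidHom.id G) M M' φ) _ _).trans ?_)
    congr 1
    have e : φ (M.act (v 0) m) = M'.act (v 0) (φ m) := h (v 0) m
    rw [← e]
    exact fm_sg _ _ _ _

theorem Eh_trans (n : ℕ) : ∀ (M : Rp G) (v : Fin (n + 1) → G) (g : G) (m : M.V),
    Eh n M (fun i => v i * g) m = Eh n M v (M.act g m) := by
  induction n with
  | zero => exact fun M v g m => M.act_mul _ _ m
  | succ n ih =>
    intro M v g m
    rw [Eh_succ, Eh_succ]
    congr 1
    refine (ih (F M) (Fin.tail v) g _).trans ?_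
    rw [F_act_sg, mul_inv_cancel_right, M.act_mul]

theorem d_Eh (n : ℕ) : ∀ (M : Rp G) (v : Fin (n + 2) → G) (m : M.V),
    d n M (Eh (n + 1) M v m) = ∑ j : Fin (n + 2), (-1 : ℤ) ^ (j : ℕ) • Eh n M (fun i => v (j.succAbove i)) m := by
  induction n with
  | zero =>
    intro M v m
    rw [Fin.sum_univ_two]
    have e1 : av M (sg M (v 0 * (Fin.tail v 0)⁻¹) (M.act (v 0) m)) = M.act (v 1) m := by
      rw [av_sg, ← M.act_mul]
      congr 2
      change (v 0 * (v 1)⁻¹)⁻¹ * v 0 = v 1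
      group
    have e2 : sm M (sg M (v 0 * (Fin.tail v 0)⁻¹) (M.act (v 0) m)) = M.act (v 0) m := sm_sg _ _ _
    have e3 : Eh 0 (F M) (Fin.tail v) (sg M (v 0) (M.act (v 0) m)) = sg M (v 0 * (Fin.tail v 0)⁻¹) (M.act (v 0) m) :=
      F_act_sg _ _ _ _
    have e4 := d_zero_up M (Eh 0 (F M) (Fin.tail v) (sg M (v 0) (M.act (v 0) m)))
    refine e4.trans ((congrArg (fun z => av M z - sm M z) e3).trans ((congrArg₂ (fun a b => a - b) e1 e2).trans ?_))
    simp only [Fin.val_zero, pow_zero, one_smul, Fin.val_one, pow_one, neg_smul, ← sub_eq_add_neg]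
    rfl
  | succ n ih =>
    intro M v m
    rw [Eh_succ, d_up, Eh_nat (n + 1) (av_eqv M), ih (F M), Fin.sum_univ_succ (n := n + 2), av_sg, M.act_inv_act]
    rw [sub_eq_add_neg, map_sum, ← Finset.sum_neg_distrib]
    congr 1
    · simp only [Fin.val_zero, pow_zero, one_smul]
      rfl
    · refine Finset.sum_congr rfl fun j _ => ?_
      rw [map_zsmul, Fin.val_succ, pow_succ, mul_neg_one, neg_smul]
      congr 2
      rw [Eh_succ]
      congr 3
      funext i
      change v (j.succAbove i).succ = v (j.succ.succAbove i.succ)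
      rw [Fin.succ_succAbove_succ]

/-- Currying the first coordinate. -/
noncomputable def Qe (n : ℕ) (G A : Type) [AddCommGroup A] : ((Fin (n + 1) → G) →₀ A) ≃+ ((Fin n → G) →₀ (G →₀ A)) :=
  (Finsupp.domCongr ((Fin.consEquiv (fun _ : Fin (n + 1) => G)).symm.trans (Equiv.prodComm _ _))).trans
    Finsupp.curryAddEquiv

theorem Qe_single (n : ℕ) (A : Type) [AddCommGroup A] (w : Fin (n + 1) → G) (m : A) :
    Qe n G A (Finsupp.single w m) = Finsupp.single (Fin.tail w) (Finsupp.single (w 0) m) := by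
  have h1 : Finsupp.domCongr ((Fin.consEquiv (fun _ : Fin (n + 1) => G)).symm.trans (Equiv.prodComm _ _))
      (Finsupp.single w m) = Finsupp.single (Fin.tail w, w 0) m := Finsupp.equivMapDomain_single _ _ _
  exact (congrArg Finsupp.curry h1).trans (Finsupp.curry_single _ _)

/-- Inhomogeneous description of chains. -/
noncomputable def Tq : ∀ (n : ℕ) (M : Rp G), ((Fin n → G) →₀ M.V) ≃+ C n M
  | 0, M => AddEquiv.ofBijective (Finsupp.applyAddHom (M := M.V) (default : Fin 0 → G))
      ⟨fun a b h => Finsupp.ext fun x => by rw [Subsingleton.elim x default]; exact h,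
        fun m => ⟨Finsupp.single default m, Finsupp.single_eq_same⟩⟩
  | n + 1, M => (Qe n G M.V).trans ((Tq n (F M)).trans (up n M))

theorem Tq_zero (M : Rp G) (w : Fin 0 → G) (m : M.V) : Tq 0 M (Finsupp.single w m) = m := by
  rw [Subsingleton.elim w default]
  exact Finsupp.single_eq_same

theorem Tq_succ (n : ℕ) (M : Rp G) (w : Fin (n + 1) → G) (m : M.V) :
    Tq (n + 1) M (Finsupp.single w m) = up n M (Tq n (F M) (Finsupp.single (Fin.tail w) (sg M (w 0) m))) := by
  exact congrArg (fun z => up n M (Tq n (F M) z)) (Qe_single n M.V w m)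

theorem Eh_Tq (n : ℕ) : ∀ (M : Rp G) (v : Fin (n + 1) → G) (m : M.V),
    Eh n M v m = Tq n M (Finsupp.single (fun i => v i.castSucc * (v i.succ)⁻¹) (M.act (v 0) m)) := by
  induction n with
  | zero => exact fun M v m => (Tq_zero M _ _).symm
  | succ n ih =>
    intro M v m
    rw [Eh_succ, ih, Tq_succ, F_act_sg]
    rfl

end bar
end GH

namespace GH

section nerve
variable {G : Type} [Group G]

/-- Vertex coordinates of a simplex. -/
def nv {n : ℕ} (σ : ComposableArrows (SingleObj G) n) (i : Fin (n + 1)) : G :=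
  σ.map (homOfLE (Fin.zero_le i))

theorem nv_map {n : ℕ} (σ : ComposableArrows (SingleObj G) n) {i j : Fin (n + 1)} (f : i ⟶ j) :
    (σ.map f : G) = nv σ j * (nv σ i)⁻¹ := by
  have h := σ.map_comp (homOfLE (Fin.zero_le i)) f
  have h2 : nv σ j = (σ.map f : G) * nv σ i := h
  rw [h2, mul_inv_cancel_right]

theorem nv_zero {n : ℕ} (σ : ComposableArrows (SingleObj G) n) : nv σ 0 = 1 := σ.map_id 0

/-- Edge coordinates of a simplex. -/
def nw {n : ℕ} (σ : ComposableArrows (SingleObj G) n) (i : Fin n) : G := nv σ i.castSucc * (nv σ i.succ)⁻¹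

theorem nw_bij (n : ℕ) : Function.Bijective (nw : ComposableArrows (SingleObj G) n → Fin n → G) := by
  constructor
  · intro σ τ h
    have hv : ∀ i, nv σ i = nv τ i := by
      intro i
      induction i using Fin.induction with
      | zero => rw [nv_zero, nv_zero]
      | succ i ih =>
        have := congrFun h i
        unfold nw at this
        rw [ih] at this
        exact inv_injective (mul_left_cancel this)
    refine CategoryTheory.Functor.hext (fun _ => rfl) fun i j f => heq_of_eq ?_
    have h2 : nv σ j * (nv σ i)⁻¹ = nv τ j * (nv τ i)⁻¹ := by rw [hv, hv]
    exact (nv_map σ f).trans (h2.trans (nv_map τ f).symm)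
  · intro w
    let σ : ComposableArrows (SingleObj G) n := SingleObj.differenceFunctor fun i : Fin (n + 1) => (Fin.partialProd w i)⁻¹
    refine ⟨σ, funext fun i => ?_⟩
    have hv : ∀ i, nv σ i = (Fin.partialProd w i)⁻¹ := fun i => by
      change (Fin.partialProd w i)⁻¹ * ((Fin.partialProd w 0)⁻¹)⁻¹ = _
      rw [Fin.partialProd_zero, inv_one, inv_one, mul_one]
    unfold nw
    rw [hv, hv, inv_inv]
    exact Fin.partialProd_right_inv w i

theorem nv_face {n : ℕ} (σ : ComposableArrows (SingleObj G) (n + 1)) (j : Fin (n + 2)) (i : Fin (n + 1)) :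
    nv ((nerve (SingleObj G)).δ j σ) i = nv σ (j.succAbove i) * (nv σ (j.succAbove 0))⁻¹ :=
  nv_map σ (i := j.succAbove 0) (j := j.succAbove i)
    (homOfLE ((Fin.strictMono_succAbove j).monotone (Fin.zero_le i)))

/-- Chains of the classifying complex. -/
noncomputable def ee (G : Type) [Group G] (n : ℕ) : (classifyingComplex G).X n ≃+ C n (triv G ℤ) :=
  (Finsupp.domCongr (M := ℤ) (Equiv.ofBijective _ (nw_bij (G := G) n))).trans (Tq n (triv G ℤ))

theorem ee_mk (n : ℕ) (σ : ComposableArrows (SingleObj G) n) :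
    ee G n (ModuleCat.freeMk (R := ℤ) σ) = Eh n (triv G ℤ) (nv σ) (1 : ℤ) :=
  (congrArg (Tq n (triv G ℤ)) (Finsupp.equivMapDomain_single _ _ _)).trans (Eh_Tq n (triv G ℤ) (nv σ) (1 : ℤ)).symm

/-- The underlying simplicial module. -/
noncomputable abbrev sX (G : Type) [Group G] : SimplicialObject (ModuleCat ℤ) :=
  ((SimplicialObject.whiskering (Type) (ModuleCat ℤ)).obj (ModuleCat.free ℤ)).obj (nerve (SingleObj G))

theorem cc_d (n : ℕ) : (classifyingComplex G).d (n + 1) n =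
    ∑ i : Fin (n + 2), (-1 : ℤ) ^ (i : ℕ) • (sX G).δ i :=
  AlternatingFaceMapComplex.obj_d_eq (sX G) n

theorem sX_face (n : ℕ) (j : Fin (n + 2)) (σ : ComposableArrows (SingleObj G) (n + 1)) :
    (sX G).δ j (ModuleCat.freeMk (R := ℤ) σ) = ModuleCat.freeMk (R := ℤ) ((nerve (SingleObj G)).δ j σ) :=
  Finsupp.mapDomain_single

theorem ee_face (n : ℕ) (j : Fin (n + 2)) (σ : ComposableArrows (SingleObj G) (n + 1)) :
    ee G n (ModuleCat.freeMk (R := ℤ) ((nerve (SingleObj G)).δ j σ)) =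
      Eh n (triv G ℤ) (fun i => nv σ (j.succAbove i)) (1 : ℤ) := by
  refine (ee_mk n _).trans ?_
  have e : nv ((nerve (SingleObj G)).δ j σ) = fun i => nv σ (j.succAbove i) * (nv σ (j.succAbove 0))⁻¹ :=
    funext fun i => nv_face σ j i
  rw [e]
  exact Eh_trans n (triv G ℤ) (fun i => nv σ (j.succAbove i)) _ (1 : ℤ)

theorem sum_app {X Y : ModuleCat.{0} ℤ} {k : ℕ} (f : Fin k → (X ⟶ Y)) (x : X) :
    (∑ i : Fin k, (-1 : ℤ) ^ (i : ℕ) • f i) x = ∑ i : Fin k, (-1 : ℤ) ^ (i : ℕ) • (f i) x := by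
  change (∑ i : Fin k, (-1 : ℤ) ^ (i : ℕ) • f i).hom x = _
  rw [ModuleCat.hom_sum, LinearMap.sum_apply]
  rfl

theorem ee_d_mk (n : ℕ) (σ : ComposableArrows (SingleObj G) (n + 1)) :
    ee G n ((classifyingComplex G).d (n + 1) n (ModuleCat.freeMk (R := ℤ) σ)) =
      d n (triv G ℤ) (ee G (n + 1) (ModuleCat.freeMk (R := ℤ) σ)) := by
  rw [ee_mk, d_Eh]
  have h1 : (classifyingComplex G).d (n + 1) n (ModuleCat.freeMk (R := ℤ) σ) =
      ∑ i : Fin (n + 2), (-1 : ℤ) ^ (i : ℕ) • (sX G).δ i (ModuleCat.freeMk (R := ℤ) σ) :=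
    (congrArg (fun f => f.hom (ModuleCat.freeMk (R := ℤ) σ)) (cc_d n)).trans (sum_app _ _)
  refine (congrArg (ee G n) h1).trans ((map_sum (ee G n) _ _).trans ?_)
  refine Finset.sum_congr rfl fun j _ => ?_
  refine (map_zsmul (ee G n) _ _).trans ?_
  congr 1
  exact (congrArg (ee G n) (sX_face n j σ)).trans (ee_face n j σ)

theorem ee_d (n : ℕ) (x : (classifyingComplex G).X (n + 1)) :
    ee G n ((classifyingComplex G).d (n + 1) n x) = d n (triv G ℤ) (ee G (n + 1) x) := by
  have h : ((ee G n).toAddMonoidHom.toIntLinearMap).comp ((classifyingComplex G).d (n + 1) n).hom =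
      ((d n (triv G ℤ)).toIntLinearMap).comp (ee G (n + 1)).toAddMonoidHom.toIntLinearMap :=
    Finsupp.lhom_ext' fun σ => LinearMap.ext_ring (ee_d_mk n σ)
  exact LinearMap.congr_fun h x

end nerve

section bridge
variable {G : Type} [Group G]

theorem mc_equiv {R : Type} [Ring R] (S : ShortComplex (ModuleCat.{0} R)) {H : Type} [AddCommGroup H]
    (φ : LinearMap.ker S.g.hom →+ H) (hφ : Function.Surjective φ)
    (hk : ∀ x, φ x = 0 ↔ ∃ y, S.f y = x.1) : Nonempty (S.homology ≃+ H) := by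
  have e : (LinearMap.range S.moduleCatToCycles).toAddSubgroup = φ.ker := by
    ext x
    refine Iff.trans ?_ (hk x).symm
    constructor
    · rintro ⟨y, rfl⟩
      exact ⟨y, rfl⟩
    · rintro ⟨y, hy⟩
      exact ⟨y, Subtype.ext hy⟩
  have E : (LinearMap.ker S.g.hom ⧸ LinearMap.range S.moduleCatToCycles) ≃+ H :=
    (QuotientAddGroup.quotientAddEquivOfEq e).trans (QuotientAddGroup.quotientKerEquivOfSurjective φ hφ)
  exact ⟨S.moduleCatHomologyIso.toLinearEquiv.toAddEquiv.trans E⟩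

/-- Comparison of homology groups of short complexes. -/
theorem sc_equiv (S : ShortComplex (ModuleCat.{0} ℤ)) (n : ℕ) (e1 : S.X₁ ≃+ C (n + 2) (triv G ℤ))
    (e2 : S.X₂ ≃+ C (n + 1) (triv G ℤ)) (e3 : S.X₃ ≃+ C n (triv G ℤ))
    (h1 : ∀ x, e2 (S.f x) = d (n + 1) _ (e1 x)) (h2 : ∀ x, e3 (S.g x) = d n _ (e2 x)) :
    Nonempty (S.homology ≃+ HH (n + 1) G) := by
  let K := LinearMap.ker S.g.hom
  let φ : K →+ HH (n + 1) G := (cl (n + 1) (triv G ℤ)).comp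
    (AddMonoidHom.mk' (fun x : K => (⟨e2 x.1, (h2 x.1).symm.trans ((congrArg e3 x.2).trans (map_zero e3))⟩ :
      Z (n + 1) (triv G ℤ))) (fun a b => Subtype.ext (map_add e2 a.1 b.1)))
  have hφ : Function.Surjective φ := by
    intro a
    obtain ⟨c, hc, rfl⟩ := mk_rep a
    refine ⟨⟨e2.symm c, ?_⟩, ?_⟩
    · refine e3.injective ((h2 _).trans ?_)
      rw [AddEquiv.apply_symm_apply, map_zero]
      exact hc
    · exact mk_congr (e2.apply_symm_apply c) _
  have hk : ∀ x, φ x = 0 ↔ ∃ y, S.f y = x.1 := by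
    intro x
    have hm : e2 x.1 ∈ Z (n + 1) (triv G ℤ) :=
      (h2 x.1).symm.trans ((congrArg e3 x.2).trans (map_zero e3))
    have hz := mk_eq_zero (M := triv G ℤ) (e2 x.1) hm
    constructor
    · intro h
      obtain ⟨y, hy⟩ := hz.1 h
      refine ⟨e1.symm y, e2.injective ((h1 _).trans ?_)⟩
      rw [AddEquiv.apply_symm_apply, hy]
    · rintro ⟨y, hy⟩
      exact hz.2 ⟨e1 y, (h1 y).symm.trans (congrArg e2 hy)⟩
  exact mc_equiv S φ hφ hk

theorem bridge (n : ℕ) : Nonempty (grpHomology G (n + 1) ≃+ HH (n + 1) G) := by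
  obtain ⟨e⟩ := sc_equiv (G := G) ((classifyingComplex G).sc' (n + 2) (n + 1) n) n (ee G (n + 2)) (ee G (n + 1)) (ee G n)
    (ee_d (n + 1)) (ee_d n)
  exact ⟨((classifyingComplex G).homologyIsoSc' (n + 2) (n + 1) n (by simp) (by simp)).toLinearEquiv.toAddEquiv.trans e⟩

end bridge
end GH

theorem realization_of_center_H2_H3
    (A B C : Type) [AddCommGroup A] [AddCommGroup B] [AddCommGroup C] :
    ∃ (S : Type) (_ : Group S),
      StronglyTorsionGenerated S ∧
      Nonempty (Subgroup.center S ≃* Multiplicative A) ∧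
      Subsingleton (grpHomology S 1) ∧
      Nonempty (grpHomology S 2 ≃+ B) ∧
      Nonempty (grpHomology S 3 ≃+ C) := by
  obtain ⟨S, _, h1, h2, h3, ⟨e2⟩, ⟨e3⟩⟩ := GH.exists_final A B C
  obtain ⟨b1⟩ := GH.bridge (G := S) 0
  obtain ⟨b2⟩ := GH.bridge (G := S) 1
  obtain ⟨b3⟩ := GH.bridge (G := S) 2
  exact ⟨S, inferInstance, h1, h2, ⟨fun a b => b1.injective ((h3 _).trans (h3 _).symm)⟩, ⟨b2.trans e2⟩, ⟨b3.trans e3⟩⟩
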